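/- Boundary C^{1,ᾱ} estimate for the homogeneous model problem: Let γ < 1 and let u ∈ C(closure Q₁⁺) satisfy u ∈ S(λ,Λ,0) in Q₁⁺, u = 0 on ∂_p Q₁⁺ ∩ {x_n = 0}, and ‖u‖_{L^∞(Q₁⁺)} ≤ 1. Then there exist constants ᾱ ∈ (0,1) depending only on n, λ, Λ, γ, a constant C₁ > 1 depending only on n, λ, Λ, γ, ᾱ, and a real number a with |a| ≤ C₁, such that |u(x,t) − a x_n| ≤ C₁ (|x| + |t|^{1/(2−γ)})^ᾱ x_n for all (x,t) ∈ closure Q_{1/2}⁺. -/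

import Mathlib

noncomputable section

open Real Topology Filter Set MeasureTheory

namespace DPP

/-- Space-time points. -/
abbrev Pt (n : ℕ) := (Fin n → ℝ) × ℝ

/-- The last index of `Fin n`. -/
def lastIdx (n : ℕ) [NeZero n] : Fin n :=
  ⟨n - 1, Nat.sub_lt (Nat.pos_of_ne_zero (NeZero.ne n)) one_pos⟩

/-- The last spatial coordinate `x_n`. -/
def xlast {n : ℕ} [NeZero n] (x : Fin n → ℝ) : ℝ := x (lastIdx n)

/-- Euclidean norm on `Fin n → ℝ`. -/
def eucNorm {n : ℕ} (x : Fin n → ℝ) : ℝ := Real.sqrt (∑ i, (x i) ^ 2)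

/-- Euclidean norm of the first `n-1` coordinates (the `x'` part). -/
def eucNormPrime {n : ℕ} [NeZero n] (x : Fin n → ℝ) : ℝ :=
  Real.sqrt (∑ i, if i = lastIdx n then 0 else (x i) ^ 2)

/-- Frobenius norm of a matrix. -/
def matNorm {n : ℕ} (M : Matrix (Fin n) (Fin n) ℝ) : ℝ :=
  Real.sqrt (∑ i, ∑ j, (M i j) ^ 2)

/-- The intrinsic parabolic quasidistance `|x-y| + |t-s|^(1/(2-γ))`. -/
def pdist {n : ℕ} (γ : ℝ) (p q : Pt n) : ℝ :=
  eucNorm (p.1 - q.1) + |p.2 - q.2| ^ ((1 : ℝ) / (2 - γ))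

/-- The intrinsic cylinder `Q_r(x₀,t₀)`. -/
def Qcyl {n : ℕ} (γ r : ℝ) (x₀ : Fin n → ℝ) (t₀ : ℝ) : Set (Pt n) :=
  {p | eucNorm (p.1 - x₀) < r ∧ t₀ - r ^ (2 - γ) < p.2 ∧ p.2 ≤ t₀}

/-- The upper intrinsic cylinder `Q_r⁺(x₀,t₀)`. -/
def Qp {n : ℕ} [NeZero n] (γ r : ℝ) (x₀ : Fin n → ℝ) (t₀ : ℝ) : Set (Pt n) :=
  {p ∈ Qcyl γ r x₀ t₀ | 0 < xlast p.1}

/-- `Q₁⁺`. -/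
def Q1p (n : ℕ) [NeZero n] (γ : ℝ) : Set (Pt n) := Qp γ 1 (0 : Fin n → ℝ) 0

/-- The parabolic boundary of `Q₁⁺`. -/
def pbQ1p (n : ℕ) [NeZero n] (γ : ℝ) : Set (Pt n) := closure (Q1p n γ) \ Q1p n γ

/-- The flat part `∂_p Q₁⁺ ∩ {x_n = 0}`. -/
def flatQ1p (n : ℕ) [NeZero n] (γ : ℝ) : Set (Pt n) :=
  {p ∈ pbQ1p n γ | xlast p.1 = 0}

/-- Symmetric matrices `A` with `λ I ≤ A ≤ Λ I`. -/
def ellipticMats (n : ℕ) (lam Lam : ℝ) : Set (Matrix (Fin n) (Fin n) ℝ) :=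
  {A | A.IsSymm ∧ ∀ v : Fin n → ℝ,
    lam * ∑ i, (v i) ^ 2 ≤ ∑ i, ∑ j, A i j * v i * v j ∧
    ∑ i, ∑ j, A i j * v i * v j ≤ Lam * ∑ i, (v i) ^ 2}

/-- Pucci maximal operator `𝓜⁺`. -/
def pucciPlus {n : ℕ} (lam Lam : ℝ) (M : Matrix (Fin n) (Fin n) ℝ) : ℝ :=
  sSup ((fun A => (A * M).trace) '' ellipticMats n lam Lam)

/-- Pucci minimal operator `𝓜⁻`. -/
def pucciMinus {n : ℕ} (lam Lam : ℝ) (M : Matrix (Fin n) (Fin n) ℝ) : ℝ :=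
  sInf ((fun A => (A * M).trace) '' ellipticMats n lam Lam)

/-- A test function: continuous, `C¹` in time and `C²` in space. -/
def IsTestFn {n : ℕ} (φ : Pt n → ℝ) : Prop :=
  Continuous φ ∧ (∀ x : Fin n → ℝ, ContDiff ℝ 1 fun t => φ (x, t)) ∧
    ∀ t : ℝ, ContDiff ℝ 2 fun x => φ (x, t)

/-- The time derivative of `φ` at `p`. -/
def timeD {n : ℕ} (φ : Pt n → ℝ) (p : Pt n) : ℝ := deriv (fun s => φ (p.1, s)) p.2

/-- The spatial gradient of `φ` at `p`. -/
def spaceGrad {n : ℕ} (φ : Pt n → ℝ) (p : Pt n) : Fin n → ℝ :=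
  fun i => fderiv ℝ (fun x => φ (x, p.2)) p.1 (Pi.single i 1)

/-- The spatial Hessian of `φ` at `p`. -/
def hess {n : ℕ} (φ : Pt n → ℝ) (p : Pt n) : Matrix (Fin n) (Fin n) ℝ :=
  fun i j =>
    fderiv ℝ (fun x => fderiv ℝ (fun y => φ (y, p.2)) x (Pi.single j 1)) p.1 (Pi.single i 1)

/-- `φ` touches `u` from above at `p` within `Ω`. -/
def TouchAbove {n : ℕ} (u φ : Pt n → ℝ) (Ω : Set (Pt n)) (p : Pt n) : Prop :=
  u p = φ p ∧ ∀ᶠ q in 𝓝[Ω] p, u q ≤ φ q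

/-- `φ` touches `u` from below at `p` within `Ω`. -/
def TouchBelow {n : ℕ} (u φ : Pt n → ℝ) (Ω : Set (Pt n)) (p : Pt n) : Prop :=
  u p = φ p ∧ ∀ᶠ q in 𝓝[Ω] p, φ q ≤ u q

/-- Viscosity subsolution of `u_t - x_n^γ F(D²u, x, t) = f` in `Ω`. -/
def ViscSub {n : ℕ} [NeZero n] (γ : ℝ) (F : Matrix (Fin n) (Fin n) ℝ → Pt n → ℝ)
    (f u : Pt n → ℝ) (Ω : Set (Pt n)) : Prop :=
  ∀ p ∈ Ω, ∀ φ : Pt n → ℝ, IsTestFn φ → TouchAbove u φ Ω p →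
    timeD φ p - xlast p.1 ^ γ * F (hess φ p) p ≤ f p

/-- Viscosity supersolution of `u_t - x_n^γ F(D²u, x, t) = f` in `Ω`. -/
def ViscSuper {n : ℕ} [NeZero n] (γ : ℝ) (F : Matrix (Fin n) (Fin n) ℝ → Pt n → ℝ)
    (f u : Pt n → ℝ) (Ω : Set (Pt n)) : Prop :=
  ∀ p ∈ Ω, ∀ φ : Pt n → ℝ, IsTestFn φ → TouchBelow u φ Ω p →
    f p ≤ timeD φ p - xlast p.1 ^ γ * F (hess φ p) p

/-- The sup norm of `u` over `S`. -/
def supAbs {n : ℕ} (u : Pt n → ℝ) (S : Set (Pt n)) : ℝ := ⨆ p : S, |u ↑p|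

/-- The solution class `S*(λ,Λ,f)` in `Ω`. -/
def InSstar {n : ℕ} [NeZero n] (γ lam Lam : ℝ) (f u : Pt n → ℝ) (Ω : Set (Pt n)) : Prop :=
  ViscSub γ (fun M _ => pucciPlus lam Lam M) (fun _ => supAbs f Ω) u Ω ∧
  ViscSuper γ (fun M _ => pucciMinus lam Lam M) (fun _ => -supAbs f Ω) u Ω

/-- The solution class `S(λ,Λ,0)` in `Ω`. -/
def InS0 {n : ℕ} [NeZero n] (γ lam Lam : ℝ) (u : Pt n → ℝ) (Ω : Set (Pt n)) : Prop :=
  ViscSub γ (fun M _ => pucciPlus lam Lam M) (fun _ => 0) u Ω ∧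
  ViscSuper γ (fun M _ => pucciMinus lam Lam M) (fun _ => 0) u Ω

/-- The boundary `C^{1,ᾱ}` estimate for the homogeneous model problem, with constants
`abar` and `C₁`. -/
def ModelEstimate (n : ℕ) [NeZero n] (γ lam Lam abar C₁ : ℝ) : Prop :=
  ∀ u : Pt n → ℝ, ContinuousOn u (closure (Q1p n γ)) →
    InS0 γ lam Lam u (Q1p n γ) →
    (∀ p ∈ flatQ1p n γ, u p = 0) →
    supAbs u (Q1p n γ) ≤ 1 →
    ∃ a : ℝ, |a| ≤ C₁ ∧ ∀ p ∈ closure (Qp γ (1/2) (0 : Fin n → ℝ) 0),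
      |u p - a * xlast p.1| ≤
        C₁ * (eucNorm p.1 + |p.2| ^ ((1 : ℝ) / (2 - γ))) ^ abar * xlast p.1

/-- Structure condition (F1): uniform parabolicity. -/
def UnifParab (n : ℕ) (lam Lam : ℝ) (F : Matrix (Fin n) (Fin n) ℝ → Pt n → ℝ) : Prop :=
  ∀ M N : Matrix (Fin n) (Fin n) ℝ, M.IsSymm → N.IsSymm → ∀ p : Pt n,
    pucciMinus lam Lam (M - N) ≤ F M p - F N p ∧ F M p - F N p ≤ pucciPlus lam Lam (M - N)

/-- Structure condition (F2): `F` is concave or convex in the matrix variable. -/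
def ConcaveOrConvex (n : ℕ) (F : Matrix (Fin n) (Fin n) ℝ → Pt n → ℝ) : Prop :=
  (∀ p : Pt n, ConvexOn ℝ Set.univ fun M => F M p) ∨
  (∀ p : Pt n, ConcaveOn ℝ Set.univ fun M => F M p)

/-- The Hessian matrix of the quadratic polynomial `P(x) = ∑ i, a i * x i * x n`. -/
def quadMat (n : ℕ) [NeZero n] (a : Fin n → ℝ) : Matrix (Fin n) (Fin n) ℝ :=
  fun i j => (if j = lastIdx n then a i else 0) + (if i = lastIdx n then a j else 0)

/-- The parabolic boundary of a general set `S ⊆ ℝ^{n+1}`. -/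
def pBdry {n : ℕ} (γ : ℝ) (S : Set (Pt n)) : Set (Pt n) :=
  {p ∈ frontier S | ∀ r : ℝ, 0 < r → (Qcyl γ r p.1 p.2 ∩ Sᶜ).Nonempty}

end DPP

open DPP

namespace MBC

/-- Squared Euclidean distance. -/
def ssq {n : ℕ} (z x : Fin n → ℝ) : ℝ := ∑ i, (x i - z i) ^ 2

/-- Supersolutions of `w_t - g M^-(D²w) = 0` in an open set, in a convenient form. -/
def SupOn {n : ℕ} (lam Lam : ℝ) (g : (Fin n → ℝ) → ℝ) (U : Set (Pt n)) (w : Pt n → ℝ) : Prop :=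
  ∀ p ∈ U, ∀ φ : Pt n → ℝ, ContDiff ℝ 2 φ → φ p = w p → (∀ᶠ q in 𝓝 p, φ q ≤ w q) →
    ∀ m : ℝ, (∀ A ∈ ellipticMats n lam Lam, m ≤ (A * hess φ p).trace) →
      g p.1 * m ≤ timeD φ p

lemma globalize {n : ℕ} {φ : Pt n → ℝ} {p : Pt n} (h : ContDiffAt ℝ 2 φ p) :
    ∃ ψ : Pt n → ℝ, ContDiff ℝ 2 ψ ∧ ψ =ᶠ[𝓝 p] φ := by
  obtain ⟨u, hu, hcd⟩ := h.contDiffOn (m := 2) le_rfl (by simp)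
  have hu' : u ∈ 𝓝 p := by simpa using hu
  obtain ⟨r, hr, hru⟩ := Metric.nhds_basis_ball.mem_iff.1 hu'
  let f : ContDiffBump p := ⟨r / 4, r / 2, by linarith, by linarith⟩
  refine ⟨fun q => f q * φ q, ?_, ?_⟩
  · rw [contDiff_iff_contDiffAt]
    intro q
    by_cases hq : dist q p < r
    · have : ContDiffAt ℝ 2 φ q := by
        apply (hcd q (hru hq)).contDiffAt
        filter_upwards [Metric.isOpen_ball.mem_nhds (show q ∈ Metric.ball p r from hq)] with y hy
        exact hru hy
      exact f.contDiffAt.mul this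
    · have hq2 : q ∉ Metric.closedBall p (r / 2) := by
        simp only [Metric.mem_closedBall]; linarith
      have : (fun q => f q * φ q) =ᶠ[𝓝 q] fun _ => 0 := by
        filter_upwards [Metric.isClosed_closedBall.isOpen_compl.mem_nhds hq2] with y hy
        have : f y = 0 := by
          apply f.zero_of_le_dist
          simp at hy
          exact hy.le
        simp [this]
      exact contDiffAt_const.congr_of_eventuallyEq this
  · filter_upwards [f.eventuallyEq_one] with y hy
    simp [hy]

lemma hess_congr {n : ℕ} {φ ψ : Pt n → ℝ} {p : Pt n} (h : ψ =ᶠ[𝓝 p] φ) :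
    hess ψ p = hess φ p := by
  have h1 : ∀ᶠ x in 𝓝 p.1, ψ (x, p.2) = φ (x, p.2) := by
    have : Tendsto (fun x : Fin n → ℝ => (x, p.2)) (𝓝 p.1) (𝓝 p) := by
      have : Continuous (fun x : Fin n → ℝ => (x, p.2)) := by fun_prop
      exact this.tendsto p.1
    exact this.eventually h
  ext i j
  unfold hess
  congr 1
  apply Filter.EventuallyEq.fderiv_eq
  filter_upwards [h1.eventually_nhds] with x hx
  have : (fun y => ψ (y, p.2)) =ᶠ[𝓝 x] (fun y => φ (y, p.2)) := hx
  rw [this.fderiv_eq]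

lemma timeD_congr {n : ℕ} {φ ψ : Pt n → ℝ} {p : Pt n} (h : ψ =ᶠ[𝓝 p] φ) :
    timeD ψ p = timeD φ p := by
  have h1 : ∀ᶠ x in 𝓝 p.2, ψ (p.1, x) = φ (p.1, x) := by
    have : Tendsto (fun x : ℝ => (p.1, x)) (𝓝 p.2) (𝓝 p) := by
      have : Continuous (fun x : ℝ => (p.1, x)) := by fun_prop
      exact this.tendsto p.2
    exact this.eventually h
  unfold timeD
  exact Filter.EventuallyEq.deriv_eq h1

lemma timeD_diff {n : ℕ} {φ : Pt n → ℝ} {p : Pt n} (h : ContDiffAt ℝ 2 φ p) :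
    DifferentiableAt ℝ (fun s => φ (p.1, s)) p.2 := by
  have h1 : DifferentiableAt ℝ φ (p.1, p.2) := h.differentiableAt (by norm_num)
  exact DifferentiableAt.comp (g := φ) (f := fun s : ℝ => (p.1, s)) p.2 h1 (by fun_prop)

lemma comparison {n : ℕ} {lam Lam : ℝ} {g : (Fin n → ℝ) → ℝ} {U : Set (Pt n)} {w φ : Pt n → ℝ}
    (hs : SupOn lam Lam g U w) {K : Set (Pt n)} (hK : IsCompact K) {T : ℝ}
    (hT : ∀ p ∈ K, p.2 ≤ T) (hw : ContinuousOn w K) (hφ : ContinuousOn φ K)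
    (hcl : ∀ p ∈ K, p.2 = T → w p < φ p → p ∈ closure (K ∩ {q | q.2 < T}))
    (hin : ∀ p ∈ K, p.2 < T → w p < φ p → p ∈ U ∧ K ∈ 𝓝 p ∧ ContDiffAt ℝ 2 φ p ∧
      ∃ m, (∀ A ∈ ellipticMats n lam Lam, m ≤ (A * hess φ p).trace) ∧ timeD φ p < g p.1 * m) :
    ∀ p ∈ K, φ p ≤ w p := by
  by_contra hcon
  push Not at hcon
  obtain ⟨p₀, hp₀, hlt₀⟩ := hcon
  -- a bad point strictly before `T`
  obtain ⟨p₁, hp₁, hp₁T, hlt₁⟩ : ∃ p ∈ K, p.2 < T ∧ w p < φ p := by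
    rcases (hT p₀ hp₀).lt_or_eq with h | h
    · exact ⟨p₀, hp₀, h, hlt₀⟩
    · have h1 := hcl p₀ hp₀ h hlt₀
      have h2 : ∀ᶠ q in 𝓝[K] p₀, w q < φ q :=
        (hw p₀ hp₀).eventually_lt (hφ p₀ hp₀) hlt₀
      rw [mem_closure_iff_frequently] at h1
      rw [eventually_nhdsWithin_iff] at h2
      obtain ⟨q, hq, hq2⟩ := (h1.and_eventually h2).exists
      exact ⟨q, hq.1, hq.2, hq2 hq.1⟩
  -- bound
  obtain ⟨L, hL⟩ := hK.exists_bound_of_continuousOn (hφ.sub hw)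
  have hL0 : 0 ≤ L := le_trans (norm_nonneg _) (hL p₀ hp₀)
  have hlim : Tendsto (fun k : ℝ => L * Real.exp (-(k * (T - p₁.2)))) atTop (𝓝 (L * 0)) := by
    apply Tendsto.const_mul
    apply Real.tendsto_exp_neg_atTop_nhds_zero.comp
    exact tendsto_id.atTop_mul_const (by linarith)
  rw [mul_zero] at hlim
  obtain ⟨k, hk, hk0⟩ := ((hlim.eventually (gt_mem_nhds (show 0 < φ p₁ - w p₁ by linarith))).and
    (eventually_ge_atTop 0)).exists
  set f : Pt n → ℝ := fun q => w q - φ q + L * Real.exp (k * (q.2 - T)) with hf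
  have hfc : ContinuousOn f K := by
    apply (hw.sub hφ).add
    fun_prop
  obtain ⟨p, hp, hmin⟩ := hK.exists_isMinOn ⟨p₀, hp₀⟩ hfc
  have hfp : f p < 0 := by
    refine lt_of_le_of_lt (hmin hp₁) ?_
    simp only [hf]
    have : k * (p₁.2 - T) = -(k * (T - p₁.2)) := by ring
    rw [this]; linarith
  have hlt : w p < φ p := by
    have : 0 ≤ L * Real.exp (k * (p.2 - T)) := by positivity
    simp only [hf] at hfp; linarith
  have hpT : p.2 < T := by
    rcases (hT p hp).lt_or_eq with h | h
    · exact h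
    · exfalso
      have h1 := hL p hp
      simp only [hf, h, sub_self, mul_zero, Real.exp_zero, mul_one] at hfp
      rw [Real.norm_eq_abs] at h1
      have := le_abs_self (φ p - w p)
      simp at h1
      linarith
  obtain ⟨hpU, hKp, hφp, m, hm, hlt2⟩ := hin p hp hpT hlt
  set ψ : Pt n → ℝ := fun q => φ q + (-(L * Real.exp (k * (q.2 - T))) + f p) with hψ
  have hψc : ContDiffAt ℝ 2 ψ p := by
    apply hφp.add
    have : ContDiff ℝ 2 (fun q : Pt n => -(L * Real.exp (k * (q.2 - T))) + f p) := by fun_prop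
    exact this.contDiffAt
  obtain ⟨χ, hχ, hχe⟩ := globalize hψc
  have h1 := hs p hpU χ hχ (by rw [hχe.eq_of_nhds]; simp [hψ, hf]) (by
    filter_upwards [hχe, hKp] with q hq hqK
    rw [hq]
    have : f p ≤ f q := hmin hqK
    simp only [hψ, hf] at this ⊢
    linarith) m (by
      intro A hA
      rw [hess_congr hχe]
      have : hess ψ p = hess φ p := by
        ext i j
        unfold hess
        simp only [hψ, fderiv_add_const]
      rw [this]
      exact hm A hA)
  rw [timeD_congr hχe] at h1
  have h2 : timeD ψ p = timeD φ p - L * (Real.exp (k * (p.2 - T)) * k) := by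
    have hd := (timeD_diff hφp).hasDerivAt
    have he : HasDerivAt (fun s : ℝ => -(L * Real.exp (k * (s - T))) + f p)
        (-(L * (Real.exp (k * (p.2 - T)) * (k * 1)))) p.2 := by
      have := (((hasDerivAt_id p.2).sub_const T).const_mul k).exp.const_mul L
      exact (this.neg).add_const (f p)
    have := (hd.add he).deriv
    unfold timeD
    rw [mul_one] at this
    exact this
  have h3 : 0 ≤ L * (Real.exp (k * (p.2 - T)) * k) := by positivity
  linarith

end MBC

namespace MBC

lemma ell_diag {n : ℕ} {l L : ℝ} {A : Matrix (Fin n) (Fin n) ℝ} (hA : A ∈ ellipticMats n l L)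
    (i : Fin n) : l ≤ A i i ∧ A i i ≤ L := by
  have h := hA.2 (Pi.single i 1)
  have h1 : ∑ j, (Pi.single i (1:ℝ) : Fin n → ℝ) j ^ 2 = 1 := by
    rw [Finset.sum_eq_single i] <;> simp +contextual
  have h2 : ∑ a, ∑ b, A a b * (Pi.single i (1:ℝ) : Fin n → ℝ) a * (Pi.single i (1:ℝ) : Fin n → ℝ) b
      = A i i := by
    rw [Finset.sum_eq_single i, Finset.sum_eq_single i] <;> simp +contextual
  rw [h1, h2] at h
  simpa using h

lemma hasFDerivAt_ssq {n : ℕ} (z x : Fin n → ℝ) :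
    HasFDerivAt (ssq z) (∑ i, (2 * (x i - z i)) •
      (ContinuousLinearMap.proj i : (Fin n → ℝ) →L[ℝ] ℝ)) x := by
  unfold ssq
  apply HasFDerivAt.fun_sum
  intro i _
  have h := ((ContinuousLinearMap.proj (R := ℝ) (φ := fun _ : Fin n => ℝ) i).hasFDerivAt
    (x := x)).sub_const (z i)
  have h2 := (h.pow 2).congr_fderiv (f' := _) (g' := (2 * (x i - z i)) •
      (ContinuousLinearMap.proj i : (Fin n → ℝ) →L[ℝ] ℝ)) (by ext v; simp)
  exact h2

lemma fderiv_ssq_apply {n : ℕ} (x z : Fin n → ℝ) (j : Fin n) :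
    (∑ i, (2 * (x i - z i)) • (ContinuousLinearMap.proj i : (Fin n → ℝ) →L[ℝ] ℝ))
      (Pi.single j 1) = 2 * (x j - z j) := by
  simp [ContinuousLinearMap.sum_apply, Pi.single_apply]

lemma fderiv_quad {n : ℕ} (y z x : Fin n → ℝ) (c0 c1 c2 c3 : ℝ) (j : Fin n) :
    fderiv ℝ (fun x => c0 + c1 * ssq y x + c2 * (c3 - ssq z x) ^ 2) x (Pi.single j 1) =
      2 * c1 * (x j - y j) - 4 * c2 * (c3 - ssq z x) * (x j - z j) := by
  have h1 := ((hasFDerivAt_ssq y x).const_mul c1).const_add c0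
  have h2 := (((hasFDerivAt_ssq z x).const_sub c3).pow 2).const_mul c2
  have h3 := (h1.add h2).fderiv
  have : (fun x => c0 + c1 * ssq y x + c2 * (c3 - ssq z x) ^ 2) =
    ((fun x => c0 + c1 * ssq y x) + fun x => c2 * (c3 - ssq z x) ^ 2) := rfl
  rw [this, h3]
  simp only [ContinuousLinearMap.add_apply, ContinuousLinearMap.smul_apply,
    ContinuousLinearMap.neg_apply, fderiv_ssq_apply, smul_eq_mul]
  simp
  ring

lemma hess_quad {n : ℕ} (y z : Fin n → ℝ) (c0 c1 c2 c3 : ℝ → ℝ) (p : Pt n) (i j : Fin n) :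
    hess (fun q : Pt n => c0 q.2 + c1 q.2 * ssq y q.1 + c2 q.2 * (c3 q.2 - ssq z q.1) ^ 2) p i j =
      (if i = j then 2 * c1 p.2 - 4 * c2 p.2 * (c3 p.2 - ssq z p.1) else 0)
        + 8 * c2 p.2 * (p.1 i - z i) * (p.1 j - z j) := by
  unfold hess
  simp only [fderiv_quad]
  have hp : ∀ (z : Fin n → ℝ), HasFDerivAt (fun x : Fin n → ℝ => x j - z j)
      (ContinuousLinearMap.proj j : (Fin n → ℝ) →L[ℝ] ℝ) p.1 := fun z =>
    ((ContinuousLinearMap.proj (R := ℝ) (φ := fun _ : Fin n => ℝ) j).hasFDerivAt).sub_const (z j)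
  have h1 := (hp y).const_mul (2 * c1 p.2)
  have h2 := (((hasFDerivAt_ssq z p.1).const_sub (c3 p.2)).const_mul (4 * c2 p.2)).mul (hp z)
  have h3 := (h1.sub h2).fderiv
  have : (fun x : Fin n → ℝ => 2 * c1 p.2 * (x j - y j)
      - 4 * c2 p.2 * (c3 p.2 - ssq z x) * (x j - z j)) =
    ((fun x => 2 * c1 p.2 * (x j - y j)) - fun x => 4 * c2 p.2 * (c3 p.2 - ssq z x) * (x j - z j)) := rfl
  rw [this]
  erw [h3]
  simp only [ContinuousLinearMap.add_apply, ContinuousLinearMap.smul_apply,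
    ContinuousLinearMap.neg_apply, ContinuousLinearMap.sub_apply, fderiv_ssq_apply, smul_eq_mul,
    ContinuousLinearMap.proj_apply, Pi.single_apply]
  by_cases hij : i = j
  · subst hij; simp; ring
  · have : ¬ j = i := fun h => hij h.symm
    simp [hij, this]; ring

lemma trace_quad {n : ℕ} {l L : ℝ} {A : Matrix (Fin n) (Fin n) ℝ} (hA : A ∈ ellipticMats n l L)
    (v : Fin n → ℝ) (a b : ℝ) (ha : a ≤ 0) (hb : 0 ≤ b) (H : Matrix (Fin n) (Fin n) ℝ)
    (hH : ∀ i j, H i j = (if i = j then a else 0) + b * v i * v j) :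
    a * (n * L) + b * (l * ∑ i, v i ^ 2) ≤ (A * H).trace := by
  have h1 : (A * H).trace = a * ∑ i, A i i + b * ∑ i, ∑ j, A i j * v i * v j := by
    simp only [Matrix.trace, Matrix.diag, Matrix.mul_apply, hH, mul_add, Finset.sum_add_distrib,
      Finset.mul_sum]
    congr 1
    · refine Finset.sum_congr rfl fun i _ => ?_
      rw [Finset.sum_eq_single i] <;> simp +contextual [mul_comm]
    · refine Finset.sum_congr rfl fun i _ => Finset.sum_congr rfl fun j _ => ?_
      ring
  have h2 : ∑ i, A i i ≤ n * L := by
    calc ∑ i, A i i ≤ ∑ _i : Fin n, L := Finset.sum_le_sum fun i _ => (ell_diag hA i).2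
      _ = n * L := by simp
  rw [h1]
  have h3 := (hA.2 v).1
  nlinarith [mul_le_mul_of_nonneg_left h3 hb]

lemma ssq_continuous {n : ℕ} (z : Fin n → ℝ) : Continuous (ssq z) := by
  unfold ssq; fun_prop

lemma ssq_contDiff {n : ℕ} (z : Fin n → ℝ) : ContDiff ℝ 2 (ssq z) := by
  unfold ssq; fun_prop

lemma ssq_nonneg {n : ℕ} (z x : Fin n → ℝ) : 0 ≤ ssq z x :=
  Finset.sum_nonneg fun _ _ => sq_nonneg _

lemma sq_le_ssq {n : ℕ} (z x : Fin n → ℝ) (i : Fin n) : (x i - z i) ^ 2 ≤ ssq z x :=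
  Finset.single_le_sum (f := fun i => (x i - z i) ^ 2) (fun _ _ => sq_nonneg _) (Finset.mem_univ i)

lemma norm_le_of_ssq {n : ℕ} {z x : Fin n → ℝ} {r : ℝ} (hr : 0 ≤ r) (h : ssq z x ≤ r ^ 2) :
    ‖x - z‖ ≤ r := by
  rw [pi_norm_le_iff_of_nonneg hr]
  intro i
  rw [Real.norm_eq_abs]
  apply abs_le_of_sq_le_sq _ hr
  exact (sq_le_ssq z x i).trans h

lemma ssq_le_of_norm {n : ℕ} {z x : Fin n → ℝ} {r : ℝ} (h : ‖x - z‖ ≤ r) :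
    ssq z x ≤ n * r ^ 2 := by
  have hr : 0 ≤ r := (norm_nonneg _).trans h
  calc ssq z x ≤ ∑ _i : Fin n, r ^ 2 := by
        apply Finset.sum_le_sum
        intro i _
        have := (norm_le_pi_norm (x - z) i).trans h
        rw [Real.norm_eq_abs] at this
        exact sq_le_sq' (by have := neg_abs_le ((x-z) i); simp at *; linarith) ((le_abs_self _).trans this)
    _ = n * r ^ 2 := by simp

lemma barrier_alg {C β nL l s q k S : ℝ} (hC : C = 2 * β + 4 * nL + 8 * l)
    (hquad : C * s ≤ q * s ^ 2 + 4 * l * k) (h : 8 * l * k ≤ 8 * l * (s + S)) :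
    4 * l * k ≤ 8 * l * S - 4 * s * nL - 2 * β * s + q * s ^ 2 := by
  have : C * s = 2 * β * s + 4 * s * nL + 8 * l * s := by rw [hC]; ring
  linarith

set_option maxHeartbeats 1000000 in
/-- Interior barrier lemma. -/
lemma barrier {n : ℕ} {l L : ℝ} (hl : 0 < l) (hL : l ≤ L) {U : Set (Pt n)} {w : Pt n → ℝ}
    (hs : SupOn l L (fun _ => 1) U w) (hw : ContinuousOn w U)
    (y z : Fin n → ℝ) {κ R β t1 t2 q m H K0 a : ℝ} (hκ : 0 < κ) (ht : t1 < t2) (hβ : 0 ≤ β)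
    (hR : κ ^ 2 + β * (t2 - t1) = R ^ 2) (ha : 0 ≤ a) (hm : 0 < m) (hq0 : 0 ≤ q)
    (hq : (2 * β + 4 * (n * L) + 8 * l) ^ 2 ≤ 16 * l * κ ^ 2 * q)
    (hmm : K0 + 2 * a * (n * L) < 4 * l * m / κ ^ 2 * Real.exp (-(q * (t2 - t1))))
    (hD : ∀ x t, ssq z x ≤ R ^ 2 → t1 ≤ t → t ≤ t2 → (x, t) ∈ U)
    (hpos : ∀ x t, ssq z x ≤ R ^ 2 → t1 ≤ t → t ≤ t2 → H + K0 * t - a * ssq y x ≤ w (x, t))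
    (hinit : ∀ x, ssq z x ≤ κ ^ 2 → H + K0 * t1 - a * ssq y x + m ≤ w (x, t1)) :
    ∀ x, ssq z x ≤ R ^ 2 → H + K0 * t2 - a * ssq y x
      + m / κ ^ 4 * Real.exp (-(q * (t2 - t1))) * (R ^ 2 - ssq z x) ^ 2 ≤ w (x, t2) := by
  set c2 : ℝ → ℝ := fun t => m / κ ^ 4 * Real.exp (-(q * (t - t1))) with hc2
  set c3 : ℝ → ℝ := fun t => κ ^ 2 + β * (t - t1) with hc3
  set φ : Pt n → ℝ := fun p => (H + K0 * p.2) + (-a) * ssq y p.1 + c2 p.2 * (c3 p.2 - ssq z p.1) ^ 2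
    with hφ
  set K : Set (Pt n) := {p | t1 ≤ p.2 ∧ p.2 ≤ t2 ∧ ssq z p.1 ≤ c3 p.2} with hKdef
  have hc3R : ∀ t, t ≤ t2 → c3 t ≤ R ^ 2 := by
    intro t h; rw [← hR]; simp only [hc3]; gcongr
  have hKU : K ⊆ U := fun p hp => hD p.1 p.2 (hp.2.2.trans (hc3R _ hp.2.1)) hp.1 hp.2.1
  have hsc : Continuous fun p : Pt n => ssq z p.1 := (ssq_continuous z).comp continuous_fst
  have hsc' : Continuous fun p : Pt n => ssq y p.1 := (ssq_continuous y).comp continuous_fst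
  have hφs : ContDiff ℝ 2 φ := by
    have h1 : ContDiff ℝ 2 fun p : Pt n => ssq z p.1 := (ssq_contDiff z).comp contDiff_fst
    have h2 : ContDiff ℝ 2 fun p : Pt n => ssq y p.1 := (ssq_contDiff y).comp contDiff_fst
    simp only [hφ, hc2, hc3]
    fun_prop
  have hKc : IsCompact K := by
    apply Metric.isCompact_of_isClosed_isBounded
    · apply IsClosed.and (isClosed_le continuous_const continuous_snd)
      apply IsClosed.and (isClosed_le continuous_snd continuous_const)
      apply isClosed_le hsc
      simp only [hc3]; fun_prop
    · apply (Metric.isBounded_closedBall (x := z) (r := |R|)).prod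
        (Metric.isBounded_Icc t1 t2) |>.subset
      intro p hp
      refine ⟨?_, hp.1, hp.2.1⟩
      rw [mem_closedBall_iff_norm]
      apply norm_le_of_ssq (abs_nonneg R)
      rw [sq_abs]
      exact hp.2.2.trans (hc3R _ hp.2.1)
  have hbad : ∀ p ∈ K, w p < φ p → t1 < p.2 ∧ ssq z p.1 < c3 p.2 := by
    intro p hp hlt
    have hpos' := hpos p.1 p.2 (hp.2.2.trans (hc3R _ hp.2.1)) hp.1 hp.2.1
    constructor
    · rcases hp.1.lt_or_eq with h | h
      · exact h
      · exfalso
        have h3 : ssq z p.1 ≤ κ ^ 2 := by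
          have := hp.2.2; simp only [hc3, ← h] at this; simpa using this
        have h2 := hinit p.1 h3
        have h4 : φ p ≤ H + K0 * t1 - a * ssq y p.1 + m := by
          simp only [hφ, hc2, hc3, ← h, sub_self, mul_zero, neg_zero, Real.exp_zero, add_zero,
            mul_one]
          have h5 : (κ ^ 2 - ssq z p.1) ^ 2 ≤ κ ^ 4 := by
            have := ssq_nonneg z p.1
            nlinarith
          have : m / κ ^ 4 * (κ ^ 2 - ssq z p.1) ^ 2 ≤ m / κ ^ 4 * κ ^ 4 := by gcongr
          rw [div_mul_cancel₀ _ (by positivity)] at this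
          linarith
        have : w p = w (p.1, t1) := by rw [h]
        linarith
    · rcases hp.2.2.lt_or_eq with h | h
      · exact h
      · exfalso
        have : φ p = H + K0 * p.2 - a * ssq y p.1 := by
          simp only [hφ, h]; ring
        have e : w p = w (p.1, p.2) := rfl
        linarith
  have main := comparison hs hKc (T := t2) (φ := φ) (fun p hp => hp.2.1) (hw.mono hKU)
    hφs.continuous.continuousOn ?_ ?_
  · intro x hx
    have h := main (x, t2) ⟨ht.le, le_rfl, by simpa only [hc3, hR] using hx⟩
    simp only [hφ, hc2, hc3, hR] at h
    linarith
  · intro p hp hpt hlt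
    obtain ⟨h1, h2⟩ := hbad p hp hlt
    have hev : ∀ᶠ s in 𝓝[<] t2, (p.1, s) ∈ K ∩ {q | q.2 < t2} := by
      have e1 : ∀ᶠ s in 𝓝 t2, ssq z p.1 < c3 s := by
        have : ContinuousAt c3 t2 := by simp only [hc3]; fun_prop
        exact this.eventually (lt_mem_nhds (hpt ▸ h2))
      filter_upwards [nhdsWithin_le_nhds e1, self_mem_nhdsWithin,
        nhdsWithin_le_nhds (lt_mem_nhds ht)] with s hs1 hs2 hs3
      exact ⟨⟨hs3.le, le_of_lt hs2, hs1.le⟩, hs2⟩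
    apply mem_closure_of_tendsto _ hev
    have : Continuous fun s : ℝ => (p.1, s) := by fun_prop
    have := (this.tendsto t2).mono_left (nhdsWithin_le_nhds (s := Iio t2))
    rwa [show ((p.1, t2) : Pt n) = p from by rw [← hpt]] at this
  · intro p hp hpt hlt
    obtain ⟨h1, h2⟩ := hbad p hp hlt
    refine ⟨hKU hp, ?_, hφs.contDiffAt, ?_⟩
    · have o : IsOpen {p : Pt n | t1 < p.2 ∧ p.2 < t2 ∧ ssq z p.1 < c3 p.2} := by
        apply IsOpen.and (isOpen_lt continuous_const continuous_snd)
        apply IsOpen.and (isOpen_lt continuous_snd continuous_const)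
        apply isOpen_lt hsc
        simp only [hc3]; fun_prop
      exact mem_of_superset (o.mem_nhds ⟨h1, hpt, h2⟩) fun q hq => ⟨hq.1.le, hq.2.1.le, hq.2.2.le⟩
    · set s := c3 p.2 - ssq z p.1 with hsdef
      have hspos : 0 < s := by linarith
      have hc2pos : 0 < c2 p.2 := by simp only [hc2]; positivity
      refine ⟨(2 * (-a) - 4 * c2 p.2 * s) * (n * L) + 8 * c2 p.2 * (l * ssq z p.1), ?_, ?_⟩
      · intro A hA
        have := trace_quad hA (fun i => p.1 i - z i) (2 * (-a) - 4 * c2 p.2 * s) (8 * c2 p.2)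
          (by nlinarith [mul_pos hc2pos hspos]) (by linarith) (hess φ p)
          (fun i j => by
            have := hess_quad y z (fun t => H + K0 * t) (fun _ => -a) c2 c3 p i j
            simpa only [hφ, hsdef] using this)
        exact this
      · have htd : timeD φ p = K0 + c2 p.2 * (2 * β * s - q * s ^ 2) := by
          unfold timeD
          have d1 : HasDerivAt (fun t : ℝ => H + K0 * t + (-a) * ssq y p.1) (K0 * 1) p.2 :=
            (((hasDerivAt_id p.2).const_mul K0).const_add H).add_const _
          have d2 : HasDerivAt c2 (m / κ ^ 4 * (Real.exp (-(q * (p.2 - t1))) * (-(q * 1)))) p.2 :=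
            (((hasDerivAt_id p.2).sub_const t1).const_mul q).neg.exp.const_mul _
          have d3 : HasDerivAt (fun t => (c3 t - ssq z p.1)) (β * 1) p.2 :=
            ((((hasDerivAt_id p.2).sub_const t1).const_mul β).const_add (κ ^ 2)).sub_const _
          have := (d1.add (d2.mul (d3.pow 2))).deriv
          have e : (fun t => φ (p.1, t)) = ((fun t : ℝ => H + K0 * t + (-a) * ssq y p.1) +
            c2 * (fun t => (c3 t - ssq z p.1)) ^ 2) := by
            ext t; simp [hφ]
          rw [e, this]
          simp only [hc2, Pi.pow_apply, ← hsdef]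
          norm_num
          ring
        rw [htd, one_mul]
        have hRt : κ ^ 2 ≤ s + ssq z p.1 := by
          have : 0 ≤ β * (p.2 - t1) := mul_nonneg hβ (by linarith)
          simp only [hsdef, hc3]; linarith
        have hE : m / κ ^ 4 * Real.exp (-(q * (t2 - t1))) ≤ c2 p.2 := by
          simp only [hc2]
          gcongr
        set C := 2 * β + 4 * (n * L) + 8 * l
        have hquad : C * s ≤ q * s ^ 2 + 4 * l * κ ^ 2 := by
          -- discriminant
          have hk : 0 < 4 * l * κ ^ 2 := by positivity
          have : (C * s) ^ 2 ≤ (q * s ^ 2 + 4 * l * κ ^ 2) ^ 2 := by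
            have : C ^ 2 * s ^ 2 ≤ 16 * l * κ ^ 2 * q * s ^ 2 := by gcongr
            nlinarith [sq_nonneg (q * s ^ 2 - 4 * l * κ ^ 2)]
          exact le_of_sq_le_sq this (by positivity)
        have key : 4 * l * κ ^ 2 ≤ 8 * l * ssq z p.1 - 4 * s * (n * L) - 2 * β * s + q * s ^ 2 := by
          have : 8 * l * κ ^ 2 ≤ 8 * l * (s + ssq z p.1) := by gcongr
          exact barrier_alg rfl hquad this
        have : c2 p.2 * (4 * l * κ ^ 2) ≤ c2 p.2 *
            (8 * l * ssq z p.1 - 4 * s * (n * L) - 2 * β * s + q * s ^ 2) := by gcongr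
        have h6 : 4 * l * m / κ ^ 2 * Real.exp (-(q * (t2 - t1))) ≤ c2 p.2 * (4 * l * κ ^ 2) := by
          calc _ = (m / κ ^ 4 * Real.exp (-(q * (t2 - t1)))) * (4 * l * κ ^ 2) := by
                field_simp
            _ ≤ _ := by gcongr
        have e1 : c2 p.2 * (8 * l * ssq z p.1 - 4 * s * (n * L) - 2 * β * s + q * s ^ 2)
          = 8 * c2 p.2 * (l * ssq z p.1) - 4 * c2 p.2 * s * (n * L) -
            c2 p.2 * (2 * β * s - q * s ^ 2) := by ring
        have e2 : (2 * (-a) - 4 * c2 p.2 * s) * (n * L) =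
          - (2 * a * (n * L)) - 4 * c2 p.2 * s * (n * L) := by ring
        rw [e2]
        linarith

end MBC

namespace MBC

lemma SupOn.mono {n : ℕ} {lam Lam : ℝ} {g : (Fin n → ℝ) → ℝ} {U V : Set (Pt n)} {w : Pt n → ℝ}
    (h : SupOn lam Lam g U w) (hV : V ⊆ U) : SupOn lam Lam g V w :=
  fun p hp => h p (hV hp)

lemma SupOn.congr_g {n : ℕ} {lam Lam : ℝ} {g g' : (Fin n → ℝ) → ℝ} {U : Set (Pt n)} {w : Pt n → ℝ}
    (h : SupOn lam Lam g U w) (hg : ∀ p ∈ U, g' p.1 = g p.1) : SupOn lam Lam g' U w := by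
  intro p hp φ h1 h2 h3 m h4
  rw [hg p hp]
  exact h p hp φ h1 h2 h3 m h4

lemma fderiv_const_mul_any {n : ℕ} (c : ℝ) (f : (Fin n → ℝ) → ℝ) (x : Fin n → ℝ) :
    fderiv ℝ (fun y => c * f y) x = c • fderiv ℝ f x := by
  have := congrFun (fderiv_const_smul_field (𝕜 := ℝ) (f := f) c) x
  exact this

lemma SupOn.affine {n : ℕ} {lam Lam : ℝ} {g : (Fin n → ℝ) → ℝ} {U : Set (Pt n)} {w : Pt n → ℝ}
    (h : SupOn lam Lam g U w) (x0 : Fin n → ℝ) (t0 : ℝ) {c r s : ℝ} (hc : 0 < c) (hr : 0 < r)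
    (hs : 0 < s) : SupOn lam Lam (fun x => s / r ^ 2 * g (x0 + r • x))
      {p | (x0 + r • p.1, t0 + s * p.2) ∈ U} (fun p => c * w (x0 + r • p.1, t0 + s * p.2)) := by
  intro p hp φ hφ heq hle m hm
  set ψ : Pt n → ℝ := fun q => c⁻¹ * φ (r⁻¹ • (q.1 - x0), s⁻¹ * (q.2 - t0)) with hψ
  set p' : Pt n := (x0 + r • p.1, t0 + s * p.2) with hp'
  have e1 : r⁻¹ • (p'.1 - x0) = p.1 := by
    simp only [hp', add_sub_cancel_left, smul_smul]; rw [inv_mul_cancel₀ hr.ne', one_smul]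
  have e2 : s⁻¹ * (p'.2 - t0) = p.2 := by
    simp only [hp']; field_simp; ring
  have hψc : ContDiff ℝ 2 ψ := by
    simp only [hψ]
    apply contDiff_const.mul
    apply hφ.comp
    fun_prop
  have hH : hess ψ p' = (c⁻¹ * (r⁻¹ * r⁻¹)) • hess φ p := by
    ext i j
    have d : ∀ x, fderiv ℝ (fun y => ψ (y, p'.2)) x (Pi.single j 1) =
        (c⁻¹ * r⁻¹) * (fderiv ℝ (fun y => φ (y, p.2)) (r⁻¹ • (x - x0)) (Pi.single j 1)) := by
      intro x
      simp only [hψ, e2]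
      rw [fderiv_const_mul_any (f := fun y => φ (r⁻¹ • (y - x0), p.2))]
      rw [fderiv_comp_sub (f := fun z => φ (r⁻¹ • z, p.2)) x0]
      rw [fderiv_comp_smul (f := fun z => φ (z, p.2))]
      simp [mul_assoc]
    unfold hess
    simp only [d]
    rw [fderiv_const_mul_any (f := fun x => fderiv ℝ (fun y => φ (y, p.2)) (r⁻¹ • (x - x0)) (Pi.single j 1))]
    rw [fderiv_comp_sub (f := fun z => fderiv ℝ (fun y => φ (y, p.2)) (r⁻¹ • z) (Pi.single j 1)) x0]
    rw [fderiv_comp_smul (f := fun z => fderiv ℝ (fun y => φ (y, p.2)) z (Pi.single j 1))]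
    rw [e1]
    simp only [smul_apply, smul_eq_mul]
    show _ = (c⁻¹ * (r⁻¹ * r⁻¹)) * _
    rw [mul_assoc, mul_assoc, mul_assoc]
  have hT : timeD ψ p' = (c⁻¹ * s⁻¹) * timeD φ p := by
    unfold timeD
    simp only [hψ, e1]
    rw [deriv_const_mul_field]
    have := deriv_comp_sub_const (f := fun z => φ (p.1, s⁻¹ * z)) t0 p'.2
    rw [this]
    have := deriv_comp_mul_left s⁻¹ (fun z => φ (p.1, z)) (p'.2 - t0)
    rw [this, e2]
    simp [mul_assoc]
  have hev : ∀ᶠ q in 𝓝 p', ψ q ≤ w q := by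
    have hcont : Continuous fun q : Pt n => (r⁻¹ • (q.1 - x0), s⁻¹ * (q.2 - t0)) := by fun_prop
    have ht := hcont.tendsto p'
    simp only [e1, e2] at ht
    filter_upwards [ht.eventually hle] with q hq
    have f1 : x0 + r • r⁻¹ • (q.1 - x0) = q.1 := by
      rw [smul_smul, mul_inv_cancel₀ hr.ne', one_smul]; simp
    have f2 : t0 + s * (s⁻¹ * (q.2 - t0)) = q.2 := by field_simp; ring
    simp only [f1, f2] at hq
    simp only [hψ]
    rw [inv_mul_le_iff₀ hc]
    exact hq
  have := h p' hp ψ hψc (by simp only [hψ, e1, e2]; rw [heq]; field_simp; simp [hp']) hev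
    (c⁻¹ * (r⁻¹ * r⁻¹) * m) (by
      intro A hA
      rw [hH, Matrix.mul_smul, Matrix.trace_smul, smul_eq_mul]
      exact mul_le_mul_of_nonneg_left (hm A hA) (by positivity))
  rw [hT] at this
  have h5 := mul_le_mul_of_nonneg_left this (show 0 ≤ c * s by positivity)
  calc s / r ^ 2 * g (x0 + r • p.1) * m = c * s * (g p'.1 * (c⁻¹ * (r⁻¹ * r⁻¹) * m)) := by
        field_simp; simp [hp']; ring
    _ ≤ _ := h5
    _ = timeD φ p := by field_simp

lemma SupOn.const_mul {n : ℕ} {lam Lam : ℝ} {g : (Fin n → ℝ) → ℝ} {U : Set (Pt n)} {w : Pt n → ℝ}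
    (h : SupOn lam Lam g U w) {c : ℝ} (hc : 0 < c) : SupOn lam Lam g U (fun p => c * w p) := by
  have := h.affine 0 0 hc one_pos one_pos
  simpa using this

lemma SupOn.unit_g {n : ℕ} {lam Lam l L : ℝ} {g : (Fin n → ℝ) → ℝ} {U : Set (Pt n)} {w : Pt n → ℝ}
    (h : SupOn lam Lam g U w) (hg : ∀ p ∈ U, 0 < g p.1 ∧ l ≤ lam * g p.1 ∧ Lam * g p.1 ≤ L) :
    SupOn l L (fun _ => 1) U w := by
  intro p hp φ h1 h2 h3 m hm
  obtain ⟨g0, gl, gL⟩ := hg p hp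
  have := h p hp φ h1 h2 h3 (m / g p.1) (by
    intro A hA
    rw [div_le_iff₀ g0]
    have := hm (g p.1 • A) ⟨hA.1.smul _, fun v => by
      have e : ∑ i, ∑ j, (g p.1 • A) i j * v i * v j = g p.1 * ∑ i, ∑ j, A i j * v i * v j := by
        simp only [Matrix.smul_apply, smul_eq_mul, Finset.mul_sum]
        refine Finset.sum_congr rfl fun i _ => Finset.sum_congr rfl fun j _ => by ring
      have hv : 0 ≤ ∑ i, v i ^ 2 := Finset.sum_nonneg fun _ _ => sq_nonneg _
      rw [e]
      have := hA.2 v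
      constructor
      · calc l * ∑ i, v i ^ 2 ≤ (lam * g p.1) * ∑ i, v i ^ 2 := by gcongr
          _ = g p.1 * (lam * ∑ i, v i ^ 2) := by ring
          _ ≤ _ := by gcongr; exact this.1
      · calc g p.1 * ∑ i, ∑ j, A i j * v i * v j ≤ g p.1 * (Lam * ∑ i, v i ^ 2) := by
              gcongr; exact this.2
          _ = (Lam * g p.1) * ∑ i, v i ^ 2 := by ring
          _ ≤ _ := by gcongr⟩
    rw [Matrix.smul_mul, Matrix.trace_smul, smul_eq_mul] at this
    linarith)
  rw [mul_div_cancel₀ _ g0.ne'] at this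
  simpa using this

lemma SupOn.add_lin {n : ℕ} {lam Lam : ℝ} {g : (Fin n → ℝ) → ℝ} {U : Set (Pt n)} {w : Pt n → ℝ}
    (h : SupOn lam Lam g U w) (α : ℝ) (k : Fin n) : SupOn lam Lam g U (fun p => w p + α * p.1 k) := by
  intro p hp φ hφ heq hle m hm
  have hH : hess (fun q : Pt n => φ q - α * q.1 k) p = hess φ p := by
    have hd : ∀ x : Fin n → ℝ, DifferentiableAt ℝ (fun y => φ (y, p.2)) x := by
      intro x
      have h1 : DifferentiableAt ℝ φ (x, p.2) := hφ.contDiffAt.differentiableAt (by norm_num)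
      exact DifferentiableAt.comp (g := φ) (f := fun y : Fin n → ℝ => (y, p.2)) x h1 (by fun_prop)
    have hl : ∀ x : Fin n → ℝ, HasFDerivAt (fun y : Fin n → ℝ => α * y k)
        (α • (ContinuousLinearMap.proj k : (Fin n → ℝ) →L[ℝ] ℝ)) x := fun x =>
      ((ContinuousLinearMap.proj (R := ℝ) (φ := fun _ : Fin n => ℝ) k).hasFDerivAt).const_mul α
    ext i j
    unfold hess
    have : ∀ x, fderiv ℝ (fun y => φ (y, p.2) - α * y k) x (Pi.single j 1) =
      fderiv ℝ (fun y => φ (y, p.2)) x (Pi.single j 1) +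
        (-(α * (Pi.single j (1:ℝ) : Fin n → ℝ) k)) := by
      intro x
      have := ((hd x).hasFDerivAt.sub (hl x)).fderiv
      have e : (fun y => φ (y, p.2) - α * y k) = ((fun y => φ (y, p.2)) - fun y => α * y k) := rfl
      rw [e, this]
      simp [sub_eq_add_neg]
    simp only [this]
    rw [fderiv_add_const]
  have hT : timeD (fun q : Pt n => φ q - α * q.1 k) p = timeD φ p := by
    unfold timeD
    simp
  have := h p hp (fun q => φ q - α * q.1 k) (by fun_prop) (by simp [heq]) (by
    filter_upwards [hle] with q hq
    linarith) m (by rw [hH]; exact hm)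
  rwa [hT] at this

lemma isTestFn_of_contDiff {n : ℕ} {φ : Pt n → ℝ} (h : ContDiff ℝ 2 φ) : IsTestFn φ := by
  refine ⟨h.continuous, fun x => ?_, fun t => ?_⟩
  · exact (h.of_le (by norm_num)).comp (contDiff_const.prodMk contDiff_id)
  · exact h.comp (contDiff_id.prodMk contDiff_const)

lemma ell_nonempty {n : ℕ} {lam Lam : ℝ} (h : lam ≤ Lam) : (ellipticMats n lam Lam).Nonempty := by
  refine ⟨lam • (1 : Matrix (Fin n) (Fin n) ℝ), ?_, fun v => ?_⟩
  · exact Matrix.isSymm_one.smul _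
  · have : ∑ i, ∑ j, (lam • (1 : Matrix (Fin n) (Fin n) ℝ)) i j * v i * v j
      = lam * ∑ i, v i ^ 2 := by
      rw [Finset.mul_sum]
      refine Finset.sum_congr rfl fun i _ => ?_
      rw [Finset.sum_eq_single i]
      · simp; ring
      · intro b _ hb; simp [Matrix.one_apply, hb.symm]
      · simp
    rw [this]
    exact ⟨le_rfl, mul_le_mul_of_nonneg_right h (Finset.sum_nonneg fun _ _ => sq_nonneg _)⟩

/-- The open upper unit cylinder. -/
def U0 (n : ℕ) [NeZero n] : Set (Pt n) :=
  {p | ssq 0 p.1 < 1 ∧ -1 < p.2 ∧ p.2 < 0 ∧ 0 < xlast p.1}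

/-- Upper unit cylinder with the flat boundary. -/
def F0 (n : ℕ) [NeZero n] : Set (Pt n) :=
  {p | ssq 0 p.1 < 1 ∧ -1 < p.2 ∧ p.2 < 0 ∧ 0 ≤ xlast p.1}

lemma xlast_continuous {n : ℕ} [NeZero n] : Continuous fun p : Pt n => xlast p.1 := by
  unfold xlast; fun_prop

lemma ssq0_continuous {n : ℕ} (z : Fin n → ℝ) : Continuous fun p : Pt n => ssq z p.1 :=
  (ssq_continuous z).comp continuous_fst

lemma U0_open (n : ℕ) [NeZero n] : IsOpen (U0 n) := by
  apply IsOpen.and (isOpen_lt (ssq0_continuous 0) continuous_const)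
  apply IsOpen.and (isOpen_lt continuous_const continuous_snd)
  apply IsOpen.and (isOpen_lt continuous_snd continuous_const)
  exact isOpen_lt continuous_const xlast_continuous

lemma eucNorm_sub_zero {n : ℕ} (x : Fin n → ℝ) : eucNorm (x - 0) = Real.sqrt (ssq 0 x) := by
  unfold eucNorm ssq; simp

lemma mem_Qp {n : ℕ} [NeZero n] {γ r : ℝ} (hr : 0 < r) (p : Pt n) : p ∈ Qp γ r (0 : Fin n → ℝ) 0 ↔
    ssq 0 p.1 < r ^ 2 ∧ -(r ^ (2 - γ)) < p.2 ∧ p.2 ≤ 0 ∧ 0 < xlast p.1 := by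
  unfold Qp Qcyl
  simp only [mem_setOf_eq, eucNorm_sub_zero, Real.sqrt_lt' hr, zero_sub, and_assoc]

lemma U0_sub {n : ℕ} [NeZero n] {γ : ℝ} : U0 n ⊆ Q1p n γ := by
  intro p hp
  unfold Q1p
  rw [mem_Qp one_pos]
  simpa using ⟨hp.1, hp.2.1, hp.2.2.1.le, hp.2.2.2⟩

lemma supOn_of_InS0 {n : ℕ} [NeZero n] {γ lam Lam : ℝ} (hlL : lam ≤ Lam) {u : Pt n → ℝ}
    (h : InS0 γ lam Lam u (Q1p n γ)) :
    SupOn lam Lam (fun x => xlast x ^ γ) (U0 n) u ∧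
    SupOn lam Lam (fun x => xlast x ^ γ) (U0 n) (fun p => - u p) := by
  have hne : ∀ M : Matrix (Fin n) (Fin n) ℝ, ((fun A => (A * M).trace) '' ellipticMats n lam Lam).Nonempty :=
    fun M => (ell_nonempty hlL).image _
  constructor
  · intro p hp φ hφ heq hle m hm
    have h1 := h.2 p (U0_sub hp) φ (isTestFn_of_contDiff hφ) ⟨heq.symm, nhdsWithin_le_nhds hle⟩
    have h2 : m ≤ pucciMinus lam Lam (hess φ p) := by
      apply le_csInf (hne _)
      rintro _ ⟨A, hA, rfl⟩
      exact hm A hA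
    have h3 : 0 ≤ xlast p.1 ^ γ := Real.rpow_nonneg hp.2.2.2.le _
    have := mul_le_mul_of_nonneg_left h2 h3
    simp only at h1 ⊢
    linarith
  · intro p hp φ hφ heq hle m hm
    have h1 := h.1 p (U0_sub hp) (fun q => - φ q) (isTestFn_of_contDiff hφ.neg)
      ⟨by simp [heq], nhdsWithin_le_nhds (by filter_upwards [hle] with q hq; linarith)⟩
    have hH : hess (fun q => - φ q) p = - hess φ p := by
      ext i j
      unfold hess
      simp only [fderiv_fun_neg, neg_apply]
      rfl
    have hT : timeD (fun q => - φ q) p = - timeD φ p := by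
      unfold timeD
      simp [deriv.fun_neg]
    have h2 : pucciPlus lam Lam (hess (fun q => - φ q) p) ≤ -m := by
      apply csSup_le (hne _)
      rintro _ ⟨A, hA, rfl⟩
      simp only [hH, Matrix.mul_neg, Matrix.trace_neg]
      linarith [hm A hA]
    have h3 : 0 ≤ xlast p.1 ^ γ := Real.rpow_nonneg hp.2.2.2.le _
    have := mul_le_mul_of_nonneg_left h2 h3
    rw [hT] at h1
    simp only at h1 ⊢
    linarith

end MBC

namespace MBC

/-- Past sup-norm parabolic cylinders. -/
def cyl {n : ℕ} (x : Fin n → ℝ) (t ρ : ℝ) : Set (Pt n) :=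
  Metric.closedBall x ρ ×ˢ Icc (t - ρ ^ 2) t

lemma cyl_closed {n : ℕ} (x : Fin n → ℝ) (t ρ : ℝ) : IsClosed (cyl x t ρ) :=
  Metric.isClosed_closedBall.prod isClosed_Icc

lemma vol_box {n : ℕ} (x : Fin n → ℝ) {r a b : ℝ} (hr : 0 ≤ r) :
    volume (Metric.closedBall x r ×ˢ Icc a b : Set (Pt n)) =
      ENNReal.ofReal ((2 * r) ^ n * (b - a)) := by
  rw [Measure.volume_eq_prod, Measure.prod_prod, Real.volume_pi_closedBall _ hr, Real.volume_Icc,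
    ENNReal.ofReal_mul (by positivity)]
  simp

lemma vol_cyl {n : ℕ} (x : Fin n → ℝ) (t : ℝ) {ρ : ℝ} (hr : 0 ≤ ρ) :
    volume (cyl x t ρ) = ENNReal.ofReal ((2 * ρ) ^ n * ρ ^ 2) := by
  unfold cyl
  rw [vol_box _ hr]
  congr 2
  ring

lemma vol_skew {n : ℕ} (x : Fin n → ℝ) {r h : ℝ} (hr : 0 ≤ r) (f : (Fin n → ℝ) → ℝ)
    (hf : Continuous f) :
    volume {p : Pt n | ‖p.1 - x‖ ≤ r ∧ |p.2 - f p.1| ≤ h} ≤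
      ENNReal.ofReal ((2 * r) ^ n * (2 * h)) := by
  have hm : MeasurableSet {p : Pt n | ‖p.1 - x‖ ≤ r ∧ |p.2 - f p.1| ≤ h} := by
    apply IsClosed.measurableSet
    apply IsClosed.and
    · exact isClosed_le (by fun_prop) continuous_const
    · exact isClosed_le (by fun_prop) continuous_const
  rw [Measure.volume_eq_prod, Measure.prod_apply hm]
  calc ∫⁻ y, volume (Prod.mk y ⁻¹' {p : Pt n | ‖p.1 - x‖ ≤ r ∧ |p.2 - f p.1| ≤ h})
      ≤ ∫⁻ y, (Metric.closedBall x r).indicator (fun _ => ENNReal.ofReal (2 * h)) y := by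
        apply lintegral_mono
        intro y
        by_cases hy : y ∈ Metric.closedBall x r
        · rw [indicator_of_mem hy]
          have : Prod.mk y ⁻¹' {p : Pt n | ‖p.1 - x‖ ≤ r ∧ |p.2 - f p.1| ≤ h} ⊆
              Icc (f y - h) (f y + h) := by
            rintro s ⟨_, hs⟩
            simp only [abs_le] at hs
            exact ⟨by linarith [hs.1], by linarith [hs.2]⟩
          refine (measure_mono this).trans ?_
          rw [Real.volume_Icc]
          apply ENNReal.ofReal_le_ofReal
          linarith
        · rw [indicator_of_notMem hy]
          have : Prod.mk y ⁻¹' {p : Pt n | ‖p.1 - x‖ ≤ r ∧ |p.2 - f p.1| ≤ h} = ∅ := by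
            ext s
            simp only [mem_preimage, mem_empty_iff_false, iff_false]
            rintro ⟨h1, _⟩
            exact hy (mem_closedBall_iff_norm.2 h1)
          beta_reduce
          rw [this]; simp
    _ = ENNReal.ofReal ((2 * r) ^ n * (2 * h)) := by
        rw [lintegral_indicator Metric.isClosed_closedBall.measurableSet, lintegral_const,
          Measure.restrict_apply_univ, Real.volume_pi_closedBall _ hr,
          mul_comm, ENNReal.ofReal_mul (p := (2 * r) ^ n) (by positivity), Fintype.card_fin]

lemma pvitali {n : ℕ} {ι : Type*} (T : Set ι) (x : ι → Fin n → ℝ) (s ρ : ι → ℝ) {R : ℝ}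
    (hρ : ∀ i ∈ T, 0 < ρ i ∧ ρ i ≤ R) :
    ∃ u ⊆ T, u.Countable ∧ u.PairwiseDisjoint (fun i => cyl (x i) (s i) (ρ i)) ∧
      ∀ a ∈ T, ∃ b ∈ u, ‖x a - x b‖ ≤ 3 * ρ b ∧ |s a - s b| ≤ 4 * ρ b ^ 2 ∧ ρ a ≤ 2 * ρ b := by
  have hne : ∀ i ∈ T, (cyl (x i) (s i) (ρ i)).Nonempty := fun i hi =>
    ⟨(x i, s i), by
      have := (hρ i hi).1
      exact ⟨Metric.mem_closedBall_self this.le, by nlinarith, le_rfl⟩⟩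
  obtain ⟨u, huT, hdis, hcov⟩ := Vitali.exists_disjoint_subfamily_covering_enlargement
    (fun i => cyl (x i) (s i) (ρ i)) T ρ 2 one_lt_two (fun i hi => (hρ i hi).1.le) R
    (fun i hi => (hρ i hi).2) hne
  refine ⟨u, huT, ?_, hdis, ?_⟩
  · apply hdis.countable_of_nonempty_interior
    intro i hi
    have h := (hρ i (huT hi)).1
    refine ⟨(x i, s i - ρ i ^ 2 / 2), ?_⟩
    rw [mem_interior_iff_mem_nhds]
    apply prod_mem_nhds
    · exact Metric.closedBall_mem_nhds _ h
    · have : 0 < ρ i ^ 2 := by positivity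
      apply Icc_mem_nhds <;> linarith
  · intro a ha
    obtain ⟨b, hb, ⟨p, hpa, hpb⟩, hab⟩ := hcov a ha
    refine ⟨b, hb, ?_, ?_, hab⟩
    · have h1 : dist p.1 (x a) ≤ ρ a := hpa.1
      have h2 : dist p.1 (x b) ≤ ρ b := hpb.1
      rw [← dist_eq_norm]
      have := dist_triangle_left (x a) (x b) p.1
      linarith
    · have ha0 := (hρ a ha).1
      have h3 : ρ a ^ 2 ≤ 4 * ρ b ^ 2 := by nlinarith
      obtain ⟨h1, h2⟩ := hpa.2
      obtain ⟨h4, h5⟩ := hpb.2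
      rw [abs_le]
      constructor <;> nlinarith [sq_nonneg (ρ b)]

lemma pvitali_meas {n : ℕ} {ι : Type*} (T : Set ι) (x : ι → Fin n → ℝ) (s ρ : ι → ℝ) {R : ℝ}
    (hρ : ∀ i ∈ T, 0 < ρ i ∧ ρ i ≤ R) {D W P : Set (Pt n)} (hD : MeasurableSet D)
    (hW : ∀ i ∈ T, cyl (x i) (s i) (ρ i) ∩ D ⊆ W) (S : ι → Set (Pt n)) (C : ENNReal)
    (hS : ∀ i ∈ T, volume (S i) ≤ C * volume (cyl (x i) (s i) (ρ i) ∩ D))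
    (hP : ∀ p ∈ P, ∃ a ∈ T, ∀ b ∈ T, ‖x a - x b‖ ≤ 3 * ρ b → |s a - s b| ≤ 4 * ρ b ^ 2 →
      ρ a ≤ 2 * ρ b → p ∈ S b) :
    volume P ≤ C * volume W := by
  obtain ⟨u, huT, huc, hdis, hcov⟩ := pvitali T x s ρ hρ
  have hPS : P ⊆ ⋃ b ∈ u, S b := by
    intro p hp
    obtain ⟨a, ha, h⟩ := hP p hp
    obtain ⟨b, hb, h1, h2, h3⟩ := hcov a ha
    exact mem_biUnion hb (h b (huT hb) h1 h2 h3)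
  have : Countable u := huc.to_subtype
  calc volume P ≤ volume (⋃ b ∈ u, S b) := measure_mono hPS
    _ ≤ ∑' b : u, volume (S b) := measure_biUnion_le _ huc _
    _ ≤ ∑' b : u, C * volume (cyl (x b) (s b) (ρ b) ∩ D) :=
        ENNReal.tsum_le_tsum fun b => hS b (huT b.2)
    _ = C * ∑' b : u, volume (cyl (x b) (s b) (ρ b) ∩ D) := ENNReal.tsum_mul_left
    _ = C * volume (⋃ b ∈ u, cyl (x b) (s b) (ρ b) ∩ D) := by
        rw [measure_biUnion huc]
        · intro i hi j hj hij
          exact (hdis hi hj hij).mono inter_subset_left inter_subset_left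
        · intro i _
          exact (cyl_closed _ _ _).measurableSet.inter hD
    _ ≤ C * volume W := by
        gcongr
        exact iUnion₂_subset fun i hi => hW i (huT hi)

end MBC

namespace MBC

/-- The paraboloids. -/
def PP {n : ℕ} (y : Fin n → ℝ) (H : ℝ) (x : Fin n → ℝ) (t : ℝ) : ℝ :=
  (H + 3) + 3 * t - 4 * ssq y x

/-- Contact points. -/
structure Contact {n : ℕ} (w : Pt n → ℝ) (y : Fin n → ℝ) (H : ℝ) (x : Fin n → ℝ) (t : ℝ) :
    Prop where
  hx : ‖x‖ ≤ 5 / 4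
  ht : -(5 / 6) ≤ t
  ht0 : t ≤ 0
  heq : w (x, t) = PP y H x t
  hle : ∀ x' t', ‖x'‖ ≤ 2 → -1 ≤ t' → t' ≤ t → PP y H x' t' ≤ w (x', t')

lemma ssq_affine {n : ℕ} (y0 y1 a b : Fin n → ℝ) :
    (ssq y1 a - ssq y0 a) - (ssq y1 b - ssq y0 b) = -2 * ∑ i, (y1 i - y0 i) * (a i - b i) := by
  unfold ssq
  rw [← Finset.sum_sub_distrib, ← Finset.sum_sub_distrib, ← Finset.sum_sub_distrib, Finset.mul_sum]
  refine Finset.sum_congr rfl fun i _ => by ring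

lemma abs_dot_le {n : ℕ} (a b : Fin n → ℝ) {M r : ℝ} (ha : ∀ i, |a i| ≤ M) (hb : ∀ i, |b i| ≤ r) :
    |∑ i, a i * b i| ≤ n * (M * r) := by
  calc |∑ i, a i * b i| ≤ ∑ i, |a i * b i| := Finset.abs_sum_le_sum_abs _ _
    _ ≤ ∑ _i : Fin n, M * r := by
        apply Finset.sum_le_sum
        intro i _
        rw [abs_mul]
        exact mul_le_mul (ha i) (hb i) (abs_nonneg _) ((abs_nonneg _).trans (ha i))
    _ = n * (M * r) := by simp

lemma abs_coord_le {n : ℕ} {a b : Fin n → ℝ} {r : ℝ} (h : ‖a - b‖ ≤ r) (i : Fin n) :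
    |a i - b i| ≤ r := by
  have := (norm_le_pi_norm (a - b) i).trans h
  simpa using this

set_option maxHeartbeats 1000000 in
lemma two_point_core {n : ℕ} (hn : 0 < n) {l L : ℝ} (hl : 0 < l) (hL : l ≤ L) :
    ∃ C : ℝ, 0 < C ∧ ∀ (U : Set (Pt n)) (w : Pt n → ℝ), SupOn l L (fun _ => 1) U w →
      ContinuousOn w U → (∀ x t, ‖x‖ ≤ 2 → -1 ≤ t → t ≤ 0 → (x, t) ∈ U) →
      ∀ (y0 : Fin n → ℝ) (H0 : ℝ) (x0 : Fin n → ℝ) (t0 : ℝ) (y1 : Fin n → ℝ) (H1 : ℝ)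
        (x1 : Fin n → ℝ) (t1 ρ : ℝ), 0 < ρ → 20 * n * ρ ≤ 1 →
        Contact w y0 H0 x0 t0 → Contact w y1 H1 x1 t1 → ‖x0 - x1‖ ≤ ρ → t1 ≤ t0 → t0 - t1 ≤ ρ ^ 2 →
        ‖y1 - y0‖ ≤ C * ρ ∧ |H1 - H0 - 4 * (ssq y1 x0 - ssq y0 x0)| ≤ C * ρ ^ 2 ∧
          |H1 - H0 - 4 * (ssq y1 x1 - ssq y0 x1)| ≤ C * ρ ^ 2 := by
  have hL0 : 0 < L := hl.trans_le hL
  have hn1 : (1:ℝ) ≤ n := by exact_mod_cast hn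
  set β : ℝ := (32 * (n:ℝ) ^ 2 - 1) / 2 with hβ
  have hβ0 : 0 ≤ β := by rw [hβ]; nlinarith
  set C2 := 2 * β + 4 * (n * L) + 8 * l with hC2
  set E := Real.exp (-(C2 ^ 2 / (8 * l))) with hE
  have hE0 : 0 < E := Real.exp_pos _
  set C := (4 + 8 * (n * L)) / (4 * l * E) with hC
  have hC0 : 0 < C := by positivity
  have hCE : 4 * l * C * E = 4 + 8 * (n * L) := by rw [hC]; field_simp
  refine ⟨C * (2 * n + 3), by positivity, ?_⟩
  intro U w hs hw hU y0 H0 x0 t0 y1 H1 x1 t1 ρ hρ hρn c0 c1 hx ht htt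
  have hρ1 : ρ ≤ 1 / 20 := by nlinarith
  have : Nonempty (Fin n) := ⟨⟨0, hn⟩⟩
  obtain ⟨i, hi⟩ := Finite.exists_max (fun i => |y1 i - y0 i|)
  set M := |y1 i - y0 i| with hM
  obtain ⟨ε, hε1, hεM⟩ : ∃ ε : ℝ, |ε| = 1 ∧ (y1 i - y0 i) * ε = M := by
    rcases le_total 0 (y1 i - y0 i) with h | h
    · exact ⟨1, by simp, by rw [hM, abs_of_nonneg h]; ring⟩
    · exact ⟨-1, by simp, by rw [hM, abs_of_nonpos h]; ring⟩
  set z : Fin n → ℝ := x0 + Pi.single i (ε * (4 * n * ρ)) with hz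
  have hzx0 : ssq z x0 = 16 * n ^ 2 * ρ ^ 2 := by
    unfold ssq
    rw [Finset.sum_eq_single i]
    · have : ε ^ 2 = 1 := by rw [← sq_abs, hε1]; norm_num
      simp only [hz, Pi.add_apply, Pi.single_eq_same]
      calc (x0 i - (x0 i + ε * (4 * n * ρ))) ^ 2 = ε ^ 2 * (16 * n ^ 2 * ρ ^ 2) := by ring
        _ = _ := by rw [this]; ring
    · intro b _ hb; simp [hz, hb]
    · simp
  -- the point `xh`
  obtain ⟨xh, hxh1, hxh2⟩ : ∃ xh, ssq z xh ≤ ρ ^ 2 ∧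
      w (xh, t0 - 2 * ρ ^ 2) < PP y0 H0 xh (t0 - 2 * ρ ^ 2) + C * ρ ^ 2 := by
    by_contra hcon
    push Not at hcon
    have hRsq : Real.sqrt (32 * n ^ 2 * ρ ^ 2) ^ 2 = 32 * n ^ 2 * ρ ^ 2 := Real.sq_sqrt (by positivity)
    have hnear : ∀ x, ssq z x ≤ 32 * n ^ 2 * ρ ^ 2 → ‖x‖ ≤ 2 := by
      intro x hx
      have h1 : ‖x - z‖ ≤ 6 * n * ρ := by
        apply norm_le_of_ssq (by positivity)
        refine hx.trans ?_
        have : 0 ≤ (n:ℝ) ^ 2 * ρ ^ 2 := by positivity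
        nlinarith
      have h2 : ‖x0 - z‖ ≤ 4 * n * ρ := by
        apply norm_le_of_ssq (by positivity)
        rw [hzx0]; apply le_of_eq; ring
      have h3 : x = (x - z) - (x0 - z) + x0 := by abel
      rw [h3]
      have := norm_add_le ((x - z) - (x0 - z)) x0
      have := norm_sub_le (x - z) (x0 - z)
      have := c0.hx
      linarith
    have htime : ∀ t, t0 - 2 * ρ ^ 2 ≤ t → -1 ≤ t := by
      intro t h
      have := c0.ht
      nlinarith
    have hb := barrier hl hL hs hw y0 z (κ := ρ) (R := Real.sqrt (32 * n ^ 2 * ρ ^ 2)) (β := β)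
      (t1 := t0 - 2 * ρ ^ 2) (t2 := t0) (q := C2 ^ 2 / (16 * l * ρ ^ 2)) (m := C * ρ ^ 2)
      (H := H0 + 3) (K0 := 3) (a := 4) hρ (by nlinarith) hβ0 (by rw [hRsq, hβ]; ring) (by norm_num)
      (by positivity) (by positivity) (by rw [← hC2]; apply le_of_eq; field_simp)
      (by
        have e1 : C2 ^ 2 / (16 * l * ρ ^ 2) * (t0 - (t0 - 2 * ρ ^ 2)) = C2 ^ 2 / (8 * l) := by
          field_simp; ring
        rw [e1, ← hE]
        have e2 : 4 * l * (C * ρ ^ 2) / ρ ^ 2 * E = 4 * l * C * E := by field_simp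
        rw [e2, hCE]; linarith)
      (fun x t h1 h2 h3 => hU x t (hnear x (by rwa [hRsq] at h1)) (htime t h2) (h3.trans c0.ht0))
      (fun x t h1 h2 h3 => c0.hle x t (hnear x (by rwa [hRsq] at h1)) (htime t h2) h3)
      (fun x hx => hcon x hx) x0 (by rw [hRsq, hzx0]; nlinarith [show 0 ≤ (n:ℝ)^2*ρ^2 by positivity])
    rw [c0.heq, hRsq, hzx0] at hb
    unfold PP at hb
    have h5 : 0 < 32 * (n:ℝ) ^ 2 * ρ ^ 2 - 16 * n ^ 2 * ρ ^ 2 := by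
      have : 0 < (n:ℝ) ^ 2 * ρ ^ 2 := by positivity
      linarith
    have : 0 < C * ρ ^ 2 / ρ ^ 4 * rexp (-(C2 ^ 2 / (16 * l * ρ ^ 2) * (t0 - (t0 - 2 * ρ ^ 2)))) *
      (32 * n ^ 2 * ρ ^ 2 - 16 * n ^ 2 * ρ ^ 2) ^ 2 := by positivity
    linarith
  have hxz : ‖xh - z‖ ≤ ρ := norm_le_of_ssq hρ.le hxh1
  have hzn : ‖z - x0‖ ≤ 4 * n * ρ := by
    rw [norm_sub_rev]
    apply norm_le_of_ssq (by positivity)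
    rw [hzx0]; apply le_of_eq; ring
  have hxhn : ‖xh‖ ≤ 2 := by
    have h3 : xh = (xh - z) + (z - x0) + x0 := by abel
    rw [h3]
    have := norm_add_le ((xh - z) + (z - x0)) x0
    have := norm_add_le (xh - z) (z - x0)
    have := c0.hx
    nlinarith
  have hl1 : PP y1 H1 xh (t0 - 2 * ρ ^ 2) ≤ w (xh, t0 - 2 * ρ ^ 2) := by
    apply c1.hle _ _ hxhn
    · have := c0.ht; nlinarith
    · nlinarith [sq_nonneg ρ]
  have hl2 : PP y0 H0 x1 t1 ≤ PP y1 H1 x1 t1 := by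
    rw [← c1.heq]
    apply c0.hle
    · linarith [c1.hx]
    · linarith [c1.ht]
    · exact ht
  have hM0 : 0 ≤ M := abs_nonneg _
  -- dot products
  have s1 : ∑ j, (y1 j - y0 j) * (z j - x0 j) = M * (4 * n * ρ) := by
    rw [Finset.sum_eq_single i]
    · simp only [hz, Pi.add_apply, Pi.single_eq_same]
      rw [← hεM]; ring
    · intro b _ hb; simp [hz, hb]
    · simp
  have s2 := abs_le.1 (abs_dot_le (fun j => y1 j - y0 j) (fun j => xh j - z j) hi (abs_coord_le hxz))
  have s3 := abs_le.1 (abs_dot_le (fun j => y1 j - y0 j) (fun j => x0 j - x1 j) hi (abs_coord_le hx))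
  have s4 : ∑ j, (y1 j - y0 j) * (xh j - x1 j) = ∑ j, (y1 j - y0 j) * (z j - x0 j)
      + ∑ j, (y1 j - y0 j) * (xh j - z j) + ∑ j, (y1 j - y0 j) * (x0 j - x1 j) := by
    rw [← Finset.sum_add_distrib, ← Finset.sum_add_distrib]
    refine Finset.sum_congr rfl fun j _ => by ring
  have a1 := ssq_affine y0 y1 xh x1
  have a2 := ssq_affine y0 y1 x0 x1
  unfold PP at hl1 hl2 hxh2
  rw [s4, s1] at a1
  set A := ∑ j, (y1 j - y0 j) * (xh j - z j)
  set B := ∑ j, (y1 j - y0 j) * (x0 j - x1 j)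
  have hnM : 0 ≤ n * (M * ρ) := by positivity
  have hMρ : 16 * (n * (M * ρ)) ≤ C * ρ ^ 2 := by
    have : M * (4 * n * ρ) = 4 * (n * (M * ρ)) := by ring
    linarith [s2.1, s3.1]
  have hMn : ‖y1 - y0‖ ≤ M := by
    rw [pi_norm_le_iff_of_nonneg hM0]
    intro j
    exact hi j
  have hMρ2 : M ≤ C * ρ := by
    have : 16 * M * ρ ≤ C * ρ * ρ := by nlinarith [mul_nonneg hM0 hρ.le]
    have := le_of_mul_le_mul_right this hρ
    linarith
  have hCρ : 0 ≤ C * ρ := by positivity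
  have hCρ2 : 0 ≤ C * ρ ^ 2 := by positivity
  have f1 : C * (2 * n + 3) * ρ ^ 2 = 2 * (n * (C * ρ ^ 2)) + 3 * (C * ρ ^ 2) := by ring
  have hn2 : C * ρ ^ 2 ≤ n * (C * ρ ^ 2) := by nlinarith
  have f2 : M * (4 * n * ρ) = 4 * (n * (M * ρ)) := by ring
  have f3 : n * (4 * (n * (M * ρ))) ≤ n * (C * ρ ^ 2 / 4) := by gcongr; linarith
  have f4 : 0 ≤ H1 - H0 - 4 * (ssq y1 x1 - ssq y0 x1) := by linarith
  have f5 : H1 - H0 - 4 * (ssq y1 x1 - ssq y0 x1) ≤ C * ρ ^ 2 := by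
    linarith [s2.1, s3.1]
  refine ⟨hMn.trans (hMρ2.trans ?_), ?_, ?_⟩
  · have : C * (2 * n + 3) * ρ = C * ρ + (2 * n + 2) * (C * ρ) := by ring
    rw [this]
    have : 0 ≤ (2 * n + 2) * (C * ρ) := by positivity
    linarith
  · rw [abs_le]; constructor <;> linarith [s3.1, s3.2]
  · rw [abs_le]; constructor <;> linarith

end MBC

namespace MBC

lemma two_point {n : ℕ} (hn : 0 < n) {l L : ℝ} (hl : 0 < l) (hL : l ≤ L) :
    ∃ C : ℝ, 0 < C ∧ ∀ (U : Set (Pt n)) (w : Pt n → ℝ), SupOn l L (fun _ => 1) U w →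
      ContinuousOn w U → (∀ x t, ‖x‖ ≤ 2 → -1 ≤ t → t ≤ 0 → (x, t) ∈ U) →
      ∀ (y0 : Fin n → ℝ) (H0 : ℝ) (x0 : Fin n → ℝ) (t0 : ℝ) (y1 : Fin n → ℝ) (H1 : ℝ)
        (x1 : Fin n → ℝ) (t1 ρ : ℝ), 0 < ρ → 20 * n * ρ ≤ 1 →
        Contact w y0 H0 x0 t0 → Contact w y1 H1 x1 t1 → ‖x1 - x0‖ ≤ ρ → |t1 - t0| ≤ ρ ^ 2 →
        ‖y1 - y0‖ ≤ C * ρ ∧ |H1 - (H0 + 4 * (ssq y1 x0 - ssq y0 x0))| ≤ C * ρ ^ 2 := by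
  obtain ⟨C, hC, h⟩ := two_point_core hn hl hL
  refine ⟨C, hC, ?_⟩
  intro U w hs hw hU y0 H0 x0 t0 y1 H1 x1 t1 ρ hρ hρn c0 c1 hx ht
  rw [abs_le] at ht
  rcases le_total t1 t0 with h01 | h01
  · obtain ⟨h1, h2, h3⟩ := h U w hs hw hU y0 H0 x0 t0 y1 H1 x1 t1 ρ hρ hρn c0 c1
      (by rwa [norm_sub_rev]) h01 (by linarith)
    refine ⟨h1, ?_⟩
    convert h2 using 2; ring
  · obtain ⟨h1, h2, h3⟩ := h U w hs hw hU y1 H1 x1 t1 y0 H0 x0 t0 ρ hρ hρn c1 c0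
      hx h01 (by linarith)
    refine ⟨by rwa [norm_sub_rev], ?_⟩
    rw [abs_sub_comm]
    convert h3 using 2; ring

lemma exists_contact {n : ℕ} (hn : 0 < n) {w : Pt n → ℝ}
    (hw : ContinuousOn w (Metric.closedBall 0 2 ×ˢ Icc (-1) 0))
    (hpos : ∀ p ∈ (Metric.closedBall 0 2 ×ˢ Icc (-1) 0 : Set (Pt n)), 0 ≤ w p)
    (h0 : w (0, 0) < 1) (y : Fin n → ℝ) (H : ℝ) (hy : ‖y‖ ≤ 1 / (4 * n)) (hH : -1 ≤ H)
    (hH2 : H ≤ -(1 / 2)) : ∃ x t, Contact w y H x t ∧ w (x, t) < 4 := by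
  have hn1 : (1:ℝ) ≤ n := by exact_mod_cast hn
  set K : Set (Pt n) := Metric.closedBall 0 2 ×ˢ Icc (-1) 0 with hK
  have hKc : IsCompact K := (isCompact_closedBall _ _).prod isCompact_Icc
  have hPc : Continuous fun p : Pt n => PP y H p.1 p.2 := by
    unfold PP
    have := ssq0_continuous y
    fun_prop
  have hy4 : ‖y‖ ≤ 1 / 4 := by
    refine hy.trans ?_
    gcongr; linarith
  have hyq : ssq y 0 ≤ 1 / 16 := by
    have h1 : ‖(0 : Fin n → ℝ) - y‖ ≤ 1 / (4 * n) := by simpa using hy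
    have := ssq_le_of_norm h1
    refine this.trans ?_
    have : (n:ℝ) * (1 / (4 * n)) ^ 2 = 1 / (16 * n) := by field_simp; norm_num
    rw [this]
    gcongr; linarith
  set S : Set (Pt n) := {p ∈ K | w p ≤ PP y H p.1 p.2} with hS
  have hSc : IsCompact S := by
    apply hKc.of_isClosed_subset _ (fun p hp => hp.1)
    exact hKc.isClosed.isClosed_le hw hPc.continuousOn
  have hSn : S.Nonempty := by
    refine ⟨(0, 0), ⟨Metric.mem_closedBall_self (by norm_num), by norm_num, le_rfl⟩, ?_⟩
    unfold PP
    simp only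
    linarith
  obtain ⟨X, hX, hmin⟩ := hSc.exists_isMinOn hSn continuous_snd.continuousOn
  have hlt : ∀ p ∈ K, p.2 < X.2 → PP y H p.1 p.2 < w p := by
    intro p hp hpt
    by_contra hcon
    push Not at hcon
    have : X.2 ≤ p.2 := hmin (show p ∈ S from ⟨hp, hcon⟩)
    linarith
  have hXK := hX.1
  have hw0 := hpos X hXK
  have hXP := hX.2
  have hX2 := hXK.2
  have hq := ssq_nonneg y X.1
  unfold PP at hXP
  have ht : -(5 / 6) ≤ X.2 := by linarith
  have hle : ∀ x' t', ‖x'‖ ≤ 2 → -1 ≤ t' → t' ≤ X.2 → PP y H x' t' ≤ w (x', t') := by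
    intro x' t' h1 h2 h3
    have hmem : ∀ s, -1 ≤ s → s ≤ X.2 → ((x', s) : Pt n) ∈ K := fun s h4 h5 =>
      ⟨by simpa using h1, h4, h5.trans hX2.2⟩
    rcases h3.lt_or_eq with h | h
    · exact (hlt (x', t') (hmem t' h2 h3) h).le
    · rw [h]
      have hcts : ContinuousOn (fun s => w (x', s)) (Icc (-1) X.2) := by
        apply hw.comp (f := fun s : ℝ => ((x', s) : Pt n)) (by fun_prop)
        intro s hs
        exact hmem s hs.1 hs.2
      have hcts2 : ContinuousOn (fun s => PP y H x' s) (Icc (-1) X.2) := by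
        unfold PP; fun_prop
      have hcl : X.2 ∈ closure (Ico (-1) X.2) := by
        rw [closure_Ico (by linarith)]
        exact ⟨by linarith, le_rfl⟩
      have hsub : closure (Ico (-1) X.2) = Icc (-1) X.2 := closure_Ico (by linarith)
      exact le_on_closure (f := fun s => PP y H x' s) (g := fun s => w (x', s)) (s := Ico (-1) X.2)
        (fun s hs => (hlt (x', s) (hmem s hs.1 hs.2.le) hs.2).le) (by rwa [hsub]) (by rwa [hsub]) hcl
  refine ⟨X.1, X.2, ⟨?_, ht, hX2.2, le_antisymm hX.2 (hle _ _ (by simpa using hXK.1) hX2.1 le_rfl),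
    hle⟩, ?_⟩
  · have h1 : ssq y X.1 ≤ 1 ^ 2 := by linarith [hX2.2]
    have h2 := norm_le_of_ssq zero_le_one h1
    have h3 : X.1 = (X.1 - y) + y := by abel
    rw [h3]
    have := norm_add_le (X.1 - y) y
    linarith
  · have : w (X.1, X.2) = w X := rfl
    linarith [hX2.2]

set_option maxHeartbeats 1000000 in
/-- Point to measure estimate. -/
lemma p2m {n : ℕ} (hn : 0 < n) {l L : ℝ} (hl : 0 < l) (hL : l ≤ L) :
    ∃ c : ℝ, 0 < c ∧ ∀ (U : Set (Pt n)) (w : Pt n → ℝ), SupOn l L (fun _ => 1) U w →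
      ContinuousOn w U → (Metric.closedBall 0 2 ×ˢ Icc (-1) 0 : Set (Pt n)) ⊆ U →
      (∀ p ∈ (Metric.closedBall 0 2 ×ˢ Icc (-1) 0 : Set (Pt n)), 0 ≤ w p) → w (0, 0) < 1 →
      ENNReal.ofReal c ≤ volume {p ∈ (Metric.closedBall 0 2 ×ˢ Icc (-1) 0 : Set (Pt n)) | w p < 4} := by
  obtain ⟨C, hC, h2p⟩ := two_point hn hl hL
  have hn1 : (1:ℝ) ≤ n := by exact_mod_cast hn
  set Cst : ℝ := (3 * C) ^ n * (18 * C) with hCst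
  have hCst0 : 0 < Cst := by positivity
  set V : ℝ := (2 * (1 / (4 * n))) ^ n * (-(1/2) - (-1)) with hV
  have hV0 : 0 < V := by
    have : (0:ℝ) < -(1/2) - (-1) := by norm_num
    positivity
  refine ⟨V / Cst, by positivity, ?_⟩
  intro U w hs hw hU hpos h0
  have hw' := hw.mono hU
  set P : Set (Pt n) := Metric.closedBall 0 (1 / (4 * n)) ×ˢ Icc (-1) (-(1/2)) with hP
  have hPv : volume P = ENNReal.ofReal V := vol_box _ (by positivity)
  set W : Set (Pt n) := {p ∈ (Metric.closedBall 0 2 ×ˢ Icc (-1) 0 : Set (Pt n)) | w p < 4} with hWdef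
  have hex : ∀ p : Pt n, ∃ q : (Fin n → ℝ) × ℝ × ℝ, p ∈ P → Contact w p.1 p.2 q.1 q.2.1 ∧
      0 < q.2.2 ∧ 60 * n * q.2.2 ≤ 1 ∧ cyl q.1 q.2.1 q.2.2 ⊆ W := by
    intro p
    by_cases hp : p ∈ P
    · obtain ⟨x, t, hc, hlt⟩ := exists_contact hn hw' hpos h0 p.1 p.2 (by simpa using hp.1)
        hp.2.1 hp.2.2
      have hmem : ((x, t) : Pt n) ∈ (Metric.closedBall 0 2 ×ˢ Icc (-1) 0 : Set (Pt n)) :=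
        ⟨by simp; linarith [hc.hx], by linarith [hc.ht], hc.ht0⟩
      have hev := (hw' (x, t) hmem).eventually (gt_mem_nhds hlt)
      rw [eventually_nhdsWithin_iff, Metric.eventually_nhds_iff] at hev
      obtain ⟨ε, hε, hev⟩ := hev
      set ρ := min (ε / 2) (1 / (60 * n)) with hρ
      have hρ0 : 0 < ρ := by positivity
      have hρ1 : 60 * n * ρ ≤ 1 := by
        have : ρ ≤ 1 / (60 * n) := min_le_right _ _
        rw [le_div_iff₀ (by positivity)] at this
        linarith
      have hρ2 : ρ ≤ 1 / 60 := by nlinarith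
      have hρ3 : ρ ≤ ε / 2 := min_le_left _ _
      have hρ4 : ρ ^ 2 ≤ ρ := by nlinarith
      refine ⟨(x, t, ρ), fun _ => ⟨hc, hρ0, hρ1, ?_⟩⟩
      intro q hq
      have hq1 : dist q.1 x ≤ ρ := hq.1
      have hq2 : t - ρ ^ 2 ≤ q.2 := hq.2.1
      have hq3 : q.2 ≤ t := hq.2.2
      have hqK : q ∈ (Metric.closedBall 0 2 ×ˢ Icc (-1) 0 : Set (Pt n)) := by
        refine ⟨?_, by linarith [hc.ht], hq3.trans hc.ht0⟩
        have := dist_triangle q.1 x 0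
        rw [dist_zero_right x] at this
        simp only [Metric.mem_closedBall]
        linarith [hc.hx]
      refine ⟨hqK, hev ?_ hqK⟩
      rw [Prod.dist_eq]
      apply max_lt
      · simp only; linarith
      · simp only [Real.dist_eq]
        rw [abs_lt]; constructor <;> linarith
    · exact ⟨(0, 0, 0), fun h => absurd h hp⟩
  choose f hf using hex
  have key := pvitali_meas (n := n) P (fun p => (f p).1) (fun p => (f p).2.1) (fun p => (f p).2.2)
    (R := 1) (D := univ) (W := W) (P := P)
    (fun p hp => ⟨(hf p hp).2.1, by have := (hf p hp).2.2.1; have := (hf p hp).2.1; nlinarith⟩)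
    MeasurableSet.univ (fun p hp => by rw [inter_univ]; exact (hf p hp).2.2.2)
    (fun b => {p : Pt n | ‖p.1 - b.1‖ ≤ C * (3 * (f b).2.2) ∧
      |p.2 - (b.2 + 4 * (ssq p.1 (f b).1 - ssq b.1 (f b).1))| ≤ C * (3 * (f b).2.2) ^ 2})
    (ENNReal.ofReal Cst)
    (by
      intro b hb
      obtain ⟨_, h1, _, _⟩ := hf b hb
      rw [inter_univ, vol_cyl _ _ h1.le, ← ENNReal.ofReal_mul hCst0.le]
      refine (vol_skew b.1 (by positivity)
        (fun y => b.2 + 4 * (ssq y (f b).1 - ssq b.1 (f b).1)) ?_).trans ?_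
      · unfold ssq; fun_prop
      · apply le_of_eq
        congr 1
        rw [hCst]
        have : (2 * (C * (3 * (f b).2.2))) ^ n = (3 * C) ^ n * (2 * (f b).2.2) ^ n := by
          rw [← mul_pow]; ring
        rw [this]; ring)
    (by
      intro p hp
      refine ⟨p, hp, fun b hb h1 h2 _ => ?_⟩
      obtain ⟨cb, rb, rb2, _⟩ := hf b hb
      obtain ⟨ca, _⟩ := hf p hp
      have := h2p U w hs hw (fun x t h3 h4 h5 => hU ⟨by simpa using h3, h4, h5⟩) b.1 b.2 (f b).1
        (f b).2.1 p.1 p.2 (f p).1 (f p).2.1 (3 * (f b).2.2) (by positivity) (by linarith) cb ca h1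
        (h2.trans (by nlinarith [sq_nonneg (f b).2.2]))
      exact this)
  rw [hPv] at key
  rw [ENNReal.ofReal_div_of_pos hCst0]
  apply ENNReal.div_le_of_le_mul
  rw [mul_comm]; exact key

end MBC

namespace MBC

/-- Affine parabolic change of variables. -/
def aff {n : ℕ} (x0 : Fin n → ℝ) (t0 r s : ℝ) (p : Pt n) : Pt n := (x0 + r • p.1, t0 + s * p.2)

lemma map_aff1 {n : ℕ} (x0 : Fin n → ℝ) {r : ℝ} (hr : 0 < r) :
    Measure.map (fun x : Fin n → ℝ => x0 + r • x) volume = ENNReal.ofReal ((r ^ n)⁻¹) • volume := by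
  have h1 := Measure.map_addHaar_smul (volume : Measure (Fin n → ℝ)) hr.ne'
  have h2 : (fun x : Fin n → ℝ => x0 + r • x) = (fun x => x0 + x) ∘ (fun x => r • x) := rfl
  rw [h2, ← Measure.map_map (by fun_prop) (by fun_prop), h1, Measure.map_smul,
    map_add_left_eq_self]
  simp [abs_of_pos hr]

lemma map_aff2 (t0 : ℝ) {s : ℝ} (hs : 0 < s) :
    Measure.map (fun x : ℝ => t0 + s * x) volume = ENNReal.ofReal (s⁻¹) • volume := by
  have h1 := Measure.map_addHaar_smul (volume : Measure ℝ) hs.ne'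
  have h2 : (fun x : ℝ => t0 + s * x) = (fun x => t0 + x) ∘ (fun x => s • x) := rfl
  rw [h2, ← Measure.map_map (by fun_prop) (by fun_prop), h1, Measure.map_smul,
    map_add_left_eq_self]
  simp [abs_of_pos hs]

lemma vol_preimage_aff {n : ℕ} (x0 : Fin n → ℝ) (t0 : ℝ) {r s : ℝ} (hr : 0 < r) (hs : 0 < s)
    (A : Set (Pt n)) : volume (aff x0 t0 r s ⁻¹' A) ≤ ENNReal.ofReal ((r ^ n * s)⁻¹) * volume A := by
  have hm : Measurable (aff x0 t0 r s) := by unfold aff; fun_prop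
  refine (Measure.le_map_apply hm.aemeasurable A).trans ?_
  have h := Measure.map_prod_map (volume : Measure (Fin n → ℝ)) (volume : Measure ℝ)
    (f := fun x => x0 + r • x) (g := fun t => t0 + s * t) (by fun_prop) (by fun_prop)
  have h3 : Prod.map (fun x : Fin n → ℝ => x0 + r • x) (fun t => t0 + s * t) = aff x0 t0 r s := rfl
  rw [Measure.volume_eq_prod, ← h3, ← h, map_aff1 x0 hr, map_aff2 t0 hs]
  rw [Measure.prod_smul_left, Measure.prod_smul_right, smul_smul, mul_inv,
    ENNReal.ofReal_mul (by positivity)]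
  simp

lemma SupOn.affine1 {n : ℕ} {l L : ℝ} {U : Set (Pt n)} {w : Pt n → ℝ}
    (h : SupOn l L (fun _ => 1) U w) (x0 : Fin n → ℝ) (t0 : ℝ) {c r : ℝ} (hc : 0 < c) (hr : 0 < r) :
    SupOn l L (fun _ => 1) (aff x0 t0 r (r ^ 2) ⁻¹' U) (fun p => c * w (aff x0 t0 r (r ^ 2) p)) := by
  have := h.affine x0 t0 hc hr (show 0 < r ^ 2 by positivity)
  refine SupOn.congr_g this ?_
  intro p _
  show (1:ℝ) = r ^ 2 / r ^ 2 * 1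
  field_simp

lemma aff_continuous {n : ℕ} (x0 : Fin n → ℝ) (t0 r s : ℝ) : Continuous (aff x0 t0 r s) := by
  unfold aff; fun_prop

set_option maxHeartbeats 1000000 in
lemma growth_unit {n : ℕ} (hn : 0 < n) {l L : ℝ} (hl : 0 < l) (hL : l ≤ L) :
    ∃ c1 θ : ℝ, 0 < c1 ∧ 0 < θ ∧ θ ≤ 1 ∧ ∀ (U : Set (Pt n)) (w : Pt n → ℝ),
      SupOn l L (fun _ => 1) U w → ContinuousOn w U → (∀ p ∈ U, 0 ≤ w p) →
      (Metric.closedBall 0 (3 * n) ×ˢ Icc (-1) 5 : Set (Pt n)) ⊆ U →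
      volume (cyl 0 0 1 \ {p : Pt n | 1 < w p}) ≤ ENNReal.ofReal c1 →
      ∀ (x : Fin n → ℝ) (t : ℝ), ‖x‖ ≤ 2 → 1 ≤ t → t ≤ 5 → θ < w (x, t) := by
  obtain ⟨c0, hc0, hp2m⟩ := p2m hn hl hL
  have hn1 : (1:ℝ) ≤ n := by exact_mod_cast hn
  set C2 := 18 * n + 4 * (n * L) + 8 * l with hC2
  have hL0 : 0 < L := hl.trans_le hL
  set q := C2 ^ 2 / (4 * l) with hq
  have hq0 : 0 ≤ q := by positivity
  set b : ℝ := ((1 / 4 : ℝ) ^ n * (1 / 4) ^ 2) with hb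
  have hb0 : 0 < b := by positivity
  refine ⟨c0 * b / 2, Real.exp (-(q * 5)), by positivity, Real.exp_pos _,
    Real.exp_le_one_iff.2 (by linarith), ?_⟩
  intro U w hs hw hpos hU hvol
  have step1 : ∀ x0 : Fin n → ℝ, ‖x0‖ ≤ 1 / 2 → 1 / 4 ≤ w (x0, 0) := by
    intro x0 hx0
    by_contra hcon
    push Not at hcon
    have hin : ∀ p ∈ (Metric.closedBall 0 2 ×ˢ Icc (-1) 0 : Set (Pt n)),
        aff x0 0 (1 / 4) ((1 / 4) ^ 2) p ∈ cyl (0 : Fin n → ℝ) 0 1 := by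
      intro p hp
      have h1 : ‖p.1‖ ≤ 2 := by simpa using hp.1
      have h2 := hp.2
      simp only [mem_Icc] at h2
      refine ⟨?_, ?_, ?_⟩
      · simp only [aff, Metric.mem_closedBall, dist_zero_right]
        have := norm_add_le x0 ((1 / 4 : ℝ) • p.1)
        rw [norm_smul, Real.norm_eq_abs, abs_of_pos (by norm_num : (0:ℝ) < 1/4)] at this
        linarith
      · simp only [aff]; linarith
      · simp only [aff]; linarith
    have hcU : cyl (0 : Fin n → ℝ) 0 1 ⊆ U := by
      intro p hp
      apply hU
      have h1 : ‖p.1‖ ≤ 1 := by simpa using hp.1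
      have h2 := hp.2
      simp only [mem_Icc] at h2
      exact ⟨by simp; linarith, by linarith, by linarith⟩
    have h := hp2m _ _ (hs.affine1 x0 0 (show (0:ℝ) < 4 by norm_num) (show (0:ℝ) < 1 / 4 by norm_num))
      (by
        apply ContinuousOn.mul continuousOn_const
        exact hw.comp (aff_continuous _ _ _ _).continuousOn (fun p hp => hp))
      (fun p hp => hcU (hin p hp)) (fun p hp => by have := hpos _ (hcU (hin p hp)); positivity)
      (by simp [aff]; linarith)
    have h2 := h.trans (measure_mono (show _ ⊆ aff x0 0 (1 / 4) ((1 / 4) ^ 2) ⁻¹'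
      (cyl 0 0 1 \ {p : Pt n | 1 < w p}) from fun p hp => ⟨hin p hp.1, fun hp' => by
        have h3 := hp.2
        have h4 : 1 < w (aff x0 0 (1 / 4) ((1 / 4) ^ 2) p) := hp'
        linarith⟩))
    have h3 := h2.trans (vol_preimage_aff x0 0 (by norm_num) (by norm_num) _)
    have h4 := h3.trans (mul_le_mul_right hvol _)
    rw [← hb, ← ENNReal.ofReal_mul (by positivity), ENNReal.ofReal_le_ofReal_iff (by positivity)] at h4
    have : b⁻¹ * (c0 * b / 2) = c0 / 2 := by field_simp
    linarith
  intro x t hx ht1 ht5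
  have hRsq : Real.sqrt (9 * n) ^ 2 = 9 * n := Real.sq_sqrt (by positivity)
  have hDn : ∀ x s, ssq 0 x ≤ Real.sqrt (9 * n) ^ 2 → 0 ≤ s → s ≤ t → ((x, s) : Pt n) ∈ U := by
    intro x s h1 h2 h3
    apply hU
    refine ⟨?_, by linarith, by linarith⟩
    have := norm_le_of_ssq (z := 0) (x := x) (r := 3 * n) (by positivity)
      (by rw [hRsq] at h1; nlinarith)
    simpa using this
  have hβ : (9 * n - 1 / 4) / t ≤ 9 * (n:ℝ) := by
    rw [div_le_iff₀ (by linarith)]; nlinarith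
  have hβ0 : 0 ≤ (9 * (n:ℝ) - 1 / 4) / t := by
    apply div_nonneg <;> linarith
  have hbar := barrier hl hL hs hw 0 0 (κ := 1 / 2) (R := Real.sqrt (9 * n)) (β := (9 * n - 1 / 4) / t)
    (t1 := 0) (t2 := t) (q := q) (m := 1 / 4) (H := 0) (K0 := 0) (a := 0) (by norm_num) (by linarith)
    hβ0 (by rw [hRsq]; field_simp; ring) le_rfl (by norm_num) hq0
    (by
      have : 16 * l * (1 / 2) ^ 2 * q = C2 ^ 2 := by rw [hq]; field_simp; ring
      rw [this]
      have hnL : 0 ≤ n * L := by positivity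
      gcongr
      rw [hC2]; linarith)
    (by
      have : 0 < 4 * l * (1 / 4) / (1 / 2) ^ 2 * rexp (-(q * (t - 0))) := by positivity
      simpa using this)
    hDn (fun x s h1 h2 h3 => by simpa using hpos _ (hDn x s h1 h2 h3))
    (fun x hx => by
      have := step1 x (by simpa using norm_le_of_ssq (z := 0) (x := x) (by norm_num) hx)
      simpa using this) x (by
        rw [hRsq]
        have := ssq_le_of_norm (z := 0) (x := x) (r := 2) (by simpa using hx)
        linarith)
  have hx2 := ssq_le_of_norm (z := 0) (x := x) (r := 2) (by simpa using hx)
  rw [hRsq] at hbar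
  refine lt_of_lt_of_le ?_ hbar
  have e1 : rexp (-(q * 5)) ≤ rexp (-(q * (t - 0))) := by
    apply Real.exp_le_exp.2; nlinarith
  have e2 : 1 ≤ (9 * n - ssq 0 x) ^ 2 := by nlinarith
  have e3 : 0 < rexp (-(q * (t - 0))) := Real.exp_pos _
  have e4 : rexp (-(q * (t - 0))) * 1 ≤ rexp (-(q * (t - 0))) * (9 * n - ssq 0 x) ^ 2 := by gcongr
  have e5 : 0 + 0 * t - 0 * ssq 0 x + 1 / 4 / (1 / 2) ^ 4 * rexp (-(q * (t - 0))) * (9 * n - ssq 0 x) ^ 2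
      = 4 * (rexp (-(q * (t - 0))) * (9 * n - ssq 0 x) ^ 2) := by ring
  rw [e5]
  linarith

lemma growth {n : ℕ} (hn : 0 < n) {l L : ℝ} (hl : 0 < l) (hL : l ≤ L) :
    ∃ c1 θ : ℝ, 0 < c1 ∧ 0 < θ ∧ θ ≤ 1 ∧ ∀ (U : Set (Pt n)) (w : Pt n → ℝ),
      SupOn l L (fun _ => 1) U w → ContinuousOn w U → (∀ p ∈ U, 0 ≤ w p) →
      ∀ (x0 : Fin n → ℝ) (t0 r ν : ℝ), 0 < r → 0 < ν →
      (Metric.closedBall x0 (3 * n * r) ×ˢ Icc (t0 - r ^ 2) (t0 + 5 * r ^ 2) : Set (Pt n)) ⊆ U →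
      volume (cyl x0 t0 r \ {p : Pt n | ν < w p}) ≤ ENNReal.ofReal (c1 * (r ^ n * r ^ 2)) →
      ∀ (x : Fin n → ℝ) (t : ℝ), ‖x - x0‖ ≤ 2 * r → t0 + r ^ 2 ≤ t → t ≤ t0 + 5 * r ^ 2 →
        θ * ν < w (x, t) := by
  obtain ⟨c1, θ, hc1, hθ, hθ1, h⟩ := growth_unit hn hl hL
  refine ⟨c1, θ, hc1, hθ, hθ1, ?_⟩
  intro U w hs hw hpos x0 t0 r ν hr hν hU hvol x t hx ht1 ht2
  have hr2 : 0 < r ^ 2 := by positivity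
  have h1 := h _ _ (hs.affine1 x0 t0 (inv_pos.2 hν) hr)
    (by
      apply ContinuousOn.mul continuousOn_const
      exact hw.comp (aff_continuous _ _ _ _).continuousOn (fun p hp => hp))
    (fun p hp => mul_nonneg (inv_pos.2 hν).le (hpos _ hp))
    (by
      intro p hp
      apply hU
      have h1 : ‖p.1‖ ≤ 3 * n := by simpa using hp.1
      have h2 := hp.2
      simp only [mem_Icc] at h2
      refine ⟨?_, ?_, ?_⟩
      · simp only [aff, Metric.mem_closedBall, dist_eq_norm, add_sub_cancel_left]
        rw [norm_smul, Real.norm_eq_abs, abs_of_pos hr]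
        nlinarith
      · simp only [aff]; nlinarith
      · simp only [aff]; nlinarith)
    (by
      refine (measure_mono (show _ ⊆ aff x0 t0 r (r ^ 2) ⁻¹'
        (cyl x0 t0 r \ {p : Pt n | ν < w p}) from ?_)).trans
          ((vol_preimage_aff x0 t0 hr hr2 _).trans ?_)
      · rintro p ⟨hp, hp2⟩
        have h1 : ‖p.1‖ ≤ 1 := by simpa using hp.1
        have h2 := hp.2
        simp only [mem_Icc] at h2
        refine ⟨⟨?_, ?_, ?_⟩, fun hp' => hp2 ?_⟩
        · simp only [aff, Metric.mem_closedBall, dist_eq_norm, add_sub_cancel_left]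
          rw [norm_smul, Real.norm_eq_abs, abs_of_pos hr]
          nlinarith
        · simp only [aff]; nlinarith
        · simp only [aff]; nlinarith
        · have h4 : ν < w (aff x0 t0 r (r ^ 2) p) := hp'
          show 1 < ν⁻¹ * _
          rw [lt_inv_mul_iff₀ hν]; linarith
      · refine (mul_le_mul_right hvol _).trans ?_
        rw [← ENNReal.ofReal_mul (by positivity)]
        apply le_of_eq
        congr 1
        field_simp)
    (r⁻¹ • (x - x0)) ((t - t0) / r ^ 2)
    (by
      rw [norm_smul, Real.norm_eq_abs, abs_of_pos (inv_pos.2 hr), inv_mul_le_iff₀ hr]; linarith)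
    (by rw [le_div_iff₀ hr2]; linarith) (by rw [div_le_iff₀ hr2]; linarith)
  have e : aff x0 t0 r (r ^ 2) (r⁻¹ • (x - x0), (t - t0) / r ^ 2) = (x, t) := by
    unfold aff
    ext1
    · simp only [smul_smul]; rw [mul_inv_cancel₀ hr.ne', one_smul]; simp
    · simp only; field_simp; ring
  rw [e, lt_inv_mul_iff₀ hν] at h1
  linarith

end MBC

namespace MBC

/-- The part of `U` on which `w` exceeds `ν`. -/
def lev {n : ℕ} (U : Set (Pt n)) (w : Pt n → ℝ) (ν : ℝ) : Set (Pt n) := {p ∈ U | ν < w p}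

lemma lev_open {n : ℕ} {U : Set (Pt n)} {w : Pt n → ℝ} (hU : IsOpen U) (hw : ContinuousOn w U)
    (ν : ℝ) : IsOpen (lev U w ν) := hw.isOpen_inter_preimage hU isOpen_Ioi

lemma lev_start {n : ℕ} {E : Set (Pt n)} (hE : IsOpen E) {X : Pt n} (hX : X ∈ E) {δ : ℝ}
    (hδ : 0 < δ) : ∃ r, 0 < r ∧ r ≤ δ ∧ cyl X.1 X.2 r ⊆ E := by
  obtain ⟨ε, hε, hb⟩ := Metric.isOpen_iff.1 hE X hX
  refine ⟨min δ (min (ε / 2) (1 / 2)), by positivity, min_le_left _ _, ?_⟩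
  set r := min δ (min (ε / 2) (1 / 2)) with hr
  have hr0 : 0 < r := by positivity
  have h1 : r ≤ ε / 2 := (min_le_right _ _).trans (min_le_left _ _)
  have h2 : r ≤ 1 / 2 := (min_le_right _ _).trans (min_le_right _ _)
  intro p hp
  apply hb
  rw [Metric.mem_ball, Prod.dist_eq, max_lt_iff]
  refine ⟨lt_of_le_of_lt hp.1 (by linarith), ?_⟩
  have h3 := hp.2
  simp only [mem_Icc] at h3
  rw [Real.dist_eq, abs_lt]
  constructor <;> nlinarith

set_option maxHeartbeats 1000000 in
lemma chain {n : ℕ} {l L : ℝ} {c1 θ : ℝ}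
    {U : Set (Pt n)} {w : Pt n → ℝ}
    (hg : ∀ (x0 : Fin n → ℝ) (t0 r ν : ℝ), 0 < r → 0 < ν →
      (Metric.closedBall x0 (3 * n * r) ×ˢ Icc (t0 - r ^ 2) (t0 + 5 * r ^ 2) : Set (Pt n)) ⊆ U →
      volume (cyl x0 t0 r \ {p : Pt n | ν < w p}) ≤ ENNReal.ofReal (c1 * (r ^ n * r ^ 2)) →
      ∀ (x : Fin n → ℝ) (t : ℝ), ‖x - x0‖ ≤ 2 * r → t0 + r ^ 2 ≤ t → t ≤ t0 + 5 * r ^ 2 →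
        θ * ν < w (x, t))
    (hUo : IsOpen U) (hw : ContinuousOn w U) {xb : Fin n → ℝ} {a s1 s2 δ ν : ℝ} (hn : 0 < n)
    (hδ : 0 < δ) (hν : 0 < ν)
    (hU : (Metric.closedBall xb (a + 3 * n * δ) ×ˢ Icc (s1 - δ ^ 2) (s2 + 7 * δ ^ 2) : Set (Pt n)) ⊆ U)
    (hno : ¬ ∃ x ∈ Metric.closedBall xb a, ∃ t ∈ Icc s1 (s2 + 7 * δ ^ 2),
      ∀ y, ‖y - x‖ ≤ δ → θ * ν < w (y, t))
    {X : Pt n} (hX : X ∈ lev U w ν ∩ (Metric.closedBall xb a ×ˢ Icc s1 s2 : Set (Pt n))) :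
    ∃ s ρ : ℝ, 0 < ρ ∧ ρ ≤ δ ∧ X.2 ≤ s ∧ s ≤ X.2 + 5 / 3 * ρ ^ 2 ∧
      cyl X.1 s ρ ⊆ lev U w (θ * ν) ∩
        (Metric.closedBall xb (a + δ) ×ˢ Icc s1 (s2 + 2 * δ ^ 2) : Set (Pt n)) ∧
      ENNReal.ofReal (c1 * (ρ ^ n * ρ ^ 2)) ≤ volume (cyl X.1 s ρ ∩ (lev U w ν)ᶜ) := by
  obtain ⟨hXE, hXK⟩ := hX
  have hn1 : (1:ℝ) ≤ n := by exact_mod_cast hn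
  obtain ⟨r0, hr0, hr0δ, hsub⟩ := lev_start (lev_open hUo hw ν) hXE hδ
  obtain ⟨x, t⟩ := X
  have hx : dist x xb ≤ a := hXK.1
  have ht1 : s1 ≤ t := hXK.2.1
  have ht2 : t ≤ s2 := hXK.2.2
  simp only at hsub ⊢
  set r : ℕ → ℝ := fun k => 2 ^ k * r0 with hr
  set τ : ℕ → ℝ := fun k => t + 5 / 3 * (r k ^ 2 - r0 ^ 2) with hτ
  have hrpos : ∀ k, 0 < r k := fun k => by positivity
  have hrs : ∀ k, r (k + 1) = 2 * r k := fun k => by simp only [hr]; ring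
  have hrge : ∀ k, r0 ≤ r k := by
    intro k
    induction k with
    | zero => simp [hr]
    | succ k ih => rw [hrs]; linarith
  have hτge : ∀ k, t ≤ τ k := by
    intro k
    have := hrge k
    simp only [hτ]; nlinarith
  have hτle : ∀ k, τ k ≤ t + 5 / 3 * r k ^ 2 := by
    intro k
    simp only [hτ]; nlinarith
  have hτs : ∀ k, τ (k + 1) = τ k + 5 * r k ^ 2 := by
    intro k; simp only [hτ, hrs]; ring
  -- growth at a dense level
  have hgrow : ∀ k, r k ≤ δ →
      volume (cyl x (τ k) (r k) \ lev U w ν) ≤ ENNReal.ofReal (c1 * (r k ^ n * r k ^ 2)) →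
      ∀ (y : Fin n → ℝ) (s : ℝ), ‖y - x‖ ≤ r (k + 1) → τ (k + 1) - r (k + 1) ^ 2 ≤ s →
        s ≤ τ (k + 1) → (y, s) ∈ U ∧ θ * ν < w (y, s) := by
    intro k hk hd y s hy hs1 hs2
    have h0 := hrpos k
    have h00 := hτge k
    have h01 := hτle k
    have hk2 : r k ^ 2 ≤ δ ^ 2 := by gcongr
    have hroom : (Metric.closedBall x (3 * n * r k) ×ˢ Icc (τ k - r k ^ 2) (τ k + 5 * r k ^ 2)
        : Set (Pt n)) ⊆ U := by
      rintro ⟨y', s'⟩ ⟨h1, h2⟩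
      apply hU
      simp only [mem_Icc] at h2
      refine ⟨?_, ?_, ?_⟩
      · have h3 : dist y' x ≤ 3 * n * r k := h1
        have h4 := dist_triangle y' x xb
        have : 3 * n * r k ≤ 3 * n * δ := by gcongr
        simp only [Metric.mem_closedBall]
        linarith
      · simp only; linarith
      · simp only; linarith
    have hs1' : τ k + r k ^ 2 ≤ s := by
      have := hτs k
      have := hrs k
      rw [‹r (k+1) = _›, ‹τ (k+1) = _›] at hs1
      linarith
    have hs2' : s ≤ τ k + 5 * r k ^ 2 := by rw [← hτs]; exact hs2
    have hy' : ‖y - x‖ ≤ 2 * r k := by rw [← hrs]; exact hy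
    refine ⟨hroom ⟨?_, ?_, ?_⟩, ?_⟩
    · simp only [Metric.mem_closedBall, dist_eq_norm]
      nlinarith
    · simp only; nlinarith
    · exact hs2'
    · refine hg x (τ k) (r k) ν h0 hν hroom (le_trans (measure_mono ?_) hd) y s hy' hs1' hs2'
      rintro p ⟨h1, h2⟩
      exact ⟨h1, fun h3 => h2 h3.2⟩
  have hex : ∃ j, r j ≤ δ ∧ ¬ volume (cyl x (τ j) (r j) \ lev U w ν) ≤
      ENNReal.ofReal (c1 * (r j ^ n * r j ^ 2)) := by
    by_contra hcon
    push Not at hcon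
    have hun : ∃ k, δ < r k := by
      obtain ⟨k, hk⟩ := pow_unbounded_of_one_lt (δ / r0) (one_lt_two : (1:ℝ) < 2)
      exact ⟨k, by rwa [div_lt_iff₀ hr0] at hk⟩
    classical
    have hm := Nat.find_spec hun
    have hm2 := fun k => Nat.find_min hun (m := k)
    rcases hk : Nat.find hun with _ | k
    · rw [hk] at hm
      simp [hr] at hm
      linarith
    · rw [hk] at hm hm2
      have hkδ : r k ≤ δ := not_lt.1 (hm2 k (Nat.lt_succ_self k))
      have h3 := hgrow k hkδ (hcon k hkδ)
      apply hno
      refine ⟨x, hx, τ (k + 1), ⟨ht1.trans (hτge _), ?_⟩, ?_⟩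
      · have h4 := hτle (k + 1)
        rw [hrs] at h4
        have h0 := hrpos k
        nlinarith
      · intro y hy
        exact (h3 y _ (hy.trans hm.le) (by nlinarith [sq_nonneg (r (k + 1))]) le_rfl).2
  classical
  have hj := Nat.find_spec hex
  have hjm := fun k => Nat.find_min hex (m := k)
  rcases hk : Nat.find hex with _ | k
  · exfalso
    rw [hk] at hj
    apply hj.2
    have : cyl x (τ 0) (r 0) \ lev U w ν = ∅ := by
      rw [diff_eq_empty]
      have h1 : r 0 = r0 := by simp [hr]
      have h2 : τ 0 = t := by simp [hτ, h1]
      rw [h1, h2]; exact hsub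
    rw [this]; simp
  · rw [hk] at hj hjm
    have hkδ : r k ≤ δ := by
      have := hj.1
      rw [hrs] at this
      linarith [hrpos k]
    have hd : volume (cyl x (τ k) (r k) \ lev U w ν) ≤
        ENNReal.ofReal (c1 * (r k ^ n * r k ^ 2)) := by
      have := hjm k (Nat.lt_succ_self k)
      by_contra hcon
      exact this ⟨hkδ, hcon⟩
    have h3 := hgrow k hkδ hd
    refine ⟨τ (k + 1), r (k + 1), hrpos _, hj.1, hτge _, hτle _, ?_, (not_le.1 hj.2).le⟩
    rintro ⟨y, s⟩ ⟨h1, h2⟩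
    have h1' : dist y x ≤ r (k + 1) := h1
    simp only [mem_Icc] at h2
    refine ⟨h3 y s (by rwa [dist_eq_norm] at h1') h2.1 h2.2, ?_, ?_, ?_⟩
    · have := dist_triangle y x xb
      have := hj.1
      simp only [Metric.mem_closedBall]
      linarith
    · have h5 := hτs k
      have h6 := hrs k
      have h7 := hτge k
      simp only
      rw [h5, h6] at h2
      nlinarith [h2.1]
    · have h5 := hτle (k + 1)
      have h6 : r (k + 1) ^ 2 ≤ δ ^ 2 := pow_le_pow_left₀ (hrpos _).le hj.1 2
      simp only
      linarith [h2.2]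

set_option maxHeartbeats 1000000 in
lemma gain {n : ℕ} (hn : 0 < n) {l L : ℝ} (hl : 0 < l) (hL : l ≤ L) :
    ∃ c θ : ℝ, 0 < c ∧ 0 < θ ∧ θ ≤ 1 ∧ ∀ (U : Set (Pt n)) (w : Pt n → ℝ), IsOpen U →
      SupOn l L (fun _ => 1) U w → ContinuousOn w U → (∀ p ∈ U, 0 ≤ w p) →
      ∀ (xb : Fin n → ℝ) (a s1 s2 δ ν : ℝ), 0 < δ → 0 < ν →
      (Metric.closedBall xb (a + 3 * n * δ) ×ˢ Icc (s1 - δ ^ 2) (s2 + 7 * δ ^ 2) : Set (Pt n)) ⊆ U →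
      (∃ x ∈ Metric.closedBall xb a, ∃ t ∈ Icc s1 (s2 + 7 * δ ^ 2),
        ∀ y, ‖y - x‖ ≤ δ → θ * ν < w (y, t)) ∨
      ENNReal.ofReal (1 + c) * volume (lev U w ν ∩ (Metric.closedBall xb a ×ˢ Icc s1 s2 : Set (Pt n)))
        ≤ volume (lev U w (θ * ν) ∩
          (Metric.closedBall xb (a + δ) ×ˢ Icc s1 (s2 + 2 * δ ^ 2) : Set (Pt n))) := by
  obtain ⟨c1, θ, hc1, hθ, hθ1, hg⟩ := growth hn hl hL
  refine ⟨c1 / (24 * 6 ^ n), θ, by positivity, hθ, hθ1, ?_⟩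
  intro U w hUo hs hw hpos xb a s1 s2 δ ν hδ hν hU
  by_cases hno : ∃ x ∈ Metric.closedBall xb a, ∃ t ∈ Icc s1 (s2 + 7 * δ ^ 2),
        ∀ y, ‖y - x‖ ≤ δ → θ * ν < w (y, t)
  · exact Or.inl hno
  right
  set K0 := (Metric.closedBall xb a ×ˢ Icc s1 s2 : Set (Pt n)) with hK0
  set K1 := (Metric.closedBall xb (a + δ) ×ˢ Icc s1 (s2 + 2 * δ ^ 2) : Set (Pt n)) with hK1
  set E := lev U w ν with hE
  set F := lev U w (θ * ν) with hF
  have hch : ∀ X : Pt n, ∃ s ρ : ℝ, X ∈ E ∩ K0 → (0 < ρ ∧ ρ ≤ δ ∧ X.2 ≤ s ∧ s ≤ X.2 + 5 / 3 * ρ ^ 2 ∧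
      cyl X.1 s ρ ⊆ F ∩ K1 ∧
      ENNReal.ofReal (c1 * (ρ ^ n * ρ ^ 2)) ≤ volume (cyl X.1 s ρ ∩ Eᶜ)) := by
    intro X
    by_cases hX : X ∈ E ∩ K0
    · obtain ⟨s, ρ, h⟩ := chain (l := l) (L := L) (hg U w hs hw hpos) hUo hw hn hδ hν hU hno hX
      exact ⟨s, ρ, fun _ => h⟩
    · exact ⟨0, 0, fun h => absurd h hX⟩
  choose s ρ hsρ using hch
  have hEm : MeasurableSet E := (lev_open hUo hw ν).measurableSet
  have hK0m : MeasurableSet K0 := by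
    rw [hK0]; exact (Metric.isClosed_closedBall.measurableSet).prod measurableSet_Icc
  have hV : volume (E ∩ K0) ≤ ENNReal.ofReal (24 * 6 ^ n / c1) * volume ((F ∩ K1) \ E) := by
    refine pvitali_meas (E ∩ K0) (fun X => X.1) s ρ (R := δ)
      (fun X hX => ⟨(hsρ X hX).1, (hsρ X hX).2.1⟩) hEm.compl ?_
      (fun X => Metric.closedBall X.1 (3 * ρ X) ×ˢ Icc (s X - 12 * ρ X ^ 2) (s X + 12 * ρ X ^ 2)) _ ?_ ?_
    · rintro X hX p ⟨h1, h2⟩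
      exact ⟨(hsρ X hX).2.2.2.2.1 h1, h2⟩
    · intro X hX
      obtain ⟨h0, _, _, _, _, h5⟩ := hsρ X hX
      rw [vol_box X.1 (by positivity)]
      refine le_trans ?_ (mul_le_mul_right h5 _)
      rw [← ENNReal.ofReal_mul (by positivity)]
      apply ENNReal.ofReal_le_ofReal
      apply le_of_eq
      have : (2 * (3 * ρ X)) ^ n = 6 ^ n * ρ X ^ n := by rw [← mul_pow]; ring
      rw [this]
      field_simp
      ring
    · intro p hp
      refine ⟨p, hp, fun b hb h1 h2 h3 => ⟨?_, ?_, ?_⟩⟩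
      · simpa [dist_eq_norm] using h1
      all_goals
        obtain ⟨g0, g1, g2, g3, _, _⟩ := hsρ p hp
        rw [abs_le] at h2
        have : ρ p ^ 2 ≤ (2 * ρ b) ^ 2 := pow_le_pow_left₀ g0.le h3 2
        nlinarith [sq_nonneg (ρ b)]
  have hEF : E ⊆ F := by
    rintro p ⟨h1, h2⟩
    refine ⟨h1, ?_⟩
    have : θ * ν ≤ ν := by nlinarith
    linarith
  have hKK : K0 ⊆ K1 := by
    rintro p ⟨h1, h2⟩
    refine ⟨Metric.closedBall_subset_closedBall (by linarith) h1, h2.1, h2.2.trans ?_⟩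
    nlinarith [sq_nonneg δ]
  have hadd : volume ((F ∩ K1) \ E) + volume (E ∩ K0) ≤ volume (F ∩ K1) := by
    rw [← measure_union _ (hEm.inter hK0m)]
    · apply measure_mono
      rintro p (hp | hp)
      · exact hp.1
      · exact ⟨hEF hp.1, hKK hp.2⟩
    · rw [Set.disjoint_left]
      exact fun p hp hp' => hp.2 hp'.1
  refine le_trans ?_ hadd
  rw [ENNReal.ofReal_add (by norm_num) (by positivity), add_mul, add_comm]
  gcongr
  · refine (mul_le_mul_right hV _).trans ?_
    rw [← mul_assoc, ← ENNReal.ofReal_mul (by positivity)]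
    have : c1 / (24 * 6 ^ n) * (24 * 6 ^ n / c1) = 1 := by field_simp
    rw [this]; simp
  · simp

lemma gain_iter {n : ℕ} (hn : 0 < n) {l L : ℝ} (hl : 0 < l) (hL : l ≤ L) :
    ∃ c θ : ℝ, 0 < c ∧ 0 < θ ∧ θ ≤ 1 ∧ ∀ (U : Set (Pt n)) (w : Pt n → ℝ), IsOpen U →
      SupOn l L (fun _ => 1) U w → ContinuousOn w U → (∀ p ∈ U, 0 ≤ w p) →
      ∀ (xb : Fin n → ℝ) (a s1 s2 δ : ℝ), 0 < δ → ∀ N : ℕ,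
      (Metric.closedBall xb (a + N * δ + 3 * n * δ) ×ˢ
        Icc (s1 - δ ^ 2) (s2 + 2 * N * δ ^ 2 + 7 * δ ^ 2) : Set (Pt n)) ⊆ U →
      (∃ x ∈ Metric.closedBall xb (a + N * δ), ∃ t ∈ Icc s1 (s2 + 2 * N * δ ^ 2 + 7 * δ ^ 2),
        ∀ y, ‖y - x‖ ≤ δ → θ ^ N < w (y, t)) ∨
      ENNReal.ofReal ((1 + c) ^ N) *
        volume (lev U w 1 ∩ (Metric.closedBall xb a ×ˢ Icc s1 s2 : Set (Pt n)))
        ≤ volume (lev U w (θ ^ N) ∩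
          (Metric.closedBall xb (a + N * δ) ×ˢ Icc s1 (s2 + 2 * N * δ ^ 2) : Set (Pt n))) := by
  obtain ⟨c, θ, hc, hθ, hθ1, hg⟩ := gain hn hl hL
  refine ⟨c, θ, hc, hθ, hθ1, ?_⟩
  intro U w hUo hs hw hpos xb a s1 s2 δ hδ N
  induction N with
  | zero => intro _; right; simp
  | succ N ih =>
    intro hU
    push_cast at hU ⊢
    have hsub : (Metric.closedBall xb (a + N * δ + 3 * n * δ) ×ˢ
        Icc (s1 - δ ^ 2) (s2 + 2 * N * δ ^ 2 + 7 * δ ^ 2) : Set (Pt n)) ⊆ U := by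
      refine Subset.trans (prod_mono (Metric.closedBall_subset_closedBall ?_)
        (Icc_subset_Icc le_rfl ?_)) hU <;> nlinarith [sq_nonneg δ]
    have hb1 : a + N * δ ≤ a + (N + 1) * δ := by nlinarith
    have hb2 : s2 + 2 * N * δ ^ 2 + 7 * δ ^ 2 ≤ s2 + 2 * (N + 1) * δ ^ 2 + 7 * δ ^ 2 := by
      nlinarith [sq_nonneg δ]
    have hth : θ ^ (N + 1) ≤ θ ^ N := pow_le_pow_of_le_one hθ.le hθ1 (Nat.le_succ N)
    rcases ih hsub with ⟨x, hx, t, ht, h⟩ | h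
    · exact Or.inl ⟨x, Metric.closedBall_subset_closedBall hb1 hx, t, ⟨ht.1, ht.2.trans hb2⟩,
        fun y hy => hth.trans_lt (h y hy)⟩
    · rcases hg U w hUo hs hw hpos xb (a + N * δ) s1 (s2 + 2 * N * δ ^ 2) δ (θ ^ N) hδ
        (by positivity) hsub with ⟨x, hx, t, ht, h'⟩ | h'
      · refine Or.inl ⟨x, Metric.closedBall_subset_closedBall hb1 hx, t, ⟨ht.1, ht.2.trans hb2⟩,
          fun y hy => ?_⟩
        rw [pow_succ, mul_comm]; exact h' y hy
      · right
        have e1 : a + (N + 1) * δ = a + N * δ + δ := by ring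
        have e2 : s2 + 2 * (N + 1) * δ ^ 2 = s2 + 2 * N * δ ^ 2 + 2 * δ ^ 2 := by ring
        have e3 : θ ^ (N + 1) = θ * θ ^ N := by ring
        have e4 : (1 + c) ^ (N + 1) = (1 + c) * (1 + c) ^ N := by ring
        rw [e1, e2, e3, e4, ENNReal.ofReal_mul (by positivity), mul_assoc]
        exact (mul_le_mul_right h _).trans h'

lemma somewhere {n : ℕ} (hn : 0 < n) {l L : ℝ} (hl : 0 < l) (hL : l ≤ L) {a d : ℝ}
    (ha : 0 < a) (hd : 0 < d) :
    ∃ δ θ : ℝ, 0 < δ ∧ δ ≤ a ∧ 0 < θ ∧ ∀ (U : Set (Pt n)) (w : Pt n → ℝ), IsOpen U →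
      SupOn l L (fun _ => 1) U w → ContinuousOn w U → (∀ p ∈ U, 0 ≤ w p) →
      ∀ (xb : Fin n → ℝ) (s1 : ℝ),
      (Metric.closedBall xb (2 * a) ×ˢ Icc (s1 - d) (s1 + 2 * d) : Set (Pt n)) ⊆ U →
      ENNReal.ofReal ((2 * a) ^ n * d / 2) ≤
        volume (lev U w 1 ∩ (Metric.closedBall xb a ×ˢ Icc s1 (s1 + d) : Set (Pt n))) →
      ∃ x ∈ Metric.closedBall xb (2 * a), ∃ t ∈ Icc s1 (s1 + 2 * d),
        ∀ y, ‖y - x‖ ≤ δ → θ < w (y, t) := by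
  obtain ⟨c, θ, hc, hθ, hθ1, hg⟩ := gain_iter hn hl hL
  have hn1 : (1:ℝ) ≤ n := by exact_mod_cast hn
  obtain ⟨N, hN⟩ := pow_unbounded_of_one_lt (4 * 2 ^ n : ℝ) (show 1 < 1 + c by linarith)
  obtain ⟨δ, hδ, h1, h2, h3⟩ : ∃ δ : ℝ, 0 < δ ∧ (N + 3 * n) * δ ≤ a ∧ (2 * N + 7) * δ ^ 2 ≤ d ∧ δ ≤ 1 := by
    refine ⟨min (a / (N + 3 * n)) (min (d / (2 * N + 7)) 1), by positivity, ?_, ?_, ?_⟩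
    · rw [← le_div_iff₀' (by positivity)]; exact min_le_left _ _
    · rw [← le_div_iff₀' (by positivity)]
      have e1 : min (a / (N + 3 * n)) (min (d / (2 * N + 7)) 1) ≤ 1 :=
        (min_le_right _ _).trans (min_le_right _ _)
      have e2 : min (a / (N + 3 * n)) (min (d / (2 * N + 7)) 1) ≤ d / (2 * N + 7) :=
        (min_le_right _ _).trans (min_le_left _ _)
      have e0 : 0 < min (a / (N + 3 * n)) (min (d / (2 * N + 7)) 1) := by positivity
      nlinarith
    · exact (min_le_right _ _).trans (min_le_right _ _)
  have hN0 : (0:ℝ) ≤ N := Nat.cast_nonneg N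
  have hNδ : 0 ≤ N * δ := by positivity
  have hNδ2 : 0 ≤ N * δ ^ 2 := by positivity
  refine ⟨δ, θ ^ N, hδ, by nlinarith, by positivity, ?_⟩
  intro U w hUo hs hw hpos xb s1 hU hvol
  have hb1 : a + N * δ ≤ 2 * a := by nlinarith
  have hb2 : s1 + d + 2 * N * δ ^ 2 + 7 * δ ^ 2 ≤ s1 + 2 * d := by nlinarith
  rcases hg U w hUo hs hw hpos xb a s1 (s1 + d) δ hδ N (by
    refine Subset.trans (prod_mono (Metric.closedBall_subset_closedBall ?_)
        (Icc_subset_Icc ?_ ?_)) hU <;> nlinarith) with ⟨x, hx, t, ht, h⟩ | h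
  · exact ⟨x, Metric.closedBall_subset_closedBall hb1 hx, t, ⟨ht.1, ht.2.trans hb2⟩, h⟩
  · exfalso
    have e1 := (mul_le_mul_right hvol (ENNReal.ofReal ((1 + c) ^ N))).trans h
    have e2 : volume (lev U w (θ ^ N) ∩
          (Metric.closedBall xb (a + N * δ) ×ˢ Icc s1 (s1 + d + 2 * N * δ ^ 2) : Set (Pt n))) ≤
          ENNReal.ofReal ((2 * (2 * a)) ^ n * (s1 + 2 * d - s1)) := by
      rw [← vol_box xb (by positivity)]
      apply measure_mono
      refine inter_subset_right.trans (prod_mono (Metric.closedBall_subset_closedBall hb1)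
        (Icc_subset_Icc le_rfl ?_))
      nlinarith [sq_nonneg δ]
    have e3 := e1.trans e2
    rw [← ENNReal.ofReal_mul (by positivity)] at e3
    have e5 : (2 * (2 * a)) ^ n * (s1 + 2 * d - s1) = 4 * 2 ^ n * ((2 * a) ^ n * d / 2) := by
      rw [mul_pow 2 (2 * a)]; ring
    rw [e5, ENNReal.ofReal_le_ofReal_iff (by positivity)] at e3
    have e4 : 0 < (2 * a) ^ n * d / 2 := by positivity
    have := le_of_mul_le_mul_right e3 e4
    linarith

end MBC

namespace MBC

/-- The exponent of the boundary barrier. -/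
def sg (γ : ℝ) : ℝ := 2 - max γ 0

lemma sg_one {γ : ℝ} (hγ : γ < 1) : 1 < sg γ := by
  have : max γ 0 < 1 := max_lt hγ one_pos
  unfold sg; linarith

lemma sg_two (γ : ℝ) : sg γ ≤ 2 := by
  have : 0 ≤ max γ 0 := le_max_right _ _
  unfold sg; linarith

/-- The boundary barrier. -/
def bb {n : ℕ} [NeZero n] (γ α k B : ℝ) (x0 : Fin n → ℝ) (t0 : ℝ) (p : Pt n) : ℝ :=
  α * xlast p.1 + k * xlast p.1 ^ sg γ - B * ssq x0 p.1 + B * (p.2 - t0)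

lemma xlast_hasFDerivAt {n : ℕ} [NeZero n] (x : Fin n → ℝ) : HasFDerivAt (fun x : Fin n → ℝ => xlast x)
    (ContinuousLinearMap.proj (lastIdx n) : (Fin n → ℝ) →L[ℝ] ℝ) x :=
  (ContinuousLinearMap.proj (R := ℝ) (φ := fun _ : Fin n => ℝ) (lastIdx n)).hasFDerivAt

lemma fderiv_bb {n : ℕ} [NeZero n] {γ : ℝ} (hγ : γ < 1) (α k B : ℝ) (x0 : Fin n → ℝ) (t0 t : ℝ)
    (x : Fin n → ℝ) (j : Fin n) :
    fderiv ℝ (fun y => bb γ α k B x0 t0 (y, t)) x (Pi.single j 1) =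
      (α + k * sg γ * xlast x ^ (sg γ - 1)) * (if j = lastIdx n then 1 else 0)
        - 2 * B * (x j - x0 j) := by
  have h1 := (xlast_hasFDerivAt x).const_mul α
  have h2 := ((xlast_hasFDerivAt x).rpow_const (p := sg γ) (Or.inr (sg_one hγ).le)).const_mul k
  have h3 := (hasFDerivAt_ssq x0 x).const_mul B
  have h4 := (((h1.add h2).sub h3).add_const (B * (t - t0))).fderiv
  have : (fun y => bb γ α k B x0 t0 (y, t)) = fun y : Fin n → ℝ =>
    (((fun y : Fin n → ℝ => α * xlast y) +
    (fun y : Fin n → ℝ => k * xlast y ^ sg γ) - (fun y : Fin n → ℝ => B * ssq x0 y)) : (Fin n → ℝ) → ℝ) y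
      + B * (t - t0) := rfl
  rw [this, h4]
  simp only [ContinuousLinearMap.add_apply, ContinuousLinearMap.smul_apply,
    ContinuousLinearMap.sub_apply, fderiv_ssq_apply, smul_eq_mul, ContinuousLinearMap.proj_apply,
    Pi.single_apply]
  by_cases hj : j = lastIdx n
  · simp [hj]; ring
  · have : ¬ lastIdx n = j := fun h => hj h.symm
    simp [hj, this]; ring

lemma hess_bb {n : ℕ} [NeZero n] {γ : ℝ} (hγ : γ < 1) (α k B : ℝ) (x0 : Fin n → ℝ) (t0 : ℝ)
    (p : Pt n) (hp : 0 < xlast p.1) (i j : Fin n) :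
    hess (bb γ α k B x0 t0) p i j = (if i = j then -(2 * B) else 0)
      + (k * (sg γ * (sg γ - 1)) * xlast p.1 ^ (sg γ - 2)) * (Pi.single (lastIdx n) 1 : Fin n → ℝ) i
        * (Pi.single (lastIdx n) 1 : Fin n → ℝ) j := by
  unfold hess
  simp only [fderiv_bb hγ]
  have hpj : HasFDerivAt (fun x : Fin n → ℝ => x j - x0 j)
      (ContinuousLinearMap.proj j : (Fin n → ℝ) →L[ℝ] ℝ) p.1 :=
    ((ContinuousLinearMap.proj (R := ℝ) (φ := fun _ : Fin n => ℝ) j).hasFDerivAt).sub_const (x0 j)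
  have h1 := ((((xlast_hasFDerivAt p.1).rpow_const (p := sg γ - 1) (Or.inl hp.ne')).const_mul
    (k * sg γ)).const_add α).mul_const (if j = lastIdx n then (1:ℝ) else 0)
  have h3 := (h1.sub (hpj.const_mul (2 * B))).fderiv
  have : (fun x : Fin n → ℝ => (α + k * sg γ * xlast x ^ (sg γ - 1)) * (if j = lastIdx n then 1 else 0)
        - 2 * B * (x j - x0 j)) =
    ((fun x : Fin n → ℝ => (α + k * sg γ * xlast x ^ (sg γ - 1)) * (if j = lastIdx n then 1 else 0))
      - fun x => 2 * B * (x j - x0 j)) := rfl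
  rw [this, h3]
  have e : sg γ - 1 - 1 = sg γ - 2 := by ring
  rw [e]
  simp only [ContinuousLinearMap.smul_apply,
    ContinuousLinearMap.sub_apply, smul_eq_mul, ContinuousLinearMap.proj_apply,
    Pi.single_apply]
  by_cases hij : i = j
  · subst hij
    by_cases hj : i = lastIdx n
    · simp [hj]; ring
    · have : ¬ lastIdx n = i := fun h => hj h.symm
      simp [hj]
  · have hji : ¬ j = i := fun h => hij h.symm
    by_cases hj : j = lastIdx n
    · have h4 : ¬ i = lastIdx n := fun h => hij (h.trans hj.symm)
      have h5 : ¬ lastIdx n = i := fun h => h4 h.symm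
      simp [hij, hji, hj, h4, h5]
    · simp [hij, hji, hj]

lemma bb_continuous {n : ℕ} [NeZero n] {γ : ℝ} (hγ : γ < 1) (α k B : ℝ) (x0 : Fin n → ℝ) (t0 : ℝ) :
    Continuous (bb γ α k B x0 t0) := by
  have h1 : Continuous fun p : Pt n => xlast p.1 := xlast_continuous
  have h2 : Continuous fun p : Pt n => ssq x0 p.1 := ssq0_continuous x0
  have h3 : Continuous fun p : Pt n => xlast p.1 ^ sg γ :=
    h1.rpow_const fun p => Or.inr (by linarith [sg_one hγ])
  unfold bb
  fun_prop

lemma bb_contDiffAt {n : ℕ} [NeZero n] {γ : ℝ} (α k B : ℝ) (x0 : Fin n → ℝ) (t0 : ℝ)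
    (p : Pt n) (hp : 0 < xlast p.1) : ContDiffAt ℝ 2 (bb γ α k B x0 t0) p := by
  have h0 : ContDiff ℝ 2 fun p : Pt n => xlast p.1 := by unfold xlast; fun_prop
  have h1 : ContDiffAt ℝ 2 (fun p : Pt n => xlast p.1) p := h0.contDiffAt
  have h2 : ContDiffAt ℝ 2 (fun p : Pt n => ssq x0 p.1) p :=
    ((ssq_contDiff x0).comp contDiff_fst).contDiffAt
  have h3 : ContDiffAt ℝ 2 (fun p : Pt n => xlast p.1 ^ sg γ) p := h1.rpow_const_of_ne hp.ne'
  have h4 : ContDiffAt ℝ 2 (fun p : Pt n => B * (p.2 - t0)) p := by fun_prop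
  exact (((contDiffAt_const.mul h1).add (contDiffAt_const.mul h3)).sub
    (contDiffAt_const.mul h2)).add h4

lemma bb_strict {γ lam Lam k B x : ℝ} {n : ℕ} (hlam : 0 < lam) (hLam : lam ≤ Lam) (hB : 0 ≤ B)
    (hk : B * (2 * (n * Lam) + 1) < k * (lam * (sg γ * (sg γ - 1)))) (hx : 0 < x) (hx1 : x ≤ 1) :
    B < x ^ γ * (-(2 * B) * (n * Lam) + (k * (sg γ * (sg γ - 1)) * x ^ (sg γ - 2)) * lam) := by
  set P := x ^ γ
  set S := x ^ (sg γ - 2)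
  have hP : 0 < P := Real.rpow_pos_of_pos hx _
  have hS : 1 ≤ S := Real.one_le_rpow_of_pos_of_le_one_of_nonpos hx hx1 (by linarith [sg_two γ])
  have hPS : 1 ≤ P * S := by
    rw [← Real.rpow_add hx]
    apply Real.one_le_rpow_of_pos_of_le_one_of_nonpos hx hx1
    unfold sg
    linarith [le_max_left γ 0]
  have hLam0 : 0 < Lam := hlam.trans_le hLam
  have hc : 0 ≤ 2 * B * (n * Lam) := by positivity
  set b := k * (lam * (sg γ * (sg γ - 1)))
  have e : P * (-(2 * B) * (n * Lam) + (k * (sg γ * (sg γ - 1)) * S) * lam) =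
    b * (P * S) - 2 * B * (n * Lam) * P := by ring
  rw [e]
  have h1 : P ≤ P * S := by nlinarith
  have h2 : 2 * B * (n * Lam) * P ≤ 2 * B * (n * Lam) * (P * S) := by gcongr
  have h3 : 0 ≤ b - 2 * B * (n * Lam) - B := by linarith
  nlinarith

set_option maxHeartbeats 1000000 in
/-- Comparison with the boundary barrier. -/
lemma bdry_barrier {n : ℕ} [NeZero n] {γ lam Lam : ℝ} (hγ : γ < 1) (hlam : 0 < lam)
    (hLam : lam ≤ Lam) {w : Pt n → ℝ}
    (hs : SupOn lam Lam (fun x => xlast x ^ γ) (U0 n) w) (hw : ContinuousOn w (F0 n))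
    (x0 : Fin n → ℝ) {t0 τ ρ h α k B : ℝ} (hτ : 0 < τ) (hh : h ≤ 1) (hB : 0 ≤ B) (hk0 : 0 ≤ k)
    (hk : B * (2 * (n * Lam) + 1) < k * (lam * (sg γ * (sg γ - 1))))
    (hdom : ∀ y t, ssq x0 y ≤ ρ ^ 2 → 0 ≤ xlast y → xlast y ≤ h → t0 - τ ≤ t → t ≤ t0 → (y, t) ∈ F0 n)
    (hbd : ∀ y t, ssq x0 y ≤ ρ ^ 2 → 0 ≤ xlast y → xlast y ≤ h → t0 - τ ≤ t → t ≤ t0 →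
      (xlast y = 0 ∨ xlast y = h ∨ ssq x0 y = ρ ^ 2 ∨ t = t0 - τ) →
      bb γ α k B x0 t0 (y, t) ≤ w (y, t)) :
    ∀ y t, ssq x0 y ≤ ρ ^ 2 → 0 ≤ xlast y → xlast y ≤ h → t0 - τ ≤ t → t ≤ t0 →
      bb γ α k B x0 t0 (y, t) ≤ w (y, t) := by
  set K : Set (Pt n) := {p | ssq x0 p.1 ≤ ρ ^ 2 ∧ 0 ≤ xlast p.1 ∧ xlast p.1 ≤ h ∧ t0 - τ ≤ p.2 ∧ p.2 ≤ t0}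
    with hKdef
  have hKF : K ⊆ F0 n := fun p hp => hdom p.1 p.2 hp.1 hp.2.1 hp.2.2.1 hp.2.2.2.1 hp.2.2.2.2
  have hsc := ssq0_continuous (n := n) x0
  have hxc := xlast_continuous (n := n)
  have hKc : IsCompact K := by
    apply Metric.isCompact_of_isClosed_isBounded
    · apply IsClosed.and (isClosed_le hsc continuous_const)
      apply IsClosed.and (isClosed_le continuous_const hxc)
      apply IsClosed.and (isClosed_le hxc continuous_const)
      apply IsClosed.and (isClosed_le continuous_const continuous_snd)
      exact isClosed_le continuous_snd continuous_const
    · apply (Metric.isBounded_closedBall (x := x0) (r := |ρ|)).prod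
        (Metric.isBounded_Icc (t0 - τ) t0) |>.subset
      intro p hp
      refine ⟨?_, hp.2.2.2⟩
      rw [mem_closedBall_iff_norm]
      apply norm_le_of_ssq (abs_nonneg ρ)
      rw [sq_abs]
      exact hp.1
  have hbad : ∀ p ∈ K, w p < bb γ α k B x0 t0 p → ssq x0 p.1 < ρ ^ 2 ∧ 0 < xlast p.1 ∧ xlast p.1 < h ∧
      t0 - τ < p.2 := by
    intro p hp hlt
    have := hbd p.1 p.2 hp.1 hp.2.1 hp.2.2.1 hp.2.2.2.1 hp.2.2.2.2
    have hno : ¬ (xlast p.1 = 0 ∨ xlast p.1 = h ∨ ssq x0 p.1 = ρ ^ 2 ∨ p.2 = t0 - τ) := by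
      intro hc
      exact absurd (this hc) (not_le.2 hlt)
    push Not at hno
    exact ⟨lt_of_le_of_ne hp.1 hno.2.2.1, lt_of_le_of_ne hp.2.1 (Ne.symm hno.1),
      lt_of_le_of_ne hp.2.2.1 hno.2.1, lt_of_le_of_ne hp.2.2.2.1 (Ne.symm hno.2.2.2)⟩
  have main := comparison hs hKc (T := t0) (φ := bb γ α k B x0 t0) (fun p hp => hp.2.2.2.2) (hw.mono hKF)
    (bb_continuous hγ _ _ _ _ _).continuousOn ?_ ?_
  · intro y t h1 h2 h3 h4 h5
    exact main (y, t) ⟨h1, h2, h3, h4, h5⟩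
  · intro p hp hpt hlt
    obtain ⟨h1, h2, h3, h4⟩ := hbad p hp hlt
    have hev : ∀ᶠ s in 𝓝[<] t0, (p.1, s) ∈ K ∩ {q | q.2 < t0} := by
      filter_upwards [self_mem_nhdsWithin,
        nhdsWithin_le_nhds (lt_mem_nhds (show t0 - τ < t0 by linarith))] with s hs2 hs3
      exact ⟨⟨h1.le, h2.le, h3.le, hs3.le, le_of_lt hs2⟩, hs2⟩
    apply mem_closure_of_tendsto _ hev
    have : Continuous fun s : ℝ => (p.1, s) := by fun_prop
    have := (this.tendsto t0).mono_left (nhdsWithin_le_nhds (s := Iio t0))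
    rwa [show ((p.1, t0) : Pt n) = p from by rw [← hpt]] at this
  · intro p hp hpt hlt
    obtain ⟨h1, h2, h3, h4⟩ := hbad p hp hlt
    have hpF := hKF hp
    refine ⟨⟨hpF.1, hpF.2.1, hpF.2.2.1, h2⟩, ?_, bb_contDiffAt _ _ _ _ _ p h2, ?_⟩
    · have o : IsOpen {p : Pt n | ssq x0 p.1 < ρ ^ 2 ∧ 0 < xlast p.1 ∧ xlast p.1 < h ∧ t0 - τ < p.2 ∧ p.2 < t0} := by
        apply IsOpen.and (isOpen_lt hsc continuous_const)
        apply IsOpen.and (isOpen_lt continuous_const hxc)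
        apply IsOpen.and (isOpen_lt hxc continuous_const)
        apply IsOpen.and (isOpen_lt continuous_const continuous_snd)
        exact isOpen_lt continuous_snd continuous_const
      exact mem_of_superset (o.mem_nhds ⟨h1, h2, h3, h4, hpt⟩) fun q hq =>
        ⟨hq.1.le, hq.2.1.le, hq.2.2.1.le, hq.2.2.2.1.le, hq.2.2.2.2.le⟩
    · have hs1 := sg_one hγ
      refine ⟨-(2 * B) * (n * Lam) + (k * (sg γ * (sg γ - 1)) * xlast p.1 ^ (sg γ - 2)) * lam, ?_, ?_⟩
      · intro A hA
        have h7 : ∑ i, (Pi.single (lastIdx n) (1:ℝ) : Fin n → ℝ) i ^ 2 = 1 := by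
          rw [Finset.sum_eq_single (lastIdx n)] <;> simp +contextual
        have h6 : 0 ≤ xlast p.1 ^ (sg γ - 2) := Real.rpow_nonneg h2.le _
        have h8 : 0 ≤ sg γ * (sg γ - 1) := by nlinarith
        have := trace_quad hA (Pi.single (lastIdx n) 1) (-(2 * B))
          (k * (sg γ * (sg γ - 1)) * xlast p.1 ^ (sg γ - 2)) (by linarith) (by positivity) _
          (hess_bb hγ α k B x0 t0 p h2)
        rw [h7] at this
        linarith
      · have htd : timeD (bb γ α k B x0 t0) p = B := by
          unfold timeD bb
          have d1 : HasDerivAt (fun s : ℝ => α * xlast p.1 + k * xlast p.1 ^ sg γ - B * ssq x0 p.1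
            + B * (s - t0)) (B * 1) p.2 :=
            (((hasDerivAt_id p.2).sub_const t0).const_mul B).const_add _
          rw [d1.deriv, mul_one]
        rw [htd]
        exact bb_strict hlam hLam hB hk h2 (by linarith)

end MBC

namespace MBC

lemma ssq_tri {n : ℕ} (x y z : Fin n → ℝ) : ssq x z ≤ 2 * ssq x y + 2 * ssq y z := by
  unfold ssq
  rw [Finset.mul_sum, Finset.mul_sum, ← Finset.sum_add_distrib]
  apply Finset.sum_le_sum
  intro i _
  nlinarith [sq_nonneg ((z i - y i) - (y i - x i))]

lemma ssq_comm {n : ℕ} (x y : Fin n → ℝ) : ssq x y = ssq y x := by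
  unfold ssq
  refine Finset.sum_congr rfl fun i _ => by ring

/-- Replace the last coordinate. -/
def setl {n : ℕ} [NeZero n] (x : Fin n → ℝ) (s : ℝ) : Fin n → ℝ := Function.update x (lastIdx n) s

lemma xlast_setl {n : ℕ} [NeZero n] (x : Fin n → ℝ) (s : ℝ) : xlast (setl x s) = s := by
  simp [xlast, setl]

lemma setl_xlast {n : ℕ} [NeZero n] (x : Fin n → ℝ) : setl x (xlast x) = x := by
  simp [xlast, setl]

lemma setl_setl {n : ℕ} [NeZero n] (x : Fin n → ℝ) (s t : ℝ) : setl (setl x s) t = setl x t := by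
  simp [setl]

lemma ssq_setl {n : ℕ} [NeZero n] (x y : Fin n → ℝ) (s t : ℝ) :
    ssq (setl x s) (setl y t) = ssq (setl x 0) (setl y 0) + (t - s) ^ 2 := by
  unfold ssq
  rw [← Finset.add_sum_erase _ _ (Finset.mem_univ (lastIdx n)),
    ← Finset.add_sum_erase _ (fun i => (setl y 0 i - setl x 0 i) ^ 2) (Finset.mem_univ (lastIdx n))]
  have : ∑ i ∈ Finset.univ.erase (lastIdx n), (setl y t i - setl x s i) ^ 2 =
    ∑ i ∈ Finset.univ.erase (lastIdx n), (setl y 0 i - setl x 0 i) ^ 2 := by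
    refine Finset.sum_congr rfl fun i hi => ?_
    have : i ≠ lastIdx n := Finset.ne_of_mem_erase hi
    simp [setl, this]
  rw [this]
  simp [setl]
  ring

lemma setl_zero {n : ℕ} [NeZero n] : setl (0 : Fin n → ℝ) 0 = 0 := by
  ext i; simp [setl]

lemma ssq0_setl {n : ℕ} [NeZero n] (x : Fin n → ℝ) (t : ℝ) :
    ssq 0 (setl x t) = ssq 0 (setl x 0) + t ^ 2 := by
  have := ssq_setl 0 x 0 t
  rw [setl_zero] at this
  rw [this]; ring

lemma ssq0_split {n : ℕ} [NeZero n] (x : Fin n → ℝ) :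
    ssq 0 x = ssq 0 (setl x 0) + xlast x ^ 2 := by
  rw [← ssq0_setl, setl_xlast]

lemma ssq_flat {n : ℕ} [NeZero n] (x : Fin n → ℝ) : ssq (setl x 0) x = xlast x ^ 2 := by
  have := ssq_setl x x 0 (xlast x)
  rw [setl_xlast] at this
  rw [this]
  have : ssq (setl x 0) (setl x 0) = 0 := by simp [ssq]
  rw [this]; ring

lemma xlast_sq_le {n : ℕ} [NeZero n] (z x : Fin n → ℝ) : (xlast x - xlast z) ^ 2 ≤ ssq z x :=
  sq_le_ssq z x (lastIdx n)

lemma rpow_sg_le {γ x : ℝ} (hγ : γ < 1) (h0 : 0 ≤ x) (h1 : x ≤ 1) : x ^ sg γ ≤ x := by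
  rcases h0.eq_or_lt with h | h
  · rw [← h, Real.zero_rpow (by linarith [sg_one hγ])]
  · conv_rhs => rw [← Real.rpow_one x]
    exact Real.rpow_le_rpow_of_exponent_ge h h1 (sg_one hγ).le

lemma sq_le_rpow_sg {γ x : ℝ} (h0 : 0 ≤ x) (h1 : x ≤ 1) : x ^ 2 ≤ x ^ sg γ := by
  rcases h0.eq_or_lt with h | h
  · rw [← h]; simp; apply Real.rpow_nonneg le_rfl
  · rw [← Real.rpow_two]
    exact Real.rpow_le_rpow_of_exponent_ge h h1 (sg_two γ)

lemma exists_kconst (n : ℕ) {γ lam Lam : ℝ} (hγ : γ < 1) (hlam : 0 < lam) (hLam : lam ≤ Lam) (B : ℝ)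
    (hB : 0 ≤ B) : ∃ k, B + 1 ≤ k ∧ B * (2 * (n * Lam) + 1) < k * (lam * (sg γ * (sg γ - 1))) := by
  have hs := sg_one hγ
  have hD : 0 < lam * (sg γ * (sg γ - 1)) :=
    mul_pos hlam (mul_pos (by linarith) (by linarith))
  have hL0 : 0 < Lam := hlam.trans_le hLam
  refine ⟨B * (2 * (n * Lam) + 1) / (lam * (sg γ * (sg γ - 1))) + (B + 1), ?_, ?_⟩
  · have : 0 ≤ B * (2 * (n * Lam) + 1) / (lam * (sg γ * (sg γ - 1))) := by positivity
    linarith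
  · rw [add_mul, div_mul_cancel₀ _ hD.ne']
    have : 0 < (B + 1) * (lam * (sg γ * (sg γ - 1))) := by positivity
    linarith

/-- One-sided Lipschitz bound at the flat boundary. -/
lemma bdry_lower (n : ℕ) [NeZero n] {γ lam Lam : ℝ} (hγ : γ < 1) (hlam : 0 < lam) (hLam : lam ≤ Lam) :
    ∃ C : ℝ, 4 ≤ C ∧ ∀ w : Pt n → ℝ, SupOn lam Lam (fun x => xlast x ^ γ) (U0 n) w →
      ContinuousOn w (F0 n) → (∀ p ∈ F0 n, -1 ≤ w p) → (∀ p ∈ F0 n, xlast p.1 = 0 → 0 ≤ w p) →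
      ∀ p ∈ F0 n, ssq 0 p.1 ≤ 1 / 4 → -(1 / 2) < p.2 → -(C * xlast p.1) ≤ w p := by
  obtain ⟨k, hk1, hk⟩ := exists_kconst n hγ hlam hLam 16 (by norm_num)
  refine ⟨2 * k, by linarith, ?_⟩
  intro w hs hw hlow hflat p hp hp1 hp2
  obtain ⟨-, hpt1, hpt2, hpx⟩ := hp
  by_cases hx : xlast p.1 ≤ 1 / 4
  · have hx0 : ssq 0 (setl p.1 0) ≤ 1 / 4 := by
      have := ssq0_split p.1
      nlinarith [sq_nonneg (xlast p.1)]
    have hdom : ∀ y t, ssq (setl p.1 0) y ≤ (1 / 4) ^ 2 → 0 ≤ xlast y → xlast y ≤ 1 → p.2 - 1 / 2 ≤ t →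
        t ≤ p.2 → (y, t) ∈ F0 n := by
      intro y t h1 h2 h3 h4 h5
      refine ⟨?_, ?_, ?_, h2⟩
      · have := ssq_tri 0 (setl p.1 0) y
        norm_num at h1
        show ssq 0 y < 1
        linarith
      · show -1 < t
        linarith
      · show t < 0
        linarith
    have := bdry_barrier hγ hlam hLam hs hw (setl p.1 0) (t0 := p.2) (τ := 1 / 2) (ρ := 1 / 4) (h := 1)
      (α := -(2 * k)) (k := k) (B := 16) (by norm_num) le_rfl (by norm_num) (by linarith) hk hdom ?_
      p.1 p.2 (by rw [ssq_flat]; gcongr) hpx (by linarith) (by linarith) le_rfl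
    · unfold bb at this
      rw [ssq_flat] at this
      have h3 := sq_le_rpow_sg (γ := γ) hpx (by linarith)
      have h4 : k * xlast p.1 ^ 2 ≤ k * xlast p.1 ^ sg γ := by gcongr
      have h5 : w (p.1, p.2) = w p := rfl
      nlinarith [sq_nonneg (xlast p.1)]
    · intro y t h1 h2 h3 h4 h5 hc
      have hF := hdom y t h1 h2 h3 h4 h5
      have e0 := ssq_nonneg (setl p.1 0) y
      have e1 := rpow_sg_le hγ h2 h3
      have e2 : k * xlast y ^ sg γ ≤ k * xlast y := by gcongr
      have e3 : 0 ≤ k * xlast y := mul_nonneg (by linarith) h2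
      have e4 := hlow _ hF
      unfold bb
      simp only
      rcases hc with hc | hc | hc | hc
      · have := hflat _ hF hc
        linarith
      · exfalso
        have := xlast_sq_le (setl p.1 0) y
        rw [xlast_setl, hc] at this
        norm_num at this h1
        linarith
      · rw [hc]
        linarith
      · linarith
  · push Not at hx
    have := hlow p ⟨by linarith, hpt1, hpt2, hpx⟩
    nlinarith

/-- Expansion of positivity by the interior barrier. -/
lemma spread1 (n : ℕ) {l L : ℝ} (hl : 0 < l) (hL : l ≤ L) {κ : ℝ} (hκ : 0 < κ) (hκ1 : κ ≤ 1) :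
    ∃ c : ℝ, 0 < c ∧ ∀ (U : Set (Pt n)) (w : Pt n → ℝ), SupOn l L (fun _ => 1) U w →
      ContinuousOn w U → (∀ p ∈ U, 0 ≤ w p) → ∀ (z : Fin n → ℝ) (R t1 t2 m : ℝ), κ ≤ R → R ≤ 1 →
      t1 + 1 / 4 ≤ t2 → t2 ≤ t1 + 1 / 2 → 0 < m →
      (∀ x t, ssq z x ≤ R ^ 2 → t1 ≤ t → t ≤ t2 → (x, t) ∈ U) →
      (∀ x, ssq z x ≤ κ ^ 2 → m ≤ w (x, t1)) →
      ∀ x, ssq z x ≤ R ^ 2 → c * m * (R ^ 2 - ssq z x) ^ 2 ≤ w (x, t2) := by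
  have hL0 : 0 < L := hl.trans_le hL
  set q := (8 + 4 * (n * L) + 8 * l) ^ 2 / (16 * l * κ ^ 2) with hq
  have hq0 : 0 ≤ q := by positivity
  refine ⟨rexp (-q), Real.exp_pos _, ?_⟩
  intro U w hs hw hpos z R t1 t2 m hR hR1 ht1 ht2 hm hD hinit x hx
  have hd : 0 < t2 - t1 := by linarith
  have hRκ : 0 ≤ R ^ 2 - κ ^ 2 := by nlinarith
  have hβ : (R ^ 2 - κ ^ 2) / (t2 - t1) ≤ 4 := by
    rw [div_le_iff₀ hd]; nlinarith
  have hβ0 : 0 ≤ (R ^ 2 - κ ^ 2) / (t2 - t1) := by positivity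
  have := barrier hl hL hs hw 0 z (κ := κ) (R := R) (β := (R ^ 2 - κ ^ 2) / (t2 - t1)) (t1 := t1)
    (t2 := t2) (q := q) (m := m) (H := 0) (K0 := 0) (a := 0) hκ (by linarith) hβ0
    (by field_simp; ring) le_rfl hm hq0
    (by
      have e : 16 * l * κ ^ 2 * q = (8 + 4 * (n * L) + 8 * l) ^ 2 := by rw [hq]; field_simp
      rw [e]
      have hnL : 0 ≤ n * L := by positivity
      gcongr
      linarith)
    (by
      have : 0 < 4 * l * m / κ ^ 2 * rexp (-(q * (t2 - t1))) := by positivity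
      linarith)
    hD (fun x s h1 h2 h3 => by simpa using hpos _ (hD x s h1 h2 h3))
    (fun x hx => by simpa using hinit x hx) x hx
  refine le_trans ?_ this
  have e1 : rexp (-q) ≤ rexp (-(q * (t2 - t1))) := by
    apply Real.exp_le_exp.2; nlinarith
  have e2 : m ≤ m / κ ^ 4 := by
    rw [le_div_iff₀ (by positivity)]
    have : κ ^ 4 ≤ 1 := pow_le_one₀ hκ.le hκ1
    nlinarith
  have e3 : rexp (-q) * m * (R ^ 2 - ssq z x) ^ 2 ≤
      m / κ ^ 4 * rexp (-(q * (t2 - t1))) * (R ^ 2 - ssq z x) ^ 2 := by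
    rw [mul_comm (rexp (-q)) m]
    gcongr
  linarith

lemma rpow_bounds {a x γ : ℝ} (ha : 0 < a) (hax : a ≤ x) (hx1 : x ≤ 1) :
    min 1 (a ^ γ) ≤ x ^ γ ∧ x ^ γ ≤ max 1 (a ^ γ) := by
  have hx : 0 < x := ha.trans_le hax
  rcases le_total 0 γ with h | h
  · exact ⟨(min_le_right _ _).trans (Real.rpow_le_rpow ha.le hax h),
      (Real.rpow_le_one hx.le hx1 h).trans (le_max_left _ _)⟩
  · exact ⟨(min_le_left _ _).trans (Real.one_le_rpow_of_pos_of_le_one_of_nonpos hx hx1 h),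
      (Real.rpow_le_rpow_of_nonpos ha hax h).trans (le_max_right _ _)⟩

/-- The reference set for the measure condition. -/
def Kref (n : ℕ) [NeZero n] : Set (Pt n) :=
  Metric.closedBall (setl 0 (1 / 4)) (1 / (128 * n)) ×ˢ Icc (-(7 / 8)) (-(7 / 8) + 1 / 16)

lemma ref_room {n : ℕ} [NeZero n] {x : Fin n → ℝ}
    (hx : ‖x - setl 0 (1 / 4)‖ ≤ 2 * (1 / (128 * n))) :
    ssq (setl 0 (1 / 4)) x ≤ 1 / 4096 ∧ ssq 0 x ≤ 1 / 8 + 2 / 4096 ∧ 1 / 4 - 1 / 64 ≤ xlast x := by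
  have hn1 : (1:ℝ) ≤ n := by exact_mod_cast Nat.pos_of_ne_zero (NeZero.ne n)
  have h1 : ssq (setl 0 (1 / 4)) x ≤ 1 / 4096 := by
    refine (ssq_le_of_norm hx).trans ?_
    rw [show (n:ℝ) * (2 * (1 / (128 * n))) ^ 2 = 1 / (4096 * n) by field_simp; norm_num]
    apply one_div_le_one_div_of_le (by norm_num) (by linarith)
  refine ⟨h1, ?_, ?_⟩
  · have h2 := ssq_tri 0 (setl 0 (1 / 4)) x
    have h3 := ssq0_setl (0 : Fin n → ℝ) (1 / 4)
    rw [setl_zero] at h3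
    have h4 : ssq (0 : Fin n → ℝ) 0 = 0 := by simp [ssq]
    rw [h4] at h3
    norm_num at h3
    linarith
  · have h2 := xlast_sq_le (setl 0 (1 / 4)) x
    rw [xlast_setl] at h2
    nlinarith

set_option maxHeartbeats 1000000 in
lemma spread (n : ℕ) [NeZero n] {γ lam Lam : ℝ} (hlam : 0 < lam) (hLam : lam ≤ Lam)
    {h : ℝ} (hh : 0 < h) (hh8 : h ≤ 1 / 8) :
    ∃ c : ℝ, 0 < c ∧ ∀ w : Pt n → ℝ, SupOn lam Lam (fun x => xlast x ^ γ) (U0 n) w →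
      ContinuousOn w (U0 n) → (∀ p ∈ U0 n, 0 ≤ w p) →
      ENNReal.ofReal ((2 * (1 / (128 * n))) ^ n * (1 / 16) / 2) ≤ volume ({p | 1 < w p} ∩ Kref n) →
      ∀ x t, xlast x = h → ssq 0 (setl x 0) ≤ 1 / 1024 → -(1 / 4) ≤ t → t < 0 → c ≤ w (x, t) := by
  have hn : 0 < n := Nat.pos_of_ne_zero (NeZero.ne n)
  have hn1 : (1:ℝ) ≤ n := by exact_mod_cast hn
  have hLam0 : 0 < Lam := hlam.trans_le hLam
  have hhg : 0 < (h / 4) ^ γ := Real.rpow_pos_of_pos (by positivity) _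
  set l := lam * min 1 ((h / 4) ^ γ) with hl
  set L := Lam * max 1 ((h / 4) ^ γ) with hL
  have hmin : 0 < min 1 ((h / 4) ^ γ) := by positivity
  have hl0 : 0 < l := by positivity
  have hlL : l ≤ L := by
    apply mul_le_mul hLam _ hmin.le hLam0.le
    exact (min_le_left _ _).trans (le_max_left _ _)
  obtain ⟨δ, θ, hδ, hδa, hθ, hsome⟩ := somewhere hn hl0 hlL
    (show (0:ℝ) < 1 / (128 * n) by positivity) (show (0:ℝ) < 1 / 16 by norm_num)
  have ha : (1:ℝ) / (128 * n) ≤ 1 / 128 := by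
    apply one_div_le_one_div_of_le (by norm_num) (by linarith)
  obtain ⟨c1, hc1, hA⟩ := spread1 n hl0 hlL hδ (by linarith)
  obtain ⟨c2, hc2, hB⟩ := spread1 n hl0 hlL (show (0:ℝ) < 1 / 32 by norm_num) (by norm_num)
  refine ⟨c2 * (c1 * θ * (1 / 64) ^ 2) * (h / 8) ^ 2, by positivity, ?_⟩
  intro w hs hw hpos hvol x t hxh hx0 ht1 ht2
  set U : Set (Pt n) := {p ∈ U0 n | h / 4 < xlast p.1} with hU
  have hUo : IsOpen U := (U0_open n).inter (isOpen_lt continuous_const xlast_continuous)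
  have hUU : U ⊆ U0 n := fun p hp => hp.1
  have hsU : SupOn l L (fun _ => 1) U w := by
    refine (hs.mono hUU).unit_g ?_
    intro p hp
    have hx1 : xlast p.1 ≤ 1 := by
      have h1 := hp.1.1
      have h2 := xlast_sq_le 0 p.1
      have h3 : xlast (0 : Fin n → ℝ) = 0 := rfl
      rw [h3] at h2
      nlinarith
    obtain ⟨b1, b2⟩ := rpow_bounds (γ := γ) (show 0 < h / 4 by positivity) hp.2.le hx1
    refine ⟨hmin.trans_le b1, ?_, ?_⟩
    · rw [hl]; gcongr
    · rw [hL]; gcongr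
  have hwU := hw.mono hUU
  have hposU : ∀ p ∈ U, 0 ≤ w p := fun p hp => hpos p hp.1
  have hroom : (Metric.closedBall (setl 0 (1 / 4)) (2 * (1 / (128 * n))) ×ˢ
      Icc (-(7 / 8) - 1 / 16) (-(7 / 8) + 2 * (1 / 16)) : Set (Pt n)) ⊆ U := by
    rintro ⟨y, s⟩ ⟨h1, h2⟩
    have h1' : ‖y - setl 0 (1 / 4)‖ ≤ 2 * (1 / (128 * n)) := by simpa [dist_eq_norm] using h1
    obtain ⟨g1, g2, g3⟩ := ref_room h1'
    simp only [mem_Icc] at h2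
    refine ⟨⟨?_, ?_, ?_, ?_⟩, ?_⟩ <;> simp only <;> linarith
  obtain ⟨X, hX, t1, ht1', hXw⟩ := hsome U w hUo hsU hwU hposU (setl 0 (1 / 4)) (-(7 / 8)) hroom (by
    refine hvol.trans (measure_mono ?_)
    rintro p ⟨h1, h2⟩
    refine ⟨⟨hroom ⟨Metric.closedBall_subset_closedBall ?_ h2.1, ?_⟩, h1⟩, h2⟩
    · have : (0:ℝ) < 1 / (128 * n) := by positivity
      linarith
    · have := h2.2
      simp only [mem_Icc] at this ⊢
      constructor <;> linarith)
  have hX' : ‖X - setl 0 (1 / 4)‖ ≤ 2 * (1 / (128 * n)) := by simpa [dist_eq_norm] using hX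
  obtain ⟨g1, g2, g3⟩ := ref_room hX'
  simp only [mem_Icc] at ht1'
  have stepA : ∀ y, ssq (setl 0 (1 / 4)) y ≤ 1 / 256 → c1 * θ * (1 / 64) ^ 2 ≤ w (y, -(1 / 2)) := by
    intro y hy
    have h1 := ssq_tri X (setl 0 (1 / 4)) y
    rw [ssq_comm X (setl 0 (1 / 4))] at h1
    have h2 : ssq X y ≤ (3 / 16) ^ 2 - 1 / 64 := by norm_num; linarith
    have := hA U w hsU hwU hposU X (3 / 16) t1 (-(1 / 2)) θ (by linarith) (by norm_num) (by linarith)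
      (by linarith) hθ ?_ ?_ y (by linarith)
    · refine le_trans ?_ this
      have : (1 / 64 : ℝ) ≤ (3 / 16) ^ 2 - ssq X y := by linarith
      gcongr
    · intro y' s h3 h4 h5
      have h6 := ssq_tri 0 X y'
      have h7 := xlast_sq_le X y'
      norm_num at h3
      have h8 : xlast X - 3 / 16 ≤ xlast y' := by nlinarith
      refine ⟨⟨?_, ?_, ?_, ?_⟩, ?_⟩ <;> simp only <;> linarith
    · intro y' h3
      exact (hXw y' (norm_le_of_ssq hδ.le h3)).le
  set z := setl x (1 / 4) with hz
  have hz0 : ssq (setl 0 (1 / 4)) z ≤ 1 / 1024 := by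
    rw [hz, ssq_setl, setl_zero]; linarith
  have hz1 : ssq 0 z ≤ 1 / 16 + 1 / 1024 := by
    rw [hz, ssq0_setl]; linarith
  have hzx : ssq z x = (h - 1 / 4) ^ 2 := by
    have := ssq_setl x x (1 / 4) h
    have h0 : ssq (setl x 0) (setl x 0) = 0 := by simp [ssq]
    rw [h0, ← hxh, setl_xlast] at this
    rw [hz, this, hxh]; ring
  have hgap : h / 8 ≤ (1 / 4 - h / 2) ^ 2 - ssq z x := by
    rw [hzx]; nlinarith
  have := hB U w hsU hwU hposU z (1 / 4 - h / 2) (-(1 / 2)) t (c1 * θ * (1 / 64) ^ 2) (by linarith)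
    (by linarith) (by linarith) (by linarith) (by positivity) ?_ ?_ x (by linarith)
  · refine le_trans ?_ this
    gcongr
  · intro y s h3 h4 h5
    have h6 := ssq_tri 0 z y
    have h7 := xlast_sq_le z y
    rw [hz, xlast_setl, ← hz] at h7
    have h8 : h / 2 ≤ xlast y := by nlinarith
    refine ⟨⟨?_, ?_, ?_, ?_⟩, ?_⟩ <;> simp only
    · nlinarith
    all_goals linarith
  · intro y hy
    apply stepA
    have := ssq_tri (setl 0 (1 / 4)) z y
    norm_num at hy
    linarith

end MBC

namespace MBC

lemma F0_of_U0 {n : ℕ} [NeZero n] : U0 n ⊆ F0 n := fun _ hp => ⟨hp.1, hp.2.1, hp.2.2.1, hp.2.2.2.le⟩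

lemma harnack_bdry (n : ℕ) [NeZero n] {γ lam Lam : ℝ} (hγ : γ < 1) (hlam : 0 < lam)
    (hLam : lam ≤ Lam) :
    ∃ δ η : ℝ, 0 < δ ∧ δ ≤ 1 / 8 ∧ 0 < η ∧ ∀ w : Pt n → ℝ,
      SupOn lam Lam (fun x => xlast x ^ γ) (U0 n) w → ContinuousOn w (F0 n) → (∀ p ∈ F0 n, 0 ≤ w p) →
      ENNReal.ofReal ((2 * (1 / (128 * n))) ^ n * (1 / 16) / 2) ≤ volume ({p | 1 < w p} ∩ Kref n) →
      ∀ p ∈ F0 n, ssq 0 p.1 < δ ^ 2 → -(1 / 8) ≤ p.2 → η * xlast p.1 ≤ w p := by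
  obtain ⟨k, hk1, hk⟩ := exists_kconst n hγ hlam hLam 1 zero_le_one
  set h : ℝ := 1 / (4096 * (k + 1)) with hh
  have hk0 : 0 < k + 1 := by linarith
  have hh0 : 0 < h := by positivity
  have hkh : (1 + k) * h = 1 / 4096 := by rw [hh]; field_simp; ring
  have hhs : h ≤ 1 / 4096 := by nlinarith
  obtain ⟨c, hc, hsp⟩ := spread (γ := γ) n hlam hLam hh0 (by linarith)
  refine ⟨h, c, hh0, by linarith, hc, ?_⟩
  intro w hs hw hpos hvol p hp hp1 hp2
  have hsp' := hsp w hs (hw.mono F0_of_U0) (fun q hq => hpos q (F0_of_U0 hq)) hvol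
  obtain ⟨q1, q2, q3, q4⟩ := hp
  have hsplit := ssq0_split p.1
  have hx0 : ssq 0 (setl p.1 0) ≤ h ^ 2 := by nlinarith [sq_nonneg (xlast p.1)]
  have hxh : xlast p.1 ≤ h := by nlinarith [ssq_nonneg 0 (setl p.1 0)]
  have hnear : ∀ y, ssq (setl p.1 0) y ≤ (1 / 64) ^ 2 → ssq 0 y ≤ 4 / 4096 := by
    intro y hy
    have := ssq_tri 0 (setl p.1 0) y
    nlinarith
  have key := bdry_barrier hγ hlam hLam hs hw (setl p.1 0) (t0 := p.2) (τ := 1 / 8) (ρ := 1 / 64)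
    (h := h) (α := c) (k := c * k) (B := c) (by norm_num) (by linarith) hc.le (by nlinarith)
    (by nlinarith) ?_ ?_ p.1 p.2 ?_ q4 hxh (by linarith) le_rfl
  · refine le_trans ?_ key
    have h1 : ssq (setl p.1 0) p.1 = xlast p.1 ^ 2 := ssq_flat p.1
    simp only [bb, h1]
    have h2 := sq_le_rpow_sg (γ := γ) q4 (by linarith : xlast p.1 ≤ 1)
    have h3 : c * xlast p.1 ^ 2 ≤ c * k * xlast p.1 ^ sg γ := by
      rw [mul_assoc]
      apply mul_le_mul_of_nonneg_left _ hc.le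
      nlinarith [sq_nonneg (xlast p.1)]
    linarith
  · intro y t h1 h2 h3 h4 h5
    have := hnear y h1
    refine ⟨?_, ?_, ?_, h2⟩ <;> simp only <;> linarith
  · intro y t h1 h2 h3 h4 h5 h6
    have hn1 := hnear y h1
    have hF : (y, t) ∈ F0 n := by
      refine ⟨?_, ?_, ?_, h2⟩ <;> simp only <;> linarith
    have hw0 := hpos _ hF
    have hs1 := rpow_sg_le hγ h2 (by linarith : xlast y ≤ 1)
    have hlin : c * xlast y + c * k * xlast y ^ sg γ ≤ c * (1 / 4096) := by
      have h7 : xlast y + k * xlast y ^ sg γ ≤ 1 / 4096 := by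
        rw [← hkh]; nlinarith
      have := mul_le_mul_of_nonneg_left h7 hc.le
      linarith
    have hss : 0 ≤ c * ssq (setl p.1 0) y := mul_nonneg hc.le (ssq_nonneg _ _)
    have htt : c * (t - p.2) ≤ 0 := by nlinarith
    simp only [bb]
    rcases h6 with h6 | h6 | h6 | h6
    · have : xlast y ^ sg γ = 0 := by rw [h6, Real.zero_rpow (by linarith [sg_one hγ])]
      rw [this, h6]; linarith
    · have : c ≤ w (y, t) := by
        apply hsp' y t h6 _ (by linarith) (by linarith)
        have := ssq0_split y
        nlinarith [sq_nonneg (xlast y)]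
      linarith
    · rw [h6]; nlinarith
    · have : c * (t - p.2) = - (c / 8) := by rw [h6]; ring
      linarith
  · rw [ssq_flat]; nlinarith

/-- Solutions in the reference half cylinder, continuous up to the flat part. -/
structure Good {n : ℕ} [NeZero n] (γ lam Lam : ℝ) (u : Pt n → ℝ) : Prop where
  sup : SupOn lam Lam (fun x => xlast x ^ γ) (U0 n) u
  sub : SupOn lam Lam (fun x => xlast x ^ γ) (U0 n) (fun p => - u p)
  cont : ContinuousOn u (F0 n)

lemma osc_step (n : ℕ) [NeZero n] {γ lam Lam : ℝ} (hγ : γ < 1) (hlam : 0 < lam)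
    (hLam : lam ≤ Lam) :
    ∃ θ δ : ℝ, 0 < θ ∧ θ ≤ 1 / 2 ∧ 0 < δ ∧ δ ≤ 1 / 8 ∧ ∀ u : Pt n → ℝ, Good γ lam Lam u →
      ∀ m M : ℝ, m ≤ M → (∀ p ∈ F0 n, m * xlast p.1 ≤ u p ∧ u p ≤ M * xlast p.1) →
      ∃ m' M' : ℝ, m ≤ m' ∧ M' ≤ M ∧ M' - m' = (1 - θ) * (M - m) ∧
        ∀ p ∈ F0 n, ssq 0 p.1 < δ ^ 2 → -(1 / 8) ≤ p.2 →
          m' * xlast p.1 ≤ u p ∧ u p ≤ M' * xlast p.1 := by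
  obtain ⟨δ, η, hδ, hδ8, hη, H⟩ := harnack_bdry n hγ hlam hLam
  refine ⟨min (η / 32) (1 / 2), δ, by positivity, min_le_right _ _, hδ, hδ8, ?_⟩
  set θ := min (η / 32) (1 / 2) with hθ
  have hθη : 32 * θ ≤ η := by have := min_le_left (η / 32) (1 / 2); linarith
  intro u hu m M hmM hb
  rcases hmM.eq_or_lt with heq | hlt
  · subst heq
    exact ⟨m, m, le_rfl, le_rfl, by ring, fun p hp _ _ => hb p hp⟩
  have hn1 : (1:ℝ) ≤ n := by exact_mod_cast Nat.pos_of_ne_zero (NeZero.ne n)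
  set κ := 32 / (M - m) with hκ
  have hd : 0 < M - m := by linarith
  have hκ0 : 0 < κ := by positivity
  have hκd : κ * (M - m) = 32 := by rw [hκ]; field_simp
  set u1 : Pt n → ℝ := fun p => κ * (u p + (-m) * p.1 (lastIdx n)) with hu1
  set u2 : Pt n → ℝ := fun p => κ * (- u p + M * p.1 (lastIdx n)) with hu2
  have hs1 : SupOn lam Lam (fun x => xlast x ^ γ) (U0 n) u1 := (hu.sup.add_lin (-m) _).const_mul hκ0
  have hs2 : SupOn lam Lam (fun x => xlast x ^ γ) (U0 n) u2 := (hu.sub.add_lin M _).const_mul hκ0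
  have hxc : Continuous fun p : Pt n => p.1 (lastIdx n) := by fun_prop
  have hc1 : ContinuousOn u1 (F0 n) := (hu.cont.add (hxc.continuousOn.const_mul _)).const_mul κ
  have hc2 : ContinuousOn u2 (F0 n) := (hu.cont.neg.add (hxc.continuousOn.const_mul _)).const_mul κ
  have hp1 : ∀ p ∈ F0 n, 0 ≤ u1 p := by
    intro p hp
    have := (hb p hp).1
    unfold xlast at this
    exact mul_nonneg hκ0.le (by linarith)
  have hp2 : ∀ p ∈ F0 n, 0 ≤ u2 p := by
    intro p hp
    have := (hb p hp).2
    unfold xlast at this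
    exact mul_nonneg hκ0.le (by linarith)
  have hcover : Kref n ⊆ ({p | 1 < u1 p} ∩ Kref n) ∪ ({p | 1 < u2 p} ∩ Kref n) := by
    intro p hp
    have h1 : ‖p.1 - setl 0 (1 / 4)‖ ≤ 2 * (1 / (128 * n)) := by
      have := hp.1
      rw [Metric.mem_closedBall, dist_eq_norm] at this
      have h0 : (0:ℝ) < 1 / (128 * n) := by positivity
      linarith
    have h2 := (ref_room h1).2.2
    have h3 : u1 p + u2 p = 32 * xlast p.1 := by
      rw [← hκd]; simp only [hu1, hu2, xlast]; ring
    by_cases h : 1 < u1 p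
    · exact Or.inl ⟨h, hp⟩
    · refine Or.inr ⟨?_, hp⟩
      simp only [mem_setOf_eq]; linarith
  set A := (2 * (1 / (128 * (n:ℝ)))) ^ n * (1 / 16) with hA
  have hA0 : 0 < A := by positivity
  have hvol : ENNReal.ofReal A = volume (Kref n) := by
    unfold Kref
    rw [vol_box _ (by positivity), hA]; congr 1; ring
  have hor : ENNReal.ofReal (A / 2) ≤ volume ({p | 1 < u1 p} ∩ Kref n) ∨
      ENNReal.ofReal (A / 2) ≤ volume ({p | 1 < u2 p} ∩ Kref n) := by
    by_contra hcon
    push Not at hcon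
    have h1 := (measure_mono hcover).trans (measure_union_le (μ := volume) _ _)
    rw [← hvol] at h1
    have h2 := ENNReal.add_lt_add hcon.1 hcon.2
    rw [← ENNReal.ofReal_add (by positivity) (by positivity), add_halves] at h2
    exact absurd h1 (not_le.mpr h2)
  have fin : ∀ x v : ℝ, 0 ≤ x → η * x ≤ κ * v → θ * (M - m) * x ≤ v := by
    intro x v hx hv
    have : 32 * θ * x ≤ κ * v := (mul_le_mul_of_nonneg_right hθη hx).trans hv
    have h2 : κ * (θ * (M - m) * x) ≤ κ * v := by
      calc κ * (θ * (M - m) * x) = κ * (M - m) * θ * x := by ring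
        _ = 32 * θ * x := by rw [hκd]
        _ ≤ _ := this
    exact le_of_mul_le_mul_left h2 hκ0
  have hθ0 : 0 < θ := by positivity
  rcases hor with h | h
  · refine ⟨m + θ * (M - m), M, by nlinarith, le_rfl, by ring, ?_⟩
    intro p hp h1 h2
    refine ⟨?_, (hb p hp).2⟩
    have := fin _ _ hp.2.2.2 (H u1 hs1 hc1 hp1 h p hp h1 h2)
    simp only [xlast] at *
    linarith
  · refine ⟨m, M - θ * (M - m), le_rfl, by nlinarith, by ring, ?_⟩
    intro p hp h1 h2
    refine ⟨(hb p hp).1, ?_⟩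
    have := fin _ _ hp.2.2.2 (H u2 hs2 hc2 hp2 h p hp h1 h2)
    simp only [xlast] at *
    linarith

lemma ssq0_smul {n : ℕ} (r : ℝ) (x : Fin n → ℝ) : ssq 0 (r • x) = r ^ 2 * ssq 0 x := by
  unfold ssq
  rw [Finset.mul_sum]
  refine Finset.sum_congr rfl fun i _ => by simp; ring

lemma xlast_smul {n : ℕ} [NeZero n] (r : ℝ) (x : Fin n → ℝ) : xlast (r • x) = r * xlast x := by
  simp [xlast]

lemma scale_F0 {n : ℕ} [NeZero n] {r s : ℝ} (hr : 0 < r) (hr1 : r ≤ 1) (hs : 0 < s) (hs1 : s ≤ 1)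
    {p : Pt n} (hp : p ∈ F0 n) :
    (r • p.1, s * p.2) ∈ F0 n ∧ ssq 0 (r • p.1) < r ^ 2 ∧ - s < s * p.2 := by
  obtain ⟨h1, h2, h3, h4⟩ := hp
  have h5 : ssq 0 (r • p.1) < r ^ 2 := by
    rw [ssq0_smul]; nlinarith [pow_pos hr 2]
  have h6 : - s < s * p.2 := by nlinarith
  refine ⟨⟨?_, ?_, ?_, ?_⟩, h5, h6⟩
  · simp only; nlinarith
  · simp only; linarith
  · simp only; nlinarith
  · simp only [xlast_smul]; positivity

lemma Good.scale {n : ℕ} [NeZero n] {γ lam Lam : ℝ} {u : Pt n → ℝ} (hu : Good γ lam Lam u)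
    (hγ : γ < 1) {r : ℝ} (hr : 0 < r) (hr1 : r ≤ 1) :
    Good γ lam Lam (fun p => r⁻¹ * u (r • p.1, r ^ (2 - γ) * p.2)) := by
  have hs : 0 < r ^ (2 - γ) := Real.rpow_pos_of_pos hr _
  have hs1 : r ^ (2 - γ) ≤ 1 := Real.rpow_le_one hr.le hr1 (by linarith)
  have hsub : U0 n ⊆ {p | ((0 : Fin n → ℝ) + r • p.1, (0:ℝ) + r ^ (2 - γ) * p.2) ∈ U0 n} := by
    intro p hp
    obtain ⟨h1, -, -⟩ := scale_F0 hr hr1 hs hs1 (F0_of_U0 hp)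
    simp only [zero_add, mem_setOf_eq]
    refine ⟨h1.1, h1.2.1, h1.2.2.1, ?_⟩
    simp only [xlast_smul]
    exact mul_pos hr hp.2.2.2
  have gen : ∀ w : Pt n → ℝ, SupOn lam Lam (fun x => xlast x ^ γ) (U0 n) w →
      SupOn lam Lam (fun x => xlast x ^ γ) (U0 n) (fun p => r⁻¹ * w (r • p.1, r ^ (2 - γ) * p.2)) := by
    intro w hw
    have h := (hw.affine 0 0 (inv_pos.mpr hr) hr hs).mono hsub
    simp only [zero_add] at h
    apply h.congr_g
    intro p hp
    rw [xlast_smul, Real.mul_rpow hr.le hp.2.2.2.le, ← mul_assoc]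
    have : r ^ (2 - γ) / r ^ 2 * r ^ γ = 1 := by
      rw [Real.rpow_sub hr, Real.rpow_two]
      have := (Real.rpow_pos_of_pos hr γ).ne'
      field_simp
    rw [this, one_mul]
  refine ⟨gen u hu.sup, ?_, ?_⟩
  · have := gen _ hu.sub
    simpa only [mul_neg] using this
  · apply ContinuousOn.mul continuousOn_const
    apply hu.cont.comp (f := fun p : Pt n => (r • p.1, r ^ (2 - γ) * p.2))
    · apply Continuous.continuousOn; fun_prop
    · intro p hp
      exact (scale_F0 hr hr1 hs hs1 hp).1

end MBC

namespace MBC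

lemma osc_iter {n : ℕ} [NeZero n] {γ lam Lam θ δ : ℝ} (hγ : γ < 1)
    (hθ1 : θ ≤ 1 / 2) (hδ : 0 < δ) (hδ8 : δ ≤ 1 / 8)
    (H : ∀ u : Pt n → ℝ, Good γ lam Lam u →
      ∀ m M : ℝ, m ≤ M → (∀ p ∈ F0 n, m * xlast p.1 ≤ u p ∧ u p ≤ M * xlast p.1) →
      ∃ m' M' : ℝ, m ≤ m' ∧ M' ≤ M ∧ M' - m' = (1 - θ) * (M - m) ∧
        ∀ p ∈ F0 n, ssq 0 p.1 < δ ^ 2 → -(1 / 8) ≤ p.2 →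
          m' * xlast p.1 ≤ u p ∧ u p ≤ M' * xlast p.1) (k : ℕ) :
    ∀ u : Pt n → ℝ, Good γ lam Lam u →
      ∀ m M : ℝ, m ≤ M → (∀ p ∈ F0 n, m * xlast p.1 ≤ u p ∧ u p ≤ M * xlast p.1) →
      ∃ m' M' : ℝ, m ≤ m' ∧ M' ≤ M ∧ M' - m' = (1 - θ) ^ k * (M - m) ∧
        ∀ p ∈ F0 n, ssq 0 p.1 < (δ ^ k) ^ 2 → -((δ ^ k) ^ (2 - γ)) < p.2 →
          m' * xlast p.1 ≤ u p ∧ u p ≤ M' * xlast p.1 := by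
  induction k with
  | zero =>
    intro u _ m M _ hb
    exact ⟨m, M, le_rfl, le_rfl, by simp, fun p hp _ _ => hb p hp⟩
  | succ k ih =>
    intro u hu m M hmM hb
    obtain ⟨m1, M1, a1, a2, a3, a4⟩ := H u hu m M hmM hb
    have hs : 0 < δ ^ (2 - γ) := Real.rpow_pos_of_pos hδ _
    have hs8 : δ ^ (2 - γ) ≤ 1 / 8 := by
      refine le_trans ?_ hδ8
      conv_rhs => rw [← Real.rpow_one δ]
      exact Real.rpow_le_rpow_of_exponent_ge hδ (by linarith) (by linarith)
    have hle1 : m1 ≤ M1 := by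
      have : 0 ≤ (1 - θ) * (M - m) := mul_nonneg (by linarith) (by linarith)
      linarith
    obtain ⟨m', M', b1, b2, b3, b4⟩ := ih _ (hu.scale hγ hδ (by linarith)) m1 M1 hle1 (by
      intro p hp
      obtain ⟨c1, c2, c3⟩ := scale_F0 hδ (by linarith) hs (by linarith) hp
      obtain ⟨d1, d2⟩ := a4 _ c1 c2 (by simp only; linarith)
      simp only [xlast_smul] at d1 d2
      rw [le_inv_mul_iff₀ hδ, inv_mul_le_iff₀ hδ]
      constructor <;> linarith)
    refine ⟨m', M', a1.trans b1, b2.trans a2, by rw [b3, a3, pow_succ]; ring, ?_⟩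
    intro p hp hp1 hp2
    have hx := hp.2.2.2
    have ht := hp.2.2.1
    have e1 : ssq 0 (δ⁻¹ • p.1) < (δ ^ k) ^ 2 := by
      rw [ssq0_smul, inv_pow, inv_mul_lt_iff₀ (by positivity)]
      calc _ < _ := hp1
        _ = _ := by ring
    have hδk : δ ^ k ≤ 1 := pow_le_one₀ hδ.le (by linarith)
    have e2 : -((δ ^ k) ^ (2 - γ)) < (δ ^ (2 - γ))⁻¹ * p.2 := by
      rw [lt_inv_mul_iff₀ hs, mul_neg, ← Real.mul_rpow hδ.le (by positivity), ← pow_succ']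
      exact hp2
    have e3 : (δ ^ k) ^ (2 - γ) ≤ 1 := Real.rpow_le_one (by positivity) hδk (by linarith)
    have hq : ((δ⁻¹ • p.1, (δ ^ (2 - γ))⁻¹ * p.2) : Pt n) ∈ F0 n := by
      refine ⟨?_, ?_, ?_, ?_⟩ <;> simp only
      · have : (δ ^ k) ^ 2 ≤ 1 := pow_le_one₀ (by positivity) hδk
        linarith
      · linarith
      · exact mul_neg_of_pos_of_neg (inv_pos.mpr hs) ht
      · rw [xlast_smul]; positivity
    have := b4 _ hq e1 e2
    simp only [smul_smul, mul_inv_cancel₀ hδ.ne', one_smul, mul_inv_cancel_left₀ hs.ne', xlast_smul] at this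
    obtain ⟨f1, f2⟩ := this
    rw [le_inv_mul_iff₀ hδ, mul_left_comm, mul_inv_cancel_left₀ hδ.ne'] at f1
    rw [inv_mul_le_iff₀ hδ, mul_left_comm, mul_inv_cancel_left₀ hδ.ne'] at f2
    exact ⟨f1, f2⟩

lemma exists_pt (n : ℕ) [NeZero n] (γ : ℝ) {r : ℝ} (hr : 0 < r) (hr1 : r ≤ 1) :
    ∃ p ∈ F0 n, 0 < xlast p.1 ∧ ssq 0 p.1 < r ^ 2 ∧ -(r ^ (2 - γ)) < p.2 := by
  have hs : 0 < min (r ^ (2 - γ)) 1 := lt_min (Real.rpow_pos_of_pos hr _) one_pos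
  have hs1 := min_le_left (r ^ (2 - γ)) 1
  have hs2 := min_le_right (r ^ (2 - γ)) 1
  have h1 := ssq0_setl (0 : Fin n → ℝ) (r / 2)
  rw [setl_zero] at h1
  have h0 : ssq (0 : Fin n → ℝ) 0 = 0 := by simp [ssq]
  refine ⟨(setl 0 (r / 2), -(min (r ^ (2 - γ)) 1 / 2)), ⟨?_, ?_, ?_, ?_⟩, ?_, ?_, ?_⟩ <;>
    simp only [xlast_setl, h1, h0] <;> nlinarith

lemma C1a_unit (n : ℕ) [NeZero n] {γ lam Lam : ℝ} (hγ : γ < 1) (hlam : 0 < lam)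
    (hLam : lam ≤ Lam) : ∃ α ∈ Ioo (0:ℝ) 1, ∃ D : ℝ, 2 ≤ D ∧ ∀ u : Pt n → ℝ, Good γ lam Lam u →
      ∀ C : ℝ, 0 ≤ C → (∀ p ∈ F0 n, |u p| ≤ C * xlast p.1) →
      ∃ a : ℝ, |a| ≤ C ∧ ∀ p ∈ F0 n, 0 < xlast p.1 →
        |u p - a * xlast p.1| ≤
          D * C * (eucNorm p.1 + |p.2| ^ ((1:ℝ) / (2 - γ))) ^ α * xlast p.1 := by
  obtain ⟨θ, δ, hθ, hθ1, hδ, hδ8, H⟩ := osc_step n hγ hlam hLam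
  have hlδ : Real.log δ < 0 := Real.log_neg hδ (by linarith)
  have hlθ : Real.log (1 - θ) < 0 := Real.log_neg (by linarith) (by linarith)
  set α := Real.log (1 - θ) / Real.log δ with hα
  have hα0 : 0 < α := div_pos_of_neg_of_neg hlθ hlδ
  have hα1 : α < 1 := by
    rw [hα, div_lt_one_of_neg hlδ]
    exact Real.log_lt_log hδ (by linarith)
  have hδα : δ ^ α = 1 - θ := by
    rw [Real.rpow_def_of_pos hδ, hα, mul_div_cancel₀ _ hlδ.ne, Real.exp_log (by linarith)]
  refine ⟨α, ⟨hα0, hα1⟩, 4, by norm_num, ?_⟩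
  intro u hu C hC hb
  have hiter := fun k => osc_iter hγ hθ1 hδ hδ8 H k u hu (-C) C (by linarith) (by
    intro p hp
    have := abs_le.mp (hb p hp)
    constructor <;> linarith)
  choose m M h1 h2 h3 h4 using hiter
  have hδk : ∀ k : ℕ, δ ^ k ≤ 1 := fun k => pow_le_one₀ hδ.le (by linarith)
  have hmM : ∀ j k, m j ≤ M k := by
    intro j k
    have hdec : ∀ i, i ≤ j + k → δ ^ (j + k) ≤ δ ^ i := fun i hi =>
      pow_le_pow_of_le_one hδ.le (by linarith) hi
    obtain ⟨p, hp, hx, hq, ht⟩ := exists_pt n γ (pow_pos hδ (j + k)) (hδk _)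
    have hin : ∀ i, i ≤ j + k → m i * xlast p.1 ≤ u p ∧ u p ≤ M i * xlast p.1 := by
      intro i hi
      apply h4 i p hp
      · exact hq.trans_le (pow_le_pow_left₀ (by positivity) (hdec i hi) 2)
      · have := Real.rpow_le_rpow (z := 2 - γ) (by positivity) (hdec i hi) (by linarith)
        linarith
    have := (hin j (by omega)).1.trans (hin k (by omega)).2
    exact le_of_mul_le_mul_right this hx
  have hbdd : BddAbove (range m) := ⟨M 0, by rintro _ ⟨j, rfl⟩; exact hmM j 0⟩
  set a := ⨆ j, m j with ha
  have ham : ∀ k, m k ≤ a := fun k => le_ciSup hbdd k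
  have haM : ∀ k, a ≤ M k := fun k => ciSup_le fun j => hmM j k
  refine ⟨a, abs_le.mpr ⟨(h1 0).trans (ham 0), (haM 0).trans (h2 0)⟩, ?_⟩
  have haC : |a| ≤ C := abs_le.mpr ⟨(h1 0).trans (ham 0), (haM 0).trans (h2 0)⟩
  intro p hp hx
  obtain ⟨q1, q2, q3, q4⟩ := hp
  set e := eucNorm p.1 with he
  have hee : e = √(ssq 0 p.1) := by rw [he, ← eucNorm_sub_zero, sub_zero]
  have he0 : 0 < e := by
    rw [hee]; apply Real.sqrt_pos.mpr
    have := ssq0_split p.1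
    nlinarith [ssq_nonneg 0 (setl p.1 0)]
  set τ := |p.2| ^ ((1:ℝ) / (2 - γ)) with hτ
  have hτ0 : 0 < τ := Real.rpow_pos_of_pos (abs_pos.mpr q3.ne) _
  set r := e + τ with hr
  have hr0 : 0 < r := by positivity
  rcases le_or_gt 1 r with hr1 | hr1
  · have h5 : 1 ≤ r ^ α := Real.one_le_rpow hr1 hα0.le
    calc |u p - a * xlast p.1| ≤ |u p| + |a * xlast p.1| := abs_sub _ _
      _ ≤ C * xlast p.1 + C * xlast p.1 := by
        rw [abs_mul, abs_of_pos hx]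
        exact add_le_add (hb p ⟨q1, q2, q3, q4⟩) (by gcongr)
      _ ≤ 4 * C * 1 * xlast p.1 := by nlinarith [mul_nonneg hC hx.le]
      _ ≤ _ := by gcongr
  · obtain ⟨k, hk1, hk2⟩ := exists_nat_pow_near_of_lt_one hr0 hr1.le hδ (by linarith)
    have hek : ssq 0 p.1 < (δ ^ k) ^ 2 := by
      have : e < δ ^ k := by linarith
      rw [hee, Real.sqrt_lt' (by positivity)] at this
      exact this
    have htk : -((δ ^ k) ^ (2 - γ)) < p.2 := by
      have h5 : τ < δ ^ k := by linarith
      have h6 := Real.rpow_lt_rpow hτ0.le h5 (by linarith : 0 < 2 - γ)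
      rw [hτ, ← Real.rpow_mul (abs_nonneg _), one_div, inv_mul_cancel₀ (by linarith), Real.rpow_one,
        abs_of_neg q3] at h6
      linarith
    obtain ⟨b1, b2⟩ := h4 k p ⟨q1, q2, q3, q4⟩ hek htk
    have c1 := ham k
    have c2 := haM k
    have c3 := h3 k
    have d1 : |u p - a * xlast p.1| ≤ (M k - m k) * xlast p.1 := by
      rw [abs_le]; constructor <;> nlinarith
    have d2 : (1 - θ) ^ (k + 1) ≤ r ^ α := by
      rw [← hδα, ← Real.rpow_natCast, ← Real.rpow_mul hδ.le, mul_comm, Real.rpow_mul hδ.le,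
        Real.rpow_natCast]
      exact Real.rpow_le_rpow (by positivity) hk1.le hα0.le
    have d3 : (1 - θ) ^ k ≤ 2 * r ^ α := by
      rw [pow_succ] at d2
      have : 0 < (1 - θ) ^ k := pow_pos (by linarith) k
      nlinarith
    rw [c3] at d1
    calc _ ≤ _ := d1
      _ ≤ (2 * r ^ α) * (C - -C) * xlast p.1 := by gcongr; linarith
      _ = _ := by ring

end MBC

namespace MBC

lemma F0_sub_closure {n : ℕ} [NeZero n] : F0 n ⊆ closure (U0 n) := by
  intro p hp
  obtain ⟨h1, h2, h3, h4⟩ := hp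
  have hc : Continuous fun ε : ℝ => ((setl p.1 (xlast p.1 + ε), p.2) : Pt n) := by
    unfold setl
    refine Continuous.prodMk (Continuous.update continuous_const _ (by fun_prop)) continuous_const
  have h0 : ((setl p.1 (xlast p.1 + 0), p.2) : Pt n) = p := by rw [add_zero, setl_xlast]
  have ht : Tendsto (fun ε : ℝ => ((setl p.1 (xlast p.1 + ε), p.2) : Pt n)) (𝓝[>] 0) (𝓝 p) := by
    have := hc.tendsto 0
    rw [h0] at this
    exact this.mono_left nhdsWithin_le_nhds
  refine mem_closure_of_tendsto ht ?_
  have e1 : ∀ᶠ q in 𝓝 p, ssq 0 q.1 < 1 :=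
    (ssq0_continuous (n := n) 0).continuousAt.eventually_lt continuousAt_const h1
  filter_upwards [ht.eventually e1, self_mem_nhdsWithin] with ε hε hε0
  refine ⟨hε, h2, h3, ?_⟩
  simp only [xlast_setl]
  have : 0 < ε := hε0
  linarith

lemma Q1p_compact (n : ℕ) [NeZero n] (γ : ℝ) : IsCompact (closure (Q1p n γ)) := by
  have hK : IsCompact (Metric.closedBall (0 : Fin n → ℝ) 1 ×ˢ Icc (-1:ℝ) 0) :=
    (isCompact_closedBall _ _).prod isCompact_Icc
  refine hK.of_isClosed_subset isClosed_closure (closure_minimal ?_ hK.isClosed)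
  intro p hp
  unfold Q1p at hp
  rw [mem_Qp one_pos, Real.one_rpow] at hp
  refine ⟨?_, hp.2.1.le, hp.2.2.1⟩
  rw [Metric.mem_closedBall, dist_eq_norm]
  exact norm_le_of_ssq zero_le_one (by linarith [hp.1])

lemma eucNorm_smul {n : ℕ} {r : ℝ} (hr : 0 ≤ r) (x : Fin n → ℝ) : eucNorm (r • x) = r * eucNorm x := by
  have h1 := eucNorm_sub_zero (r • x)
  have h2 := eucNorm_sub_zero x
  rw [sub_zero] at h1 h2
  rw [h1, h2, ssq0_smul, Real.sqrt_mul (sq_nonneg r), Real.sqrt_sq hr]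

lemma final (n : ℕ) [NeZero n] {γ lam Lam : ℝ} (hγ : γ < 1) (hlam : 0 < lam) (hLam : lam ≤ Lam) :
    ∃ abar ∈ Set.Ioo (0 : ℝ) 1, ∃ C₁ : ℝ, 1 < C₁ ∧ ModelEstimate n γ lam Lam abar C₁ := by
  obtain ⟨α, hα, D, hD, HD⟩ := C1a_unit n hγ hlam hLam
  obtain ⟨C, hC, HC⟩ := bdry_lower n hγ hlam hLam
  refine ⟨α, hα, 2 * (D * C), by nlinarith, ?_⟩
  intro u hcont hS hflat hsup
  obtain ⟨hs1, hs2⟩ := supOn_of_InS0 hLam hS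
  have hclU : closure (U0 n) ⊆ closure (Q1p n γ) := closure_mono U0_sub
  have hF0 : F0 n ⊆ closure (Q1p n γ) := F0_sub_closure.trans hclU
  have hgood : Good γ lam Lam u := ⟨hs1, hs2, hcont.mono hF0⟩
  have hQ : ∀ p ∈ Q1p n γ, |u p| ≤ 1 := by
    intro p hp
    obtain ⟨B, hB⟩ := (Q1p_compact n γ).exists_bound_of_continuousOn hcont
    refine le_trans ?_ hsup
    unfold supAbs
    exact le_ciSup (f := fun q : Q1p n γ => |u q|)
      ⟨B, by rintro _ ⟨q, rfl⟩; exact hB q (subset_closure q.2)⟩ ⟨p, hp⟩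
  have hF1 : ∀ p ∈ F0 n, |u p| ≤ 1 := by
    intro p hp
    exact le_on_closure (f := fun q => |u q|) (g := fun _ => (1:ℝ)) (s := Q1p n γ) hQ hcont.abs
      continuousOn_const (hF0 hp)
  have hflat0 : ∀ p ∈ F0 n, xlast p.1 = 0 → u p = 0 := by
    intro p hp hx
    refine hflat p ⟨⟨hF0 hp, ?_⟩, hx⟩
    intro hq
    exact absurd hq.2 (by rw [hx]; exact lt_irrefl _)
  have hlin : ∀ p ∈ F0 n, ssq 0 p.1 ≤ 1 / 4 → -(1 / 2) < p.2 → |u p| ≤ C * xlast p.1 := by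
    intro p hp h1 h2
    have a1 := HC u hs1 hgood.cont (fun q hq => (abs_le.mp (hF1 q hq)).1)
      (fun q hq hx => (hflat0 q hq hx).ge) p hp h1 h2
    have a2 := HC _ hs2 hgood.cont.neg (fun q hq => by linarith [(abs_le.mp (hF1 q hq)).2])
      (fun q hq hx => by rw [hflat0 q hq hx]; simp) p hp h1 h2
    rw [abs_le]
    constructor <;> linarith
  set s : ℝ := (1 / 2) ^ (2 - γ) with hs
  have hs0 : 0 < s := Real.rpow_pos_of_pos (by norm_num) _
  have hs12 : s ≤ 1 / 2 := by
    conv_rhs => rw [← Real.rpow_one (1 / 2 : ℝ)]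
    exact Real.rpow_le_rpow_of_exponent_ge (by norm_num) (by norm_num) (by linarith)
  have hhalf : (0:ℝ) < 1 / 2 := by norm_num
  obtain ⟨a, ha, hest⟩ := HD _ (hgood.scale hγ hhalf (by norm_num)) C (by linarith) (by
    intro p hp
    obtain ⟨c1, c2, c3⟩ := scale_F0 hhalf (by norm_num) hs0 (by linarith) hp
    have := hlin _ c1 (by simp only; linarith) (by simp only; linarith)
    simp only [xlast_smul] at this
    rw [abs_mul, abs_of_pos (inv_pos.mpr hhalf), inv_mul_le_iff₀ hhalf]
    linarith)
  refine ⟨a, by nlinarith, ?_⟩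
  set S : Set (Pt n) := {p | p ∈ Qp γ (1 / 2) (0 : Fin n → ℝ) 0 ∧ p.2 < 0} with hSdef
  have hSQ : S ⊆ Q1p n γ := by
    intro p hp
    have h1 := (mem_Qp hhalf p).mp hp.1
    unfold Q1p
    rw [mem_Qp one_pos, Real.one_rpow]
    refine ⟨by linarith [h1.1], by linarith [h1.2.1], h1.2.2⟩
  have hScl : closure (Qp γ (1 / 2) (0 : Fin n → ℝ) 0) ⊆ closure S := by
    refine closure_minimal ?_ isClosed_closure
    intro p hp
    have hpp := (mem_Qp hhalf p).mp hp
    have hc : Continuous fun ε : ℝ => ((p.1, p.2 - ε) : Pt n) := by fun_prop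
    have ht : Tendsto (fun ε : ℝ => ((p.1, p.2 - ε) : Pt n)) (𝓝[>] 0) (𝓝 p) := by
      have := hc.tendsto 0
      simp only [sub_zero] at this
      exact this.mono_left nhdsWithin_le_nhds
    refine mem_closure_of_tendsto ht ?_
    have e1 : ∀ᶠ q : Pt n in 𝓝 p, -s < q.2 :=
      continuousAt_const.eventually_lt continuous_snd.continuousAt hpp.2.1
    filter_upwards [ht.eventually e1, self_mem_nhdsWithin] with ε hε hε0
    have hε1 : 0 < ε := hε0
    refine ⟨(mem_Qp hhalf _).mpr ⟨hpp.1, hε, ?_, hpp.2.2.2⟩, ?_⟩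
    · simp only; linarith [hpp.2.2.1]
    · simp only; linarith [hpp.2.2.1]
  have hmain : ∀ p ∈ S, |u p - a * xlast p.1| ≤
      2 * (D * C) * (eucNorm p.1 + |p.2| ^ ((1 : ℝ) / (2 - γ))) ^ α * xlast p.1 := by
    intro p hp
    obtain ⟨h1, h2, -, h4⟩ := (mem_Qp hhalf p).mp hp.1
    have h3 : p.2 < 0 := hp.2
    have hq : (((2:ℝ) • p.1, s⁻¹ * p.2) : Pt n) ∈ F0 n := by
      refine ⟨?_, ?_, ?_, ?_⟩ <;> simp only
      · rw [ssq0_smul]; linarith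
      · rw [lt_inv_mul_iff₀ hs0]; linarith
      · exact mul_neg_of_pos_of_neg (inv_pos.mpr hs0) h3
      · rw [xlast_smul]; positivity
    have h5 := hest _ hq (by simp only [xlast_smul]; positivity)
    have hτ : |s⁻¹ * p.2| ^ ((1:ℝ) / (2 - γ)) = 2 * |p.2| ^ ((1:ℝ) / (2 - γ)) := by
      rw [abs_mul, abs_of_pos (inv_pos.mpr hs0), Real.mul_rpow (inv_pos.mpr hs0).le (abs_nonneg _),
        Real.inv_rpow hs0.le, hs, ← Real.rpow_mul hhalf.le, mul_one_div_cancel (by linarith),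
        Real.rpow_one]
      norm_num
    simp only [xlast_smul, eucNorm_smul zero_le_two, hτ, smul_smul] at h5
    norm_num only [one_smul] at h5
    rw [← hs, mul_inv_cancel_left₀ hs0.ne', ← mul_add] at h5
    set r := eucNorm p.1 + |p.2| ^ ((1:ℝ) / (2 - γ)) with hr
    have hr0 : 0 ≤ r := add_nonneg (Real.sqrt_nonneg _) (Real.rpow_nonneg (abs_nonneg _) _)
    have h6 : (2 * r) ^ α ≤ 2 * r ^ α := by
      rw [Real.mul_rpow zero_le_two hr0]
      apply mul_le_mul_of_nonneg_right _ (Real.rpow_nonneg hr0 _)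
      conv_rhs => rw [← Real.rpow_one 2]
      exact Real.rpow_le_rpow_of_exponent_le (by norm_num) hα.2.le
    have h7 : |2 * u p - a * (2 * xlast p.1)| = 2 * |u p - a * xlast p.1| := by
      rw [show 2 * u p - a * (2 * xlast p.1) = 2 * (u p - a * xlast p.1) by ring, abs_mul, abs_two]
    have hDC : 0 ≤ D * C := by nlinarith
    have h8 : D * C * (2 * r) ^ α * (2 * xlast p.1) ≤ D * C * (2 * r ^ α) * (2 * xlast p.1) := by
      gcongr
    have h9 : 2 * |u p - a * xlast p.1| ≤ D * C * (2 * r) ^ α * (2 * xlast p.1) := by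
      rw [← h7]
      exact h5
    linarith
  intro p hp
  have hcl : closure S ⊆ closure (Q1p n γ) := closure_mono hSQ
  have hxc := xlast_continuous (n := n)
  refine le_on_closure (f := fun p => |u p - a * xlast p.1|) (g := fun p : Pt n =>
      2 * (D * C) * (eucNorm p.1 + |p.2| ^ ((1 : ℝ) / (2 - γ))) ^ α * xlast p.1) hmain ?_ ?_ (hScl hp)
  · exact ((hcont.mono hcl).sub (hxc.continuousOn.const_mul a)).abs
  · apply Continuous.continuousOn
    refine Continuous.mul (Continuous.mul continuous_const ?_) hxc
    refine Continuous.rpow_const ?_ (fun _ => Or.inr hα.1.le)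
    refine Continuous.add ?_ ?_
    · unfold eucNorm; fun_prop
    · refine Continuous.rpow_const (by fun_prop) (fun _ => Or.inr ?_)
      have : 0 < 2 - γ := by linarith
      positivity

end MBC

/-- **Boundary `C^{1,ᾱ}` estimate for the homogeneous model problem** (Lemma 3.3). -/
theorem model_boundary_C1alpha
    (n : ℕ) [NeZero n] (hn : 2 ≤ n) (γ lam Lam : ℝ)
    (hγ : γ < 1) (hlam : 0 < lam) (hlamLam : lam ≤ Lam) :
    ∃ abar ∈ Set.Ioo (0 : ℝ) 1, ∃ C₁ : ℝ, 1 < C₁ ∧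
      ModelEstimate n γ lam Lam abar C₁ := by
  exact MBC.final n hγ hlam hlamLam
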